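/- (Estimate (5.26), mean square of R₁ — explicit core of Theorem 1) Fix an integer l ≥ 1 and an irrational θ > 0 of finite approximation type γ ≥ 1. For every ε > 0 there exist C > 0 and T₀ ≥ 3 such that for all T ≥ T₀, setting H = T²: |∫_T^{2T} R₁(x,H)² dx − (2^{3−2l}·C_{l,θ}/(π²·((l−1)!)²))·∫_T^{2T} x^{2l−1/2} dx| ≤ C·T^{2l + (4γ+1)/(8γ+4) + ε}. -/

import Mathlib

open Finset

/-- An irrational real `α` is of finite approximation type `γ` if `γ ≥ 1` and for every
`ε > 0` there is `c(ε) > 0` with `|α − p/q| ≥ c(ε)·q^{−γ−1−ε}` for all integers `p` and all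
positive integers `q`. -/
def IsApproxType (α γ : ℝ) : Prop :=
  1 ≤ γ ∧ ∀ ε : ℝ, 0 < ε → ∃ c : ℝ, 0 < c ∧
    ∀ p : ℤ, ∀ q : ℕ, 0 < q → |α - (p : ℝ) / q| ≥ c * (q : ℝ) ^ (-γ - 1 - ε)

/-- `R₁(x,H) = (2^{2−l}/((l−1)!·π)) · Σ_{1≤h≤H} ((−1)^{lh}/h) ·
Σ_{1≤m≤√(x/θ)} m·(x − θm²)^{l−1}·sin(2πh(x/(2m) − θm/2))`. -/
noncomputable def R1 (l : ℕ) (θ : ℝ) (x H : ℝ) : ℝ :=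
  ((2 : ℝ) ^ ((2 : ℤ) - l) / ((l - 1).factorial * Real.pi)) *
    ∑ h ∈ Finset.Icc 1 ⌊H⌋₊, ((-1 : ℝ) ^ (l * h) / h) *
      ∑ m ∈ Finset.Icc 1 ⌊Real.sqrt (x / θ)⌋₊,
        (m : ℝ) * (x - θ * m ^ 2) ^ (l - 1) *
          Real.sin (2 * Real.pi * h * (x / (2 * m) - θ * m / 2))

/-- `u(h,r) = (−1)^{lh}·h^{−1/4}·(2r − θh)^{−5/4}·(1 − θh/(2r − θh))^{l−1}`. -/
noncomputable def uCoef (l : ℕ) (θ : ℝ) (h r : ℕ) : ℝ :=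
  (-1 : ℝ) ^ (l * h) * (h : ℝ) ^ (-(1 : ℝ) / 4) *
    (2 * (r : ℝ) - θ * h) ^ (-(5 : ℝ) / 4) *
    (1 - θ * h / (2 * (r : ℝ) - θ * h)) ^ (l - 1)

/-- `J = ⌊(log T − log log T)/(2 log 2)⌋`. -/
noncomputable def Jdef (T : ℝ) : ℕ :=
  ⌊(Real.log T - Real.log (Real.log T)) / (2 * Real.log 2)⌋₊

/-- `R₁₁(x,H) = (2^{2−l}/((l−1)!·π))·x^{l−1/4}·Σ_{1≤h≤H}
Σ_{θh < r ≤ θh(2^{2J+1}+1/2)} u(h,r)·cos(2π√(x·h(2r − θh)) − π/4)`, with `J = Jdef T`. -/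
noncomputable def R11 (l : ℕ) (θ : ℝ) (T x H : ℝ) : ℝ :=
  ((2 : ℝ) ^ ((2 : ℤ) - l) / ((l - 1).factorial * Real.pi)) * x ^ ((l : ℝ) - 1 / 4) *
    ∑ h ∈ Finset.Icc 1 ⌊H⌋₊,
      ∑ r ∈ Finset.Ioc ⌊θ * h⌋₊ ⌊θ * h * (2 ^ (2 * Jdef T + 1) + 1 / 2)⌋₊,
        uCoef l θ h r *
          Real.cos (2 * Real.pi * Real.sqrt (x * h * (2 * (r : ℝ) - θ * h)) - Real.pi / 4)

open Classical in
/-- `C_{l,θ} = Σ_{h=1}^∞ Σ_{r > θh} (1 − θh/(2r − θh))^{2l−2}·h^{−1/2}·(2r − θh)^{−5/2}`. -/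
noncomputable def Cconst (l : ℕ) (θ : ℝ) : ℝ :=
  ∑' p : ℕ × ℕ,
    if 1 ≤ p.1 ∧ 1 ≤ p.2 ∧ θ * p.1 < (p.2 : ℝ) then
      (1 - θ * p.1 / (2 * (p.2 : ℝ) - θ * p.1)) ^ (2 * l - 2) *
        (p.1 : ℝ) ^ (-(1 : ℝ) / 2) * (2 * (p.2 : ℝ) - θ * p.1) ^ (-(5 : ℝ) / 2)
    else 0

/-- A sum of reciprocals of distinct positive integers is at most a harmonic number. -/
lemma sum_one_div_le_one_add_log (S : Finset ℕ) (h : ∀ k ∈ S, 1 ≤ k) :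
    ∑ k ∈ S, (1 : ℝ) / k ≤ 1 + Real.log (#S) := by
  have key : ∑ k ∈ S, (1 : ℝ) / k ≤ ((harmonic #S : ℚ) : ℝ) := by
    induction S using Finset.induction_on_max with
    | empty => simp
    | insert a s ha ih =>
      have hna : a ∉ s := fun h' => lt_irrefl _ (ha a h')
      rw [Finset.sum_insert hna, Finset.card_insert_of_notMem hna, harmonic_succ]
      have h1 := ih fun k hk => h k (mem_insert_of_mem hk)
      have hcard : #s + 1 ≤ a := by
        have hsub : insert a s ⊆ Icc 1 a := by
          intro k hk
          refine mem_Icc.2 ⟨h k hk, ?_⟩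
          rcases mem_insert.1 hk with rfl | hk
          · exact le_rfl
          · exact (ha k hk).le
        have := card_le_card hsub
        rw [card_insert_of_notMem hna] at this
        simpa using this
      have h2 : (1 : ℝ) / a ≤ ((#s + 1 : ℕ) : ℝ)⁻¹ := by
        rw [one_div]
        have : (0 : ℝ) < ((#s + 1 : ℕ) : ℝ) := by positivity
        gcongr
      push_cast at h2 ⊢
      linarith
  exact key.trans (harmonic_le_one_add_log _)

lemma sum_Icc_one_div_le (n : ℕ) : ∑ k ∈ Icc 1 n, (1 : ℝ) / k ≤ 1 + Real.log n := by
  simpa using sum_one_div_le_one_add_log (Icc 1 n) fun k hk => (mem_Icc.1 hk).1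

/-- One-sided reciprocal sum over a `g`-separated family. -/
lemma sum_one_div_le_of_separated {ι : Type*} (S : Finset ι) (d : ι → ℝ) {g : ℝ} (hg : 0 < g)
    (hd : ∀ i ∈ S, g ≤ d i) (hS : ∀ i ∈ S, ∀ j ∈ S, i ≠ j → g ≤ |d i - d j|) :
    ∑ i ∈ S, 1 / d i ≤ 1 / g * (1 + Real.log (#S)) := by
  classical
  have hinj : Set.InjOn (fun i => ⌊d i / g⌋₊) S := by
    intro i hi j hj hij
    by_contra hne
    have h1 := hS i hi j hj hne
    have hi0 : 0 ≤ d i / g := div_nonneg (hg.le.trans (hd i hi)) hg.le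
    have hj0 : 0 ≤ d j / g := div_nonneg (hg.le.trans (hd j hj)) hg.le
    simp only at hij
    have a1 := Nat.floor_le hi0
    have a2 := Nat.lt_floor_add_one (d i / g)
    have b1 := Nat.floor_le hj0
    have b2 := Nat.lt_floor_add_one (d j / g)
    rw [hij] at a1 a2
    have h2 : |d i / g - d j / g| < 1 := by
      rw [abs_lt]; constructor <;> linarith
    rw [← sub_div, abs_div, abs_of_pos hg, div_lt_one hg] at h2
    linarith
  have h1 : ∀ i ∈ S, 1 ≤ ⌊d i / g⌋₊ := fun i hi => by
    rw [Nat.one_le_floor_iff, le_div_iff₀ hg, one_mul]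
    exact hd i hi
  calc ∑ i ∈ S, 1 / d i ≤ ∑ i ∈ S, 1 / g * (1 / (⌊d i / g⌋₊ : ℝ)) := by
        refine sum_le_sum fun i hi => ?_
        have hi0 : 0 ≤ d i / g := div_nonneg (hg.le.trans (hd i hi)) hg.le
        have h2 : (0 : ℝ) < (⌊d i / g⌋₊ : ℝ) := by exact_mod_cast h1 i hi
        have h3 := Nat.floor_le hi0
        rw [le_div_iff₀ hg] at h3
        rw [div_mul_div_comm, one_mul]
        exact one_div_le_one_div_of_le (by positivity) (by linarith)
    _ = 1 / g * ∑ k ∈ S.image (fun i => ⌊d i / g⌋₊), (1 : ℝ) / k := by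
        rw [← mul_sum, sum_image hinj]
    _ ≤ 1 / g * (1 + Real.log (#S)) := by
        have h2 := sum_one_div_le_one_add_log (S.image (fun i => ⌊d i / g⌋₊)) (by
          intro k hk
          obtain ⟨i, hi, rfl⟩ := mem_image.1 hk
          exact h1 i hi)
        rw [card_image_of_injOn hinj] at h2
        gcongr

/-- Reciprocal distances from a point of a `g`-separated family. -/
lemma sum_one_div_dist_le {ι : Type*} [DecidableEq ι] (S : Finset ι) (f : ι → ℝ) {g : ℝ}
    (hg : 0 < g) (hS : ∀ i ∈ S, ∀ j ∈ S, i ≠ j → g ≤ |f i - f j|) {i : ι} (hi : i ∈ S) :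
    ∑ j ∈ S.erase i, 1 / |f i - f j| ≤ 2 / g * (1 + Real.log (#S)) := by
  have hcard : ∀ p : ι → Prop, [DecidablePred p] →
      1 / g * (1 + Real.log (#((S.erase i).filter p))) ≤ 1 / g * (1 + Real.log (#S)) := by
    intro p _
    rcases Nat.eq_zero_or_pos (#((S.erase i).filter p)) with h0 | h0
    · rw [h0]
      have : (1 : ℝ) ≤ #S := by exact_mod_cast card_pos.2 ⟨i, hi⟩
      have := Real.log_nonneg this
      simp only [Nat.cast_zero, Real.log_zero]
      gcongr
    · have h1 : #((S.erase i).filter p) ≤ #S :=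
        card_le_card ((filter_subset _ _).trans (erase_subset _ _))
      have h2 : (0 : ℝ) < #((S.erase i).filter p) := by exact_mod_cast h0
      gcongr
  rw [← sum_filter_add_sum_filter_not (S.erase i) (fun j => f i < f j)]
  have e : 2 / g * (1 + Real.log (#S)) =
    1 / g * (1 + Real.log (#S)) + 1 / g * (1 + Real.log (#S)) := by ring
  rw [e]
  refine add_le_add ((le_trans ?_ (sum_one_div_le_of_separated _ (fun j => f j - f i) hg ?_ ?_)).trans
    (hcard fun j => f i < f j))
    ((le_trans ?_ (sum_one_div_le_of_separated _ (fun j => f i - f j) hg ?_ ?_)).trans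
    (hcard fun j => ¬ f i < f j))
  · refine sum_le_sum fun j hj => ?_
    rw [abs_of_neg (by have := (mem_filter.1 hj).2; linarith), neg_sub]
  · intro j hj
    obtain ⟨hj1, hj2⟩ := mem_filter.1 hj
    have := hS i hi j (mem_of_mem_erase hj1) (ne_of_mem_erase hj1).symm
    rwa [abs_of_neg (by linarith), neg_sub] at this
  · intro j hj k hk hjk
    have := hS j (mem_of_mem_erase (mem_filter.1 hj).1) k (mem_of_mem_erase (mem_filter.1 hk).1) hjk
    simpa using this
  · refine sum_le_sum fun j hj => ?_
    rw [abs_of_nonneg (by have := (mem_filter.1 hj).2; linarith)]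
  · intro j hj
    obtain ⟨hj1, hj2⟩ := mem_filter.1 hj
    have := hS i hi j (mem_of_mem_erase hj1) (ne_of_mem_erase hj1).symm
    rwa [abs_of_nonneg (by linarith)] at this
  · intro j hj k hk hjk
    have := hS k (mem_of_mem_erase (mem_filter.1 hk).1) j (mem_of_mem_erase (mem_filter.1 hj).1)
      hjk.symm
    convert this using 2
    ring

/-- First derivative test with a monotone amplitude. -/
lemma abs_integral_mul_deriv_mul_cos_le {a b : ℝ} (hab : a ≤ b) {φ φ' G G' : ℝ → ℝ}
    (hφ : ∀ x ∈ Set.Icc a b, HasDerivAt φ (φ' x) x)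
    (hG : ∀ x ∈ Set.Icc a b, HasDerivAt G (G' x) x)
    (hφc : ContinuousOn φ' (Set.Icc a b)) (hGc : ContinuousOn G' (Set.Icc a b))
    (hG0 : 0 ≤ G a) (hG'0 : ∀ x ∈ Set.Icc a b, 0 ≤ G' x) :
    |∫ x in a..b, G x * (φ' x * Real.cos (φ x))| ≤ 2 * G b := by
  have hu : Set.uIcc a b = Set.Icc a b := Set.uIcc_of_le hab
  have hφcont : ContinuousOn φ (Set.Icc a b) := fun x hx => (hφ x hx).continuousAt.continuousWithinAt
  have hv : ∀ x ∈ Set.uIcc a b, HasDerivAt (fun x => Real.sin (φ x)) (φ' x * Real.cos (φ x)) x := by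
    intro x hx
    have := (hφ x (hu ▸ hx)).sin
    rwa [mul_comm] at this
  have hGi : IntervalIntegrable G' MeasureTheory.volume a b :=
    ContinuousOn.intervalIntegrable (by rwa [hu])
  have hvi : IntervalIntegrable (fun x => φ' x * Real.cos (φ x)) MeasureTheory.volume a b :=
    ContinuousOn.intervalIntegrable (by rw [hu]; exact hφc.mul (Real.continuous_cos.comp_continuousOn hφcont))
  rw [intervalIntegral.integral_mul_deriv_eq_deriv_mul (fun x hx => hG x (hu ▸ hx)) hv hGi hvi]
  have hint : ∫ x in a..b, G' x = G b - G a :=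
    intervalIntegral.integral_eq_sub_of_hasDerivAt (fun x hx => hG x (hu ▸ hx)) hGi
  have hbound : |∫ x in a..b, G' x * Real.sin (φ x)| ≤ G b - G a := by
    rw [← hint]
    refine intervalIntegral.norm_integral_le_of_norm_le (f := fun x => G' x * Real.sin (φ x)) hab ?_ hGi
    filter_upwards with x hx
    have h0 := hG'0 x ⟨hx.1.le, hx.2⟩
    rw [Real.norm_eq_abs, abs_mul, abs_of_nonneg h0]
    exact mul_le_of_le_one_right h0 (Real.abs_sin_le_one _)
  have hmono : 0 ≤ G b - G a := by
    rw [← hint]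
    exact intervalIntegral.integral_nonneg hab hG'0
  have h1 : |G b * Real.sin (φ b)| ≤ G b := by
    rw [abs_mul, abs_of_nonneg (by linarith : 0 ≤ G b)]
    exact mul_le_of_le_one_right (by linarith) (Real.abs_sin_le_one _)
  have h2 : |G a * Real.sin (φ a)| ≤ G a := by
    rw [abs_mul, abs_of_nonneg hG0]
    exact mul_le_of_le_one_right hG0 (Real.abs_sin_le_one _)
  rw [abs_le] at *
  constructor <;> linarith

open Complex in
lemma norm_integral_cexp_neg_mul_sq_le {z : ℂ} (hz : 0 ≤ z.re) (hz0 : z ≠ 0) {B Y : ℝ} (hB : 0 < B)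
    (hBY : B ≤ Y) : ‖∫ y in B..Y, cexp (-z * (y : ℂ) ^ 2)‖ ≤ 1 / (‖z‖ * B) := by
  have hu : Set.uIcc B Y = Set.Icc B Y := Set.uIcc_of_le hBY
  have hpos : ∀ y ∈ Set.uIcc B Y, 0 < y := fun y hy => hB.trans_le (hu ▸ hy).1
  have hY : 0 < Y := hB.trans_le hBY
  have hzn : 0 < ‖z‖ := norm_pos_iff.2 hz0
  have hv1 : ∀ y : ℝ, ‖cexp (-z * (y : ℂ) ^ 2)‖ ≤ 1 := by
    intro y
    rw [norm_exp, Real.exp_le_one_iff]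
    have : (-z * (y : ℂ) ^ 2).re = -(z.re * y ^ 2) := by
      rw [← ofReal_pow, re_mul_ofReal]; simp
    rw [this]
    have := mul_nonneg hz (sq_nonneg y)
    linarith
  have hdu : ∀ y ∈ Set.uIcc B Y, HasDerivAt (fun y : ℝ => -1 / (2 * z * (y : ℂ)))
      (1 / (2 * z * (y : ℂ) ^ 2)) y := by
    intro y hy
    have hy0 : (y : ℂ) ≠ 0 := ofReal_ne_zero.2 (hpos y hy).ne'
    have h1 : HasDerivAt (fun w : ℂ => -1 / (2 * z * w)) (1 / (2 * z * (y : ℂ) ^ 2)) (y : ℂ) := by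
      have := (hasDerivAt_const (y : ℂ) (-1 : ℂ)).div ((hasDerivAt_id (y : ℂ)).const_mul (2 * z))
        (by simp [hz0, hy0])
      refine HasDerivAt.congr_deriv (f := fun w : ℂ => -1 / (2 * z * w)) this ?_
      simp only [id]
      field_simp
      ring
    exact h1.comp_ofReal
  have hdv : ∀ y ∈ Set.uIcc B Y, HasDerivAt (fun y : ℝ => cexp (-z * (y : ℂ) ^ 2))
      (cexp (-z * (y : ℂ) ^ 2) * (-z * (2 * (y : ℂ)))) y := by
    intro y hy
    have h1 : HasDerivAt (fun w : ℂ => cexp (-z * w ^ 2)) (cexp (-z * (y : ℂ) ^ 2) * (-z * (2 * (y : ℂ)))) (y : ℂ) := by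
      have := (((hasDerivAt_id (y : ℂ)).pow 2).const_mul (-z)).cexp
      simpa using this
    exact h1.comp_ofReal
  have hcu : ContinuousOn (fun y : ℝ => 1 / (2 * z * (y : ℂ) ^ 2)) (Set.uIcc B Y) := by
    refine ContinuousOn.div (by fun_prop) (by fun_prop) fun y hy => ?_
    have hy0 : (y : ℂ) ≠ 0 := ofReal_ne_zero.2 (hpos y hy).ne'
    simp [hz0, hy0]
  have hibp := intervalIntegral.integral_mul_deriv_eq_deriv_mul hdu hdv hcu.intervalIntegrable
    (by apply Continuous.intervalIntegrable; fun_prop)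
  have hl : ∫ y in B..Y, cexp (-z * (y : ℂ) ^ 2) =
      ∫ y in B..Y, -1 / (2 * z * (y : ℂ)) * (cexp (-z * (y : ℂ) ^ 2) * (-z * (2 * (y : ℂ)))) := by
    refine intervalIntegral.integral_congr fun y hy => ?_
    have hy0 : (y : ℂ) ≠ 0 := ofReal_ne_zero.2 (hpos y hy).ne'
    field_simp
  have hint : IntervalIntegrable (fun y : ℝ => 1 / (2 * ‖z‖) * (1 / y ^ 2)) MeasureTheory.volume B Y := by
    refine ContinuousOn.intervalIntegrable ?_
    refine ContinuousOn.mul (by fun_prop) (ContinuousOn.div (by fun_prop) (by fun_prop) fun y hy => ?_)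
    exact pow_ne_zero _ (hpos y hy).ne'
  have hval : ∫ y in B..Y, 1 / (2 * ‖z‖) * (1 / y ^ 2) = 1 / (2 * ‖z‖) * (1 / B - 1 / Y) := by
    rw [intervalIntegral.integral_eq_sub_of_hasDerivAt (f := fun y => 1 / (2 * ‖z‖) * (-1 / y)) ?_ hint]
    · ring
    · intro y hy
      have hy0 := (hpos y hy).ne'
      have := ((hasDerivAt_const y (-1 : ℝ)).div (hasDerivAt_id y) hy0).const_mul (1 / (2 * ‖z‖))
      refine HasDerivAt.congr_deriv (f := fun y => 1 / (2 * ‖z‖) * (-1 / y)) this ?_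
      simp
  have hb : ‖∫ y in B..Y, 1 / (2 * z * (y : ℂ) ^ 2) * cexp (-z * (y : ℂ) ^ 2)‖ ≤
      1 / (2 * ‖z‖) * (1 / B - 1 / Y) := by
    rw [← hval]
    refine intervalIntegral.norm_integral_le_of_norm_le hBY ?_ hint
    filter_upwards with y hy
    have hy0 : 0 < y := hB.trans hy.1
    rw [norm_mul, norm_div, norm_mul, norm_mul, norm_pow, norm_real, Real.norm_of_nonneg hy0.le]
    refine (mul_le_of_le_one_right (by positivity) (hv1 y)).trans (le_of_eq ?_)
    simp
    field_simp
  have hend : ∀ y : ℝ, 0 < y → ‖-1 / (2 * z * (y : ℂ)) * cexp (-z * (y : ℂ) ^ 2)‖ ≤ 1 / (2 * ‖z‖) * (1 / y) := by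
    intro y hy
    rw [norm_mul, norm_div, norm_mul, norm_mul, norm_real, Real.norm_of_nonneg hy.le]
    refine (mul_le_of_le_one_right (by positivity) (hv1 y)).trans (le_of_eq ?_)
    simp
    field_simp
  rw [hl, hibp]
  calc _ ≤ 1 / (2 * ‖z‖) * (1 / Y) + 1 / (2 * ‖z‖) * (1 / B) + 1 / (2 * ‖z‖) * (1 / B - 1 / Y) :=
        (norm_sub_le _ _).trans (add_le_add ((norm_sub_le _ _).trans (add_le_add (hend Y hY) (hend B hB))) hb)
    _ = 1 / (‖z‖ * B) := by field_simp; ring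

open Complex in
/-- Truncated Fresnel integral. -/
lemma norm_fresnel_sub_le {a b : ℝ} (ha : 0 < a) (hb : 0 < b) :
    ‖(∫ y in (0 : ℝ)..b, cexp (I * a * (y : ℂ) ^ 2)) -
      ((Real.sqrt (Real.pi / a) / 2 : ℝ) : ℂ) * cexp (I * (Real.pi / 4))‖ ≤ 1 / (a * b) := by
  have step : ∀ ε : ℝ, 0 < ε → ‖(∫ y in (0 : ℝ)..b, cexp (-(ε - I * a) * (y : ℂ) ^ 2)) -
      (Real.pi / (ε - I * a)) ^ (1 / 2 : ℂ) / 2‖ ≤ 1 / (a * b) := by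
    intro ε hε
    set z : ℂ := ε - I * a with hz
    have hzre : z.re = ε := by simp [hz]
    have hzim : z.im = -a := by simp [hz]
    have hz0 : z ≠ 0 := fun h => by rw [h] at hzre; simp at hzre; linarith
    have hza : a ≤ ‖z‖ := by
      have := abs_im_le_norm z
      rwa [hzim, abs_neg, abs_of_pos ha] at this
    have hlim := MeasureTheory.intervalIntegral_tendsto_integral_Ioi (μ := MeasureTheory.volume) 0
      ((integrable_cexp_neg_mul_sq (b := z) (by rw [hzre]; exact hε)).integrableOn) Filter.tendsto_id
    rw [integral_gaussian_complex_Ioi (by rw [hzre]; exact hε)] at hlim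
    have h2 := (hlim.const_sub (∫ y in (0 : ℝ)..b, cexp (-z * (y : ℂ) ^ 2))).norm
    refine le_of_tendsto h2 ?_
    filter_upwards [Filter.eventually_ge_atTop b] with Y hY
    have hi : ∀ p q : ℝ, IntervalIntegrable (fun y : ℝ => cexp (-z * (y : ℂ) ^ 2)) MeasureTheory.volume p q :=
      fun p q => by apply Continuous.intervalIntegrable; fun_prop
    rw [id, ← intervalIntegral.integral_add_adjacent_intervals (hi 0 b) (hi b Y), sub_add_cancel_left, norm_neg]
    refine (norm_integral_cexp_neg_mul_sq_le (by rw [hzre]; exact hε.le) hz0 hb hY).trans ?_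
    gcongr
  have hc1 : Continuous fun ε : ℝ => ∫ y in (0 : ℝ)..b, cexp (-(ε - I * a) * (y : ℂ) ^ 2) :=
    intervalIntegral.continuous_parametric_intervalIntegral_of_continuous' (by fun_prop) _ _
  have hia : (Real.pi : ℂ) / ((0 : ℝ) - I * a) = ((Real.pi / a : ℝ) : ℂ) * I := by
    have : (a : ℂ) ≠ 0 := ofReal_ne_zero.2 ha.ne'
    push_cast
    rw [zero_sub, div_eq_iff (by simp [this])]
    field_simp
    simp
  have hp : 0 < Real.pi / a := by positivity
  have hc2 : ContinuousAt (fun ε : ℝ => ((Real.pi : ℂ) / (ε - I * a)) ^ (1 / 2 : ℂ) / 2) 0 := by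
    refine ContinuousAt.div_const (ContinuousAt.cpow ?_ continuousAt_const ?_) _
    · refine ContinuousAt.div continuousAt_const (by fun_prop) ?_
      simp [ha.ne']
    · rw [hia, mem_slitPlane_iff]
      right
      simp [ha.ne', Real.pi_ne_zero]
  have hval : ((Real.pi : ℂ) / ((0 : ℝ) - I * a)) ^ (1 / 2 : ℂ) / 2 =
      ((Real.sqrt (Real.pi / a) / 2 : ℝ) : ℂ) * cexp (I * (Real.pi / 4)) := by
    rw [hia, cpow_def_of_ne_zero (mul_ne_zero (ofReal_ne_zero.2 hp.ne') I_ne_zero),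
      log_ofReal_mul hp I_ne_zero, log_I, add_mul, exp_add, Real.sqrt_eq_rpow,
      Real.rpow_def_of_pos hp]
    push_cast
    ring_nf
  have ht : Filter.Tendsto (fun ε : ℝ => ‖(∫ y in (0 : ℝ)..b, cexp (-(ε - I * a) * (y : ℂ) ^ 2)) -
      (Real.pi / (ε - I * a)) ^ (1 / 2 : ℂ) / 2‖) (nhdsWithin 0 (Set.Ioi 0))
      (nhds ‖(∫ y in (0 : ℝ)..b, cexp (-((0 : ℝ) - I * a) * (y : ℂ) ^ 2)) -
      (Real.pi / ((0 : ℝ) - I * a)) ^ (1 / 2 : ℂ) / 2‖) :=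
    ((hc1.continuousAt.sub hc2).norm.tendsto).mono_left nhdsWithin_le_nhds
  rw [hval] at ht
  simp only [ofReal_zero, zero_sub, neg_neg] at ht
  refine le_of_tendsto ht ?_
  filter_upwards [self_mem_nhdsWithin] with ε hε
  exact step ε hε

/-- `e(x) = exp(2πix)`. -/
noncomputable def expTwoPi (x : ℝ) : ℂ := Complex.exp ((2 * Real.pi * x : ℝ) * Complex.I)

lemma expTwoPi_add (x y : ℝ) : expTwoPi (x + y) = expTwoPi x * expTwoPi y := by
  unfold expTwoPi
  rw [← Complex.exp_add]
  push_cast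
  ring_nf

lemma expTwoPi_natCast (n : ℕ) : expTwoPi n = 1 := by
  unfold expTwoPi
  rw [Complex.exp_eq_one_iff]
  exact ⟨n, by push_cast; ring⟩

@[simp] lemma norm_expTwoPi (x : ℝ) : ‖expTwoPi x‖ = 1 := Complex.norm_exp_ofReal_mul_I _

lemma expTwoPi_im (x : ℝ) : (expTwoPi x).im = Real.sin (2 * Real.pi * x) :=
  Complex.exp_ofReal_mul_I_im _

lemma continuous_expTwoPi : Continuous expTwoPi := by
  unfold expTwoPi
  fun_prop

lemma hasDerivAt_expTwoPi_comp {φ : ℝ → ℝ} {φ' x : ℝ} (h : HasDerivAt φ φ' x) :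
    HasDerivAt (fun t => expTwoPi (φ t))
      (((2 * Real.pi * φ' : ℝ) : ℂ) * Complex.I * expTwoPi (φ x)) x := by
  unfold expTwoPi
  have := (((h.const_mul (2 * Real.pi)).ofReal_comp).mul_const Complex.I).cexp
  exact this.congr_deriv (by push_cast; ring)

lemma norm_expTwoPi_sub_le (x y : ℝ) : ‖expTwoPi x - expTwoPi y‖ ≤ 2 * Real.pi * |x - y| := by
  have h1 : expTwoPi x - expTwoPi y = expTwoPi y * (expTwoPi (x - y) - 1) := by
    rw [mul_sub, ← expTwoPi_add, add_sub_cancel, mul_one]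
  rw [h1, norm_mul, norm_expTwoPi, one_mul]
  unfold expTwoPi
  rw [mul_comm _ Complex.I]
  refine (Real.norm_exp_I_mul_ofReal_sub_one_le (x := 2 * Real.pi * (x - y))).trans ?_
  rw [Real.norm_eq_abs, abs_mul, abs_of_pos Real.two_pi_pos]

/-- `cot(πz) - 1/(πz)`, the regular part of the cotangent at the origin. -/
noncomputable def cotReg (z : ℝ) : ℝ :=
  Real.cos (Real.pi * z) / Real.sin (Real.pi * z) - 1 / (Real.pi * z)

lemma cotReg_neg (z : ℝ) : cotReg (-z) = -cotReg z := by
  unfold cotReg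
  rw [mul_neg, Real.cos_neg, Real.sin_neg, div_neg, div_neg]
  ring

lemma cos_div_sin_le {y : ℝ} (h0 : 0 < y) (h1 : y < Real.pi) : Real.cos y / Real.sin y ≤ 1 / y := by
  have hs := Real.sin_pos_of_pos_of_lt_pi h0 h1
  rw [div_le_div_iff₀ hs h0, one_mul]
  rcases lt_or_ge y (Real.pi / 2) with h | h
  · have h2 := Real.lt_tan h0 h
    have hc : 0 < Real.cos y := Real.cos_pos_of_mem_Ioo ⟨by linarith, h⟩
    rw [Real.tan_eq_sin_div_cos, lt_div_iff₀ hc] at h2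
    linarith
  · have := Real.cos_nonpos_of_pi_div_two_le_of_le h (by linarith)
    nlinarith

lemma cotReg_nonpos {z : ℝ} (h0 : 0 ≤ z) (h1 : z < 1) : cotReg z ≤ 0 := by
  rcases h0.eq_or_lt with rfl | h0
  · simp [cotReg]
  have := cos_div_sin_le (mul_pos Real.pi_pos h0) (by nlinarith [Real.pi_pos])
  unfold cotReg
  linarith

lemma antitoneOn_cotReg_Ioo : AntitoneOn cotReg (Set.Ioo 0 1) := by
  have hpos : ∀ z ∈ Set.Ioo (0 : ℝ) 1, 0 < Real.sin (Real.pi * z) := fun z hz =>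
    Real.sin_pos_of_pos_of_lt_pi (mul_pos Real.pi_pos hz.1) (by nlinarith [Real.pi_pos, hz.2])
  have hd : ∀ z ∈ Set.Ioo (0 : ℝ) 1, HasDerivAt cotReg
      (Real.pi * (1 / (Real.pi * z) ^ 2 - 1 / Real.sin (Real.pi * z) ^ 2)) z := by
    intro z hz
    have hs := (hpos z hz).ne'
    have hz0 := hz.1.ne'
    have h1 : HasDerivAt (fun z => Real.pi * z) Real.pi z := by
      simpa using (hasDerivAt_id z).const_mul Real.pi
    have h2 := (h1.cos.div h1.sin hs).sub ((hasDerivAt_const z (1 : ℝ)).div h1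
      (mul_ne_zero Real.pi_ne_zero hz0))
    refine HasDerivAt.congr_deriv (f := cotReg) h2 ?_
    have := Real.sin_sq_add_cos_sq (Real.pi * z)
    have hpi := Real.pi_ne_zero
    field_simp
    linear_combination (-z ^ 2 * Real.pi ^ 2) * this
  refine antitoneOn_of_deriv_nonpos (convex_Ioo 0 1)
    (fun z hz => (hd z hz).continuousAt.continuousWithinAt) ?_ ?_
  · rw [interior_Ioo]
    exact fun z hz => (hd z hz).differentiableAt.differentiableWithinAt
  · rw [interior_Ioo]
    intro z hz
    rw [(hd z hz).deriv]
    have h1 := hpos z hz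
    have h2 : Real.sin (Real.pi * z) ≤ Real.pi * z := Real.sin_le (mul_pos Real.pi_pos hz.1).le
    have h3 : 1 / (Real.pi * z) ^ 2 ≤ 1 / Real.sin (Real.pi * z) ^ 2 := by gcongr
    have := Real.pi_pos
    nlinarith

lemma cotReg_antitone {u v : ℝ} (hu : -1 < u) (huv : u ≤ v) (hv : v < 1) :
    cotReg v ≤ cotReg u := by
  rcases lt_or_ge 0 u with h | h
  · exact antitoneOn_cotReg_Ioo ⟨h, by linarith⟩ ⟨by linarith, hv⟩ huv
  · have hu' : 0 ≤ cotReg u := by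
      have := cotReg_nonpos (z := -u) (by linarith) (by linarith)
      rw [cotReg_neg] at this
      linarith
    rcases lt_or_ge v 0 with h' | h'
    · have := antitoneOn_cotReg_Ioo (a := -v) (b := -u) ⟨by linarith, by linarith⟩
        ⟨by linarith, by linarith⟩ (by linarith)
      rw [cotReg_neg, cotReg_neg] at this
      linarith
    · exact (cotReg_nonpos h' hv).trans hu'

lemma abs_cotReg_le {z η : ℝ} (hη : 0 < η) (hη' : η ≤ 1 / 2) (hz : |z| ≤ 1 - η) :
    |cotReg z| ≤ 1 / η := by
  have hend : -(1 / η) ≤ cotReg (1 - η) := by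
    unfold cotReg
    have h1 : Real.pi * (1 - η) = Real.pi - Real.pi * η := by ring
    rw [h1, Real.cos_pi_sub, Real.sin_pi_sub, ← h1, neg_div]
    have h2 := cos_div_sin_le (mul_pos Real.pi_pos hη) (by nlinarith [Real.pi_pos])
    have h3 : 1 / (Real.pi * (1 - η)) ≤ 1 / (Real.pi * η) := by
      have := Real.pi_pos
      gcongr
      linarith
    have h4 : 1 / (Real.pi * η) + 1 / (Real.pi * η) ≤ 1 / η := by
      rw [← add_div, div_le_div_iff₀ (by positivity) hη]
      nlinarith [Real.pi_gt_three]
    linarith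
  rw [abs_le] at hz
  have h1 := cotReg_antitone (u := z) (v := 1 - η) (by linarith) hz.2 (by linarith)
  have h2 := cotReg_antitone (u := -(1 - η)) (v := z) (by linarith) hz.1 (by linarith)
  rw [cotReg_neg] at h2
  rw [abs_le]
  constructor <;> linarith

lemma half_sum_expTwoPi_sub_integral_linear {α Δ : ℝ} (hΔ : |Δ| < 1) :
    (1 / 2 : ℂ) * (expTwoPi α + expTwoPi (α + Δ)) - ∫ u in (0 : ℝ)..1, expTwoPi (α + Δ * u) =
      -(Complex.I / 2) * cotReg Δ * (expTwoPi (α + Δ) - expTwoPi α) := by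
  rcases eq_or_ne Δ 0 with rfl | h0
  · simp
    ring
  have hsin : Real.sin (Real.pi * Δ) ≠ 0 := by
    rw [abs_lt] at hΔ
    rcases lt_or_gt_of_ne h0 with h | h
    · exact (Real.sin_neg_of_neg_of_neg_pi_lt (by nlinarith [Real.pi_pos])
        (by nlinarith [Real.pi_pos])).ne
    · exact (Real.sin_pos_of_pos_of_lt_pi (by nlinarith [Real.pi_pos])
        (by nlinarith [Real.pi_pos])).ne'
  have hc : ((2 * Real.pi * Δ : ℝ) : ℂ) * Complex.I ≠ 0 :=
    mul_ne_zero (by exact_mod_cast mul_ne_zero Real.two_pi_pos.ne' h0) Complex.I_ne_zero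
  have hint : ∫ u in (0 : ℝ)..1, expTwoPi (α + Δ * u) =
      (expTwoPi (α + Δ) - expTwoPi α) / (((2 * Real.pi * Δ : ℝ) : ℂ) * Complex.I) := by
    have hd : ∀ u ∈ Set.uIcc (0 : ℝ) 1, HasDerivAt
        (fun u : ℝ => expTwoPi (α + Δ * u) / (((2 * Real.pi * Δ : ℝ) : ℂ) * Complex.I))
        (expTwoPi (α + Δ * u)) u := by
      intro u _
      have h1 : HasDerivAt (fun u : ℝ => α + Δ * u) Δ u := by
        simpa using ((hasDerivAt_id u).const_mul Δ).const_add α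
      exact ((hasDerivAt_expTwoPi_comp h1).div_const _).congr_deriv (mul_div_cancel_left₀ _ hc)
    rw [intervalIntegral.integral_eq_sub_of_hasDerivAt hd
      ((continuous_expTwoPi.comp (by fun_prop)).intervalIntegrable _ _)]
    simp only [mul_one, mul_zero, add_zero]
    ring
  have hz : expTwoPi Δ - 1 = 2 * Complex.I * Real.sin (Real.pi * Δ) * expTwoPi (Δ / 2) ∧
      expTwoPi Δ + 1 = 2 * Real.cos (Real.pi * Δ) * expTwoPi (Δ / 2) := by
    have e1 : expTwoPi (Δ / 2) =
        Real.cos (Real.pi * Δ) + Real.sin (Real.pi * Δ) * Complex.I := by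
      unfold expTwoPi
      rw [Complex.exp_mul_I, ← Complex.ofReal_cos, ← Complex.ofReal_sin]
      ring_nf
    have e2 : expTwoPi Δ = expTwoPi (Δ / 2) * expTwoPi (Δ / 2) := by
      rw [← expTwoPi_add, add_halves]
    have e3 : (Real.cos (Real.pi * Δ) : ℂ) ^ 2 + (Real.sin (Real.pi * Δ) : ℂ) ^ 2 = 1 := by
      exact_mod_cast (Real.cos_sq_add_sin_sq (Real.pi * Δ))
    rw [e2, e1]
    constructor
    · linear_combination e3 + (Real.sin (Real.pi * Δ) : ℂ) ^ 2 * (-1) * Complex.I_sq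
    · linear_combination (-(1 : ℂ)) * e3 + (Real.sin (Real.pi * Δ) : ℂ) ^ 2 * Complex.I_sq
  have hs' : (Real.sin (Real.pi * Δ) : ℂ) ≠ 0 := by exact_mod_cast hsin
  have hΔ' : (Δ : ℂ) ≠ 0 := by exact_mod_cast h0
  have hpi : (Real.pi : ℂ) ≠ 0 := by exact_mod_cast Real.pi_ne_zero
  rw [hint, expTwoPi_add]
  have h1 : expTwoPi α * expTwoPi Δ - expTwoPi α = expTwoPi α * (expTwoPi Δ - 1) := by ring
  have h2 : expTwoPi α + expTwoPi α * expTwoPi Δ = expTwoPi α * (expTwoPi Δ + 1) := by ring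
  rw [h1, h2, hz.1, hz.2]
  unfold cotReg
  push_cast at hs' ⊢
  field_simp
  rw [Complex.I_sq]
  ring

/-- One step of the trapezoidal rule for `∫ e(φ)`, when `φ'` is monotone. -/
lemma norm_half_sum_expTwoPi_sub_integral_le {φ φ' : ℝ → ℝ} {m : ℝ}
    (hφ : ∀ x ∈ Set.Icc m (m + 1), HasDerivAt φ (φ' x) x)
    (hmono : MonotoneOn φ' (Set.Icc m (m + 1))) (hΔ : |φ (m + 1) - φ m| < 1) :
    ‖(1 / 2 : ℂ) * (expTwoPi (φ m) + expTwoPi (φ (m + 1))) -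
      (∫ x in m..m + 1, expTwoPi (φ x)) +
      Complex.I / 2 * cotReg (φ (m + 1) - φ m) * (expTwoPi (φ (m + 1)) - expTwoPi (φ m))‖ ≤
      2 * Real.pi * (φ' (m + 1) - φ' m) := by
  set Δ := φ (m + 1) - φ m with hΔdef
  have hcont : ContinuousOn φ (Set.Icc m (m + 1)) := fun x hx =>
    (hφ x hx).continuousAt.continuousWithinAt
  have hlin := half_sum_expTwoPi_sub_integral_linear (α := φ m) hΔ
  have hφ1 : φ m + Δ = φ (m + 1) := by rw [hΔdef]; ring
  rw [hφ1] at hlin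
  have hshift : ∫ x in m..m + 1, expTwoPi (φ x) = ∫ u in (0 : ℝ)..1, expTwoPi (φ (m + u)) := by
    rw [intervalIntegral.integral_comp_add_left (fun x => expTwoPi (φ x)) m, add_zero]
  have hclose : ∀ u ∈ Set.Icc (0 : ℝ) 1, |φ (m + u) - (φ m + Δ * u)| ≤ φ' (m + 1) - φ' m := by
    intro u hu
    have hmean : ∀ y, m < y → y ≤ m + 1 → ∃ ξ ∈ Set.Icc m (m + 1), φ y - φ m = φ' ξ * (y - m) := by
      intro y h1 h2
      obtain ⟨ξ, hξ, hξ'⟩ := exists_hasDerivAt_eq_slope φ φ' h1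
        (hcont.mono (Set.Icc_subset_Icc_right h2))
        (fun x hx => hφ x ⟨hx.1.le, hx.2.le.trans h2⟩)
      refine ⟨ξ, ⟨hξ.1.le, hξ.2.le.trans h2⟩, ?_⟩
      rw [hξ', div_mul_cancel₀ _ (by linarith)]
    have hbd : ∀ ξ ∈ Set.Icc m (m + 1), φ' m ≤ φ' ξ ∧ φ' ξ ≤ φ' (m + 1) := fun ξ hξ =>
      ⟨hmono ⟨le_rfl, by linarith⟩ hξ hξ.1, hmono hξ ⟨by linarith, le_rfl⟩ hξ.2⟩
    obtain ⟨ξ₁, hξ₁, h1⟩ := hmean (m + 1) (by linarith) le_rfl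
    have hb1 := hbd ξ₁ hξ₁
    rcases hu.1.eq_or_lt with rfl | hu0
    · simp
      linarith
    obtain ⟨ξ₂, hξ₂, h2⟩ := hmean (m + u) (by linarith) (by linarith [hu.2])
    have hb2 := hbd ξ₂ hξ₂
    have h3 : φ (m + u) - (φ m + Δ * u) = (φ' ξ₂ - φ' ξ₁) * u := by
      have : Δ = φ' ξ₁ := by rw [hΔdef, h1]; ring
      rw [this]
      linear_combination h2
    rw [h3, abs_mul, abs_of_pos hu0]
    calc |φ' ξ₂ - φ' ξ₁| * u ≤ |φ' ξ₂ - φ' ξ₁| * 1 := by gcongr; exact hu.2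
      _ ≤ _ := by rw [mul_one, abs_le]; constructor <;> linarith
  have hcontu : ContinuousOn (fun u => expTwoPi (φ (m + u))) (Set.uIcc 0 1) := by
    rw [Set.uIcc_of_le zero_le_one]
    refine continuous_expTwoPi.comp_continuousOn (hcont.comp (by fun_prop) ?_)
    intro u hu
    exact ⟨by linarith [hu.1], by linarith [hu.2]⟩
  have hdiff : ‖(∫ u in (0 : ℝ)..1, expTwoPi (φ m + Δ * u)) -
      ∫ u in (0 : ℝ)..1, expTwoPi (φ (m + u))‖ ≤ 2 * Real.pi * (φ' (m + 1) - φ' m) := by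
    have hl : Continuous fun u => expTwoPi (φ m + Δ * u) := continuous_expTwoPi.comp (by fun_prop)
    rw [← intervalIntegral.integral_sub (hl.intervalIntegrable _ _) hcontu.intervalIntegrable]
    refine (intervalIntegral.norm_integral_le_of_norm_le_const
      (C := 2 * Real.pi * (φ' (m + 1) - φ' m)) ?_).trans (by simp)
    intro u hu
    rw [Set.uIoc_of_le zero_le_one] at hu
    refine (norm_expTwoPi_sub_le _ _).trans ?_
    rw [abs_sub_comm]
    have := hclose u ⟨hu.1.le, hu.2⟩
    have := Real.two_pi_pos
    gcongr
  rw [hshift]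
  refine le_of_eq_of_le (congrArg _ ?_) hdiff
  linear_combination hlin

/-- One step of the trapezoidal rule for `∫ g·e(φ)`, when `φ'` is monotone. -/
lemma norm_half_sum_mul_expTwoPi_sub_integral_le {φ φ' g g' : ℝ → ℝ} {m G G1 : ℝ}
    (hφ : ∀ x ∈ Set.Icc m (m + 1), HasDerivAt φ (φ' x) x)
    (hmono : MonotoneOn φ' (Set.Icc m (m + 1))) (hΔ : |φ (m + 1) - φ m| < 1)
    (hg : ∀ x ∈ Set.Icc m (m + 1), HasDerivAt g (g' x) x)
    (hG : |g m| ≤ G) (hG1 : ∀ x ∈ Set.Icc m (m + 1), |g' x| ≤ G1) :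
    ‖(1 / 2 : ℂ) * (g m * expTwoPi (φ m) + g (m + 1) * expTwoPi (φ (m + 1))) -
      (∫ x in m..m + 1, g x * expTwoPi (φ x)) +
      Complex.I / 2 * (g m * cotReg (φ (m + 1) - φ m)) *
        (expTwoPi (φ (m + 1)) - expTwoPi (φ m))‖ ≤
      3 / 2 * G1 + 2 * Real.pi * G * (φ' (m + 1) - φ' m) := by
  have hm : m ≤ m + 1 := by linarith
  have h0 := norm_half_sum_expTwoPi_sub_integral_le hφ hmono hΔ
  have hφc : ContinuousOn (fun x => expTwoPi (φ x)) (Set.Icc m (m + 1)) :=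
    continuous_expTwoPi.comp_continuousOn fun x hx => (hφ x hx).continuousAt.continuousWithinAt
  have hgc : ContinuousOn g (Set.Icc m (m + 1)) :=
    fun x hx => (hg x hx).continuousAt.continuousWithinAt
  have hgm : ∀ x ∈ Set.Icc m (m + 1), |g x - g m| ≤ G1 * (x - m) := by
    intro x hx
    exact norm_image_sub_le_of_norm_deriv_le_segment' (f := g) (f' := g')
      (fun y hy => (hg y hy).hasDerivWithinAt)
      (fun y hy => hG1 y ⟨hy.1, hy.2.le⟩) x hx
  have hG1' : 0 ≤ G1 := (abs_nonneg _).trans (hG1 m ⟨le_rfl, hm⟩)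
  have hint : ‖(∫ x in m..m + 1, (g x : ℂ) * expTwoPi (φ x)) -
      g m * ∫ x in m..m + 1, expTwoPi (φ x)‖ ≤ G1 := by
    rw [← intervalIntegral.integral_const_mul, ← intervalIntegral.integral_sub]
    · refine (intervalIntegral.norm_integral_le_of_norm_le_const (C := G1) ?_).trans (by simp)
      intro x hx
      rw [Set.uIoc_of_le hm] at hx
      rw [← sub_mul, norm_mul, norm_expTwoPi, mul_one, ← Complex.ofReal_sub, Complex.norm_real]
      refine (hgm x ⟨hx.1.le, hx.2⟩).trans ?_
      nlinarith [hx.1, hx.2]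
    · refine ContinuousOn.intervalIntegrable_of_Icc hm (ContinuousOn.mul ?_ hφc)
      exact Complex.continuous_ofReal.comp_continuousOn hgc
    · exact ContinuousOn.intervalIntegrable_of_Icc hm (continuousOn_const.mul hφc)
  have h2 : ‖(1 / 2 : ℂ) * ((g (m + 1) - g m) * expTwoPi (φ (m + 1)))‖ ≤ 1 / 2 * G1 := by
    rw [norm_mul, norm_mul, norm_expTwoPi, mul_one, ← Complex.ofReal_sub, Complex.norm_real]
    have := hgm (m + 1) ⟨hm, le_rfl⟩
    simp only [add_sub_cancel_left, mul_one] at this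
    rw [Real.norm_eq_abs]
    norm_num
    linarith
  have h3 : ‖(g m : ℂ) * ((1 / 2 : ℂ) * (expTwoPi (φ m) + expTwoPi (φ (m + 1))) -
      (∫ x in m..m + 1, expTwoPi (φ x)) +
      Complex.I / 2 * cotReg (φ (m + 1) - φ m) * (expTwoPi (φ (m + 1)) - expTwoPi (φ m)))‖ ≤
      G * (2 * Real.pi * (φ' (m + 1) - φ' m)) := by
    rw [norm_mul, Complex.norm_real]
    exact mul_le_mul hG h0 (norm_nonneg _) ((abs_nonneg _).trans hG)
  refine le_trans (le_of_eq_of_le (congrArg _ ?_)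
    (norm_add₃_le (a := (g m : ℂ) * ((1 / 2 : ℂ) * (expTwoPi (φ m) + expTwoPi (φ (m + 1))) -
      (∫ x in m..m + 1, expTwoPi (φ x)) +
      Complex.I / 2 * cotReg (φ (m + 1) - φ m) * (expTwoPi (φ (m + 1)) - expTwoPi (φ m))))
      (b := (1 / 2 : ℂ) * ((g (m + 1) - g m) * expTwoPi (φ (m + 1))))
      (c := -((∫ x in m..m + 1, (g x : ℂ) * expTwoPi (φ x)) -
        g m * ∫ x in m..m + 1, expTwoPi (φ x))))) ?_
  · ring
  · rw [norm_neg]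
    linarith

lemma norm_add₃_le_of_le {E : Type*} [SeminormedAddCommGroup E] {x y z : E} {u v w : ℝ}
    (hx : ‖x‖ ≤ u) (hy : ‖y‖ ≤ v) (hz : ‖z‖ ≤ w) : ‖x + y + z‖ ≤ u + v + w :=
  norm_add_le_of_le (norm_add_le_of_le hx hy) hz

lemma exists_slope_eq_deriv {φ φ' : ℝ → ℝ} {u v : ℝ} (huv : u < v)
    (hφ : ∀ x ∈ Set.Icc u v, HasDerivAt φ (φ' x) x) :
    ∃ ξ ∈ Set.Icc u v, φ v - φ u = φ' ξ * (v - u) := by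
  obtain ⟨ξ, hξ, hξ'⟩ := exists_hasDerivAt_eq_slope φ φ' huv
    (fun x hx => (hφ x hx).continuousAt.continuousWithinAt)
    (fun x hx => hφ x ⟨hx.1.le, hx.2.le⟩)
  exact ⟨ξ, ⟨hξ.1.le, hξ.2.le⟩, by rw [hξ', div_mul_cancel₀ _ (by linarith)]⟩

lemma norm_sum_trapezoid_sub_integral_le {φ φ' g g' : ℝ → ℝ} {A G G1 η : ℝ} {N : ℕ}
    (hη : 0 < η) (hη' : η ≤ 1 / 2)
    (hφ : ∀ x ∈ Set.Icc A (A + N), HasDerivAt φ (φ' x) x)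
    (hmono : MonotoneOn φ' (Set.Icc A (A + N)))
    (hφ' : ∀ x ∈ Set.Icc A (A + N), |φ' x| ≤ 1 - η)
    (hg : ∀ x ∈ Set.Icc A (A + N), HasDerivAt g (g' x) x)
    (hG : ∀ x ∈ Set.Icc A (A + N), |g x| ≤ G)
    (hG1 : ∀ x ∈ Set.Icc A (A + N), |g' x| ≤ G1) (n : ℕ) (hn : n + 1 ≤ N) :
    ‖(∑ k ∈ range (n + 1), (1 / 2 : ℂ) * (g (A + k) * expTwoPi (φ (A + k)) +
        g (A + k + 1) * expTwoPi (φ (A + k + 1)))) -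
      (∫ x in A..A + n + 1, g x * expTwoPi (φ x)) +
      Complex.I / 2 * (g (A + n) * cotReg (φ (A + n + 1) - φ (A + n))) *
        expTwoPi (φ (A + n + 1))‖ ≤
      (n + 1) * (3 / 2 * G1 + G1 / (2 * η)) + 2 * Real.pi * G * (φ' (A + n + 1) - φ' A) +
        G / 2 * (cotReg (φ (A + 1) - φ A) - cotReg (φ (A + n + 1) - φ (A + n))) +
        G / (2 * η) := by
  have hsub : ∀ k : ℕ, k + 1 ≤ N → Set.Icc (A + k) (A + k + 1) ⊆ Set.Icc A (A + N) := by
    intro k hk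
    have : (k : ℝ) + 1 ≤ N := by exact_mod_cast hk
    exact Set.Icc_subset_Icc (by linarith [k.cast_nonneg (α := ℝ)]) (by linarith)
  have hlt : ∀ k : ℕ, (A + k : ℝ) < A + k + 1 := fun k => by linarith
  have hΔ : ∀ k : ℕ, k + 1 ≤ N → ∃ ξ ∈ Set.Icc (A + k) (A + k + 1),
      φ (A + k + 1) - φ (A + k) = φ' ξ := by
    intro k hk
    obtain ⟨ξ, hξ, h⟩ := exists_slope_eq_deriv (hlt k) (fun x hx => hφ x (hsub k hk hx))
    exact ⟨ξ, hξ, by rw [h]; ring⟩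
  have hΔabs : ∀ k : ℕ, k + 1 ≤ N → |φ (A + k + 1) - φ (A + k)| ≤ 1 - η := by
    intro k hk
    obtain ⟨ξ, hξ, h⟩ := hΔ k hk
    rw [h]
    exact hφ' ξ (hsub k hk hξ)
  have hstep : ∀ k : ℕ, k + 1 ≤ N → _ := fun k hk =>
    norm_half_sum_mul_expTwoPi_sub_integral_le (m := A + k) (G := G) (G1 := G1)
      (fun x hx => hφ x (hsub k hk hx)) (hmono.mono (hsub k hk))
      (by linarith [hΔabs k hk]) (fun x hx => hg x (hsub k hk hx))
      (hG _ (hsub k hk ⟨le_rfl, (hlt k).le⟩)) (fun x hx => hG1 x (hsub k hk hx))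
  have hcot : ∀ k : ℕ, k + 1 ≤ N → |cotReg (φ (A + k + 1) - φ (A + k))| ≤ 1 / η :=
    fun k hk => abs_cotReg_le hη hη' (hΔabs k hk)
  have hG0 : 0 ≤ G := (abs_nonneg _).trans (hG A ⟨le_rfl, by linarith [N.cast_nonneg (α := ℝ)]⟩)
  have hG10 : 0 ≤ G1 := (abs_nonneg _).trans (hG1 A ⟨le_rfl, by linarith [N.cast_nonneg (α := ℝ)]⟩)
  have hwE : ∀ k : ℕ, k + 1 ≤ N → ∀ z : ℝ, ‖Complex.I / 2 *
      ((g (A + k) : ℂ) * cotReg (φ (A + k + 1) - φ (A + k))) * expTwoPi z‖ ≤ G / (2 * η) := by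
    intro k hk z
    rw [norm_mul, norm_expTwoPi, mul_one, norm_mul, norm_mul, Complex.norm_real, Complex.norm_real,
      norm_div, Complex.norm_I]
    have h1 := hG _ (hsub k hk ⟨le_rfl, (hlt k).le⟩)
    have h2 := hcot k hk
    have h3 := mul_le_mul h1 h2 (abs_nonneg _) hG0
    have h4 : G / (2 * η) = 1 / 2 * (G * (1 / η)) := by ring
    rw [h4]
    simpa using h3
  have hFint : ∀ u v : ℝ, A ≤ u → u ≤ v → v ≤ A + N →
      IntervalIntegrable (fun x => (g x : ℂ) * expTwoPi (φ x)) MeasureTheory.volume u v := by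
    intro u v h1 h2 h3
    have hs : Set.Icc u v ⊆ Set.Icc A (A + N) := Set.Icc_subset_Icc h1 h3
    refine ContinuousOn.intervalIntegrable_of_Icc h2 (ContinuousOn.mul ?_ ?_)
    · exact Complex.continuous_ofReal.comp_continuousOn
        fun x hx => (hg x (hs hx)).continuousAt.continuousWithinAt
    · exact continuous_expTwoPi.comp_continuousOn
        fun x hx => (hφ x (hs hx)).continuousAt.continuousWithinAt
  induction n with
  | zero =>
    have h0 := hstep 0 hn
    have h1 := hwE 0 hn (φ (A + 0))
    simp only [Nat.cast_zero, add_zero, zero_add, range_one, sum_singleton, sub_self, mul_zero,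
      one_mul] at h0 h1 ⊢
    have h2 := norm_add_le_of_le h0 h1
    refine le_trans (le_of_eq_of_le (congrArg _ ?_) h2) ?_
    · ring
    · have : 0 ≤ G1 / (2 * η) := by positivity
      linarith
  | succ n ih =>
    have hn' : n + 1 ≤ N := by omega
    have hnN : (n : ℝ) + 1 + 1 ≤ N := by exact_mod_cast hn
    have hn0 := n.cast_nonneg (α := ℝ)
    have h0 := hstep (n + 1) hn
    have hih := ih hn'
    have hadd := intervalIntegral.integral_add_adjacent_intervals
      (hFint A (A + n + 1) le_rfl (by linarith) (by linarith))
      (hFint (A + n + 1) (A + n + 1 + 1) (by linarith) (by linarith) (by linarith))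
    obtain ⟨ξ₁, hξ₁, h1⟩ := hΔ n hn'
    obtain ⟨ξ₂, hξ₂, h2⟩ := hΔ (n + 1) hn
    have hc1 := hΔabs n hn'
    have hc2 := hΔabs (n + 1) hn
    have hcb := hcot (n + 1) hn
    have hcb' := hcot n hn'
    rw [sum_range_succ]
    push_cast at h0 h2 hξ₂ hc2 hcb ⊢
    simp only [← add_assoc] at h0 h2 hξ₂ hc2 hcb ⊢
    rw [← hadd]
    have hord : φ (A + n + 1) - φ (A + n) ≤ φ (A + n + 1 + 1) - φ (A + n + 1) := by
      rw [h1, h2]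
      refine hmono (hsub n hn' hξ₁) (hsub (n + 1) hn ?_) (hξ₁.2.trans hξ₂.1)
      push_cast
      simpa only [← add_assoc] using hξ₂
    set c1 := cotReg (φ (A + n + 1) - φ (A + n)) with hc1def
    set c2 := cotReg (φ (A + n + 1 + 1) - φ (A + n + 1)) with hc2def
    have hanti : c2 ≤ c1 := by
      rw [abs_le] at hc1 hc2
      exact cotReg_antitone (by linarith [hc1.1]) hord (by linarith [hc2.2])
    have hgd : |g (A + n + 1) - g (A + n)| ≤ G1 := by
      have := norm_image_sub_le_of_norm_deriv_le_segment' (f := g) (f' := g') (C := G1)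
        (a := A + n) (b := A + n + 1)
        (fun y hy => (hg y (hsub n hn' hy)).hasDerivWithinAt)
        (fun y hy => hG1 y (hsub n hn' ⟨hy.1, hy.2.le⟩)) (A + n + 1) ⟨(hlt n).le, le_rfl⟩
      simpa using this
    have hgn := hG (A + n) (hsub n hn' ⟨le_rfl, (hlt n).le⟩)
    have hw : ‖Complex.I / 2 * ((g (A + n + 1) * c2 - g (A + n) * c1 : ℝ) : ℂ) *
        expTwoPi (φ (A + n + 1))‖ ≤ G1 / (2 * η) + G / 2 * (c1 - c2) := by
      rw [norm_mul, norm_expTwoPi, mul_one, norm_mul, Complex.norm_real, norm_div, Complex.norm_I]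
      have e : g (A + n + 1) * c2 - g (A + n) * c1 =
        (g (A + n + 1) - g (A + n)) * c2 + g (A + n) * (c2 - c1) := by ring
      have e1 : |(g (A + n + 1) - g (A + n)) * c2| ≤ G1 * (1 / η) := by
        rw [abs_mul]
        exact mul_le_mul hgd hcb (abs_nonneg _) hG10
      have e2 : |g (A + n) * (c2 - c1)| ≤ G * (c1 - c2) := by
        rw [abs_mul, abs_sub_comm, abs_of_nonneg (sub_nonneg.2 hanti)]
        exact mul_le_mul_of_nonneg_right hgn (sub_nonneg.2 hanti)
      rw [e, Real.norm_eq_abs]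
      have e3 := (abs_add_le _ _).trans (add_le_add e1 e2)
      have e4 : G1 / (2 * η) + G / 2 * (c1 - c2) = 1 / 2 * (G1 * (1 / η) + G * (c1 - c2)) := by
        ring
      rw [e4]
      norm_num at e3 ⊢
      linarith
    refine le_trans (le_of_eq_of_le (congrArg _ ?_)
      (norm_add₃_le_of_le hih h0 hw)) ?_
    · push_cast
      ring
    · linarith

/-- Sums against integrals over an interval of integers (Euler summation to second order). -/
lemma norm_sum_range_mul_expTwoPi_sub_integral_le {φ φ' g g' : ℝ → ℝ} {A G G1 η : ℝ} {N : ℕ}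
    (hη : 0 < η) (hη' : η ≤ 1 / 2)
    (hφ : ∀ x ∈ Set.Icc A (A + N), HasDerivAt φ (φ' x) x)
    (hmono : MonotoneOn φ' (Set.Icc A (A + N)))
    (hφ' : ∀ x ∈ Set.Icc A (A + N), |φ' x| ≤ 1 - η)
    (hg : ∀ x ∈ Set.Icc A (A + N), HasDerivAt g (g' x) x)
    (hG : ∀ x ∈ Set.Icc A (A + N), |g x| ≤ G)
    (hG1 : ∀ x ∈ Set.Icc A (A + N), |g' x| ≤ G1) :
    ‖(∑ k ∈ range (N + 1), g (A + k) * expTwoPi (φ (A + k))) -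
      ∫ x in A..A + N, g x * expTwoPi (φ x)‖ ≤ (9 * G + 3 * G1 * N) / η := by
  have hN := N.cast_nonneg (α := ℝ)
  have hA : A ∈ Set.Icc A (A + N) := ⟨le_rfl, by linarith⟩
  have hG0 : 0 ≤ G := (abs_nonneg _).trans (hG A hA)
  have hG10 : 0 ≤ G1 := (abs_nonneg _).trans (hG1 A hA)
  have hηi : 2 ≤ 1 / η := by rw [le_div_iff₀ hη]; linarith
  have hF : ∀ x ∈ Set.Icc A (A + N), ‖(g x : ℂ) * expTwoPi (φ x)‖ ≤ G := by
    intro x hx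
    rw [norm_mul, norm_expTwoPi, mul_one, Complex.norm_real]
    exact hG x hx
  obtain _ | n := N
  · have := hF A hA
    simp only [Nat.cast_zero, add_zero, zero_add, range_one, sum_singleton,
      intervalIntegral.integral_same, sub_zero, mul_zero]
    refine this.trans ?_
    rw [le_div_iff₀ hη]
    nlinarith
  · have h := norm_sum_trapezoid_sub_integral_le hη hη' hφ hmono hφ' hg hG hG1 n le_rfl
    set F : ℝ → ℂ := fun x => (g x : ℂ) * expTwoPi (φ x) with hFdef
    have htrap : ∑ k ∈ range (n + 1), (1 / 2 : ℂ) * (F (A + k) + F (A + k + 1)) =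
        ∑ k ∈ range (n + 1 + 1), F (A + k) - 1 / 2 * F A - 1 / 2 * F (A + n + 1) := by
      rw [← mul_sum, sum_add_distrib]
      have e1 := sum_range_succ (fun k : ℕ => F (A + k)) (n + 1)
      have e2 := sum_range_succ' (fun k : ℕ => F (A + k)) (n + 1)
      push_cast at e1 e2
      simp only [← add_assoc, add_zero] at e1 e2
      linear_combination (-1 / 2 : ℂ) * e1 - (1 / 2 : ℂ) * e2
    have hx0 : A + (n : ℝ) + 1 = A + ((n + 1 : ℕ) : ℝ) := by push_cast; ring
    have hsubn : ∀ k : ℕ, k ≤ n → Set.Icc (A + k) (A + k + 1) ⊆ Set.Icc A (A + (n + 1 : ℕ)) := by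
      intro k hk
      have : (k : ℝ) ≤ n := by exact_mod_cast hk
      rw [← hx0]
      exact Set.Icc_subset_Icc (by linarith [k.cast_nonneg (α := ℝ)]) (by linarith)
    have hcot : ∀ k : ℕ, k ≤ n → |cotReg (φ (A + k + 1) - φ (A + k))| ≤ 1 / η := by
      intro k hk
      refine abs_cotReg_le hη hη' ?_
      obtain ⟨ξ, hξ, e⟩ := exists_slope_eq_deriv (by linarith : A + (k : ℝ) < A + k + 1)
        (fun x hx => hφ x (hsubn k hk hx))
      rw [e, show A + (k : ℝ) + 1 - (A + k) = 1 by ring, mul_one]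
      exact hφ' ξ (hsubn k hk hξ)
    have hc0 := hcot 0 (Nat.zero_le _)
    have hcn := hcot n le_rfl
    have hlast : A + (n : ℝ) + 1 ∈ Set.Icc A (A + (n + 1 : ℕ)) := by
      rw [hx0]; exact ⟨by linarith, le_rfl⟩
    have hpre : A + (n : ℝ) ∈ Set.Icc A (A + (n + 1 : ℕ)) :=
      hsubn n le_rfl ⟨le_rfl, by linarith⟩
    have hb1 := hφ' _ hlast
    have hb2 := hφ' _ hA
    have hw : ‖Complex.I / 2 * (g (A + n) * cotReg (φ (A + n + 1) - φ (A + n))) *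
        expTwoPi (φ (A + n + 1))‖ ≤ G / (2 * η) := by
      rw [norm_mul, norm_expTwoPi, mul_one, norm_mul, norm_mul, Complex.norm_real,
        Complex.norm_real, norm_div, Complex.norm_I]
      have h3 := mul_le_mul (hG _ hpre) hcn (abs_nonneg _) hG0
      have h4 : G / (2 * η) = 1 / 2 * (G * (1 / η)) := by ring
      rw [h4]
      simpa using h3
    rw [htrap] at h
    have hFA : ‖(1 / 2 : ℂ) * F A‖ ≤ G / 2 := by
      rw [norm_mul]
      have := hF A hA
      norm_num
      linarith
    have hFl : ‖(1 / 2 : ℂ) * F (A + n + 1)‖ ≤ G / 2 := by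
      rw [norm_mul]
      have := hF _ hlast
      norm_num
      linarith
    rw [← hx0]
    have h' := norm_add_le_of_le (norm_add₃_le_of_le h hFA hFl) ((norm_neg _).trans_le hw)
    refine le_trans (le_of_eq_of_le (congrArg _ ?_) h') ?_
    · ring
    · rw [Nat.cast_zero, add_zero] at hc0
      rw [abs_le] at hb1 hb2 hc0 hcn
      have i1 : 2 * Real.pi * G * (φ' (A + n + 1) - φ' A) ≤ 13 * G := by
        have : φ' (A + n + 1) - φ' A ≤ 2 := by linarith [hb1.2, hb2.1]
        have hp := Real.pi_lt_d2
        have hp0 := Real.pi_pos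
        have : 2 * Real.pi * (φ' (A + n + 1) - φ' A) ≤ 13 := by nlinarith
        nlinarith
      have i2 : G / 2 * (cotReg (φ (A + 1) - φ A) - cotReg (φ (A + n + 1) - φ (A + n))) ≤
          G / 2 * (2 * (1 / η)) := by
        gcongr
        linarith [hc0.2, hcn.1]
      have i3 : G / (2 * η) = 1 / 2 * (G * (1 / η)) := by ring
      have i4 : G1 / (2 * η) = 1 / 2 * (G1 * (1 / η)) := by ring
      have i5 : (9 * G + 3 * G1 * ((n + 1 : ℕ) : ℝ)) / η =
        9 * (G * (1 / η)) + (n + 1) * (3 * (G1 * (1 / η))) := by push_cast; ring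
      rw [i5, i3, i4]
      have i6 : 2 * G ≤ G * (1 / η) := by nlinarith
      have i7 : (n + 1 : ℝ) * (3 / 2 * G1 + 1 / 2 * (G1 * (1 / η))) ≤
          (n + 1) * (3 * (G1 * (1 / η))) := by
        gcongr
        nlinarith
      nlinarith

/-- A truncated Poisson summation formula in the range where a single frequency matters. -/
lemma norm_sum_Ioc_mul_expTwoPi_sub_integral_le {φ φ' g g' : ℝ → ℝ} {a b G G1 η : ℝ}
    (ha : 0 ≤ a) (hab : a ≤ b) (hη : 0 < η) (hη' : η ≤ 1 / 2)
    (hφ : ∀ x ∈ Set.Icc a b, HasDerivAt φ (φ' x) x)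
    (hmono : MonotoneOn φ' (Set.Icc a b))
    (hφ' : ∀ x ∈ Set.Icc a b, |φ' x| ≤ 1 - η)
    (hg : ∀ x ∈ Set.Icc a b, HasDerivAt g (g' x) x)
    (hG : ∀ x ∈ Set.Icc a b, |g x| ≤ G)
    (hG1 : ∀ x ∈ Set.Icc a b, |g' x| ≤ G1) :
    ‖(∑ m ∈ Ioc ⌊a⌋₊ ⌊b⌋₊, g m * expTwoPi (φ m)) - ∫ x in a..b, g x * expTwoPi (φ x)‖ ≤
      10 * (G + G1 * (b - a)) / η := by
  have haI : a ∈ Set.Icc a b := ⟨le_rfl, hab⟩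
  have hG0 : 0 ≤ G := (abs_nonneg _).trans (hG a haI)
  have hG10 : 0 ≤ G1 := (abs_nonneg _).trans (hG1 a haI)
  have hFint : ∀ u v : ℝ, a ≤ u → u ≤ v → v ≤ b →
      IntervalIntegrable (fun x => (g x : ℂ) * expTwoPi (φ x)) MeasureTheory.volume u v := by
    intro u v h1 h2 h3
    have hs : Set.Icc u v ⊆ Set.Icc a b := Set.Icc_subset_Icc h1 h3
    refine ContinuousOn.intervalIntegrable_of_Icc h2 (ContinuousOn.mul ?_ ?_)
    · exact Complex.continuous_ofReal.comp_continuousOn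
        fun x hx => (hg x (hs hx)).continuousAt.continuousWithinAt
    · exact continuous_expTwoPi.comp_continuousOn
        fun x hx => (hφ x (hs hx)).continuousAt.continuousWithinAt
  have hshort : ∀ u v : ℝ, a ≤ u → u ≤ v → v ≤ b → v - u ≤ 1 →
      ‖∫ x in u..v, (g x : ℂ) * expTwoPi (φ x)‖ ≤ G := by
    intro u v h1 h2 h3 h4
    refine (intervalIntegral.norm_integral_le_of_norm_le_const (C := G) ?_).trans ?_
    · intro x hx
      rw [Set.uIoc_of_le h2] at hx
      rw [norm_mul, norm_expTwoPi, mul_one, Complex.norm_real]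
      exact hG x ⟨by linarith [hx.1], by linarith [hx.2]⟩
    · rw [abs_of_nonneg (by linarith)]
      nlinarith
  have hp := Nat.floor_le ha
  have hp' := Nat.lt_floor_add_one a
  have hq := Nat.floor_le (ha.trans hab)
  have hq' := Nat.lt_floor_add_one b
  have hpq : ⌊a⌋₊ ≤ ⌊b⌋₊ := Nat.floor_mono hab
  have hfin : 10 * (G + G1 * (b - a)) / η = 10 * (G / η) + 10 * (G1 * (b - a) / η) := by ring
  have h1η : G ≤ 1 / 2 * (G / η) := by
    have : 2 * G ≤ G / η := by rw [le_div_iff₀ hη]; nlinarith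
    linarith
  have hpos : 0 ≤ G1 * (b - a) / η :=
    div_nonneg (mul_nonneg hG10 (sub_nonneg.2 hab)) hη.le
  rcases hpq.eq_or_lt with h | h
  · rw [← h, Ioc_self, sum_empty, zero_sub, norm_neg]
    rw [← h] at hq'
    refine (hshort a b le_rfl hab le_rfl (by linarith)).trans ?_
    rw [hfin]
    nlinarith [div_nonneg hG0 hη.le]
  · obtain ⟨N, hN⟩ : ∃ N, ⌊b⌋₊ = ⌊a⌋₊ + 1 + N := ⟨⌊b⌋₊ - (⌊a⌋₊ + 1), by omega⟩
    set A : ℝ := ⌊a⌋₊ + 1 with hA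
    have hAN : A + N = ⌊b⌋₊ := by rw [hN]; push_cast; ring
    have hsub : Set.Icc A (A + N) ⊆ Set.Icc a b := by
      rw [hAN]; exact Set.Icc_subset_Icc hp'.le hq
    have key := norm_sum_range_mul_expTwoPi_sub_integral_le (N := N) hη hη'
      (fun x hx => hφ x (hsub hx)) (hmono.mono hsub) (fun x hx => hφ' x (hsub hx))
      (fun x hx => hg x (hsub hx)) (fun x hx => hG x (hsub hx)) (fun x hx => hG1 x (hsub hx))
    have hsum : ∑ m ∈ Ioc ⌊a⌋₊ ⌊b⌋₊, (g m : ℂ) * expTwoPi (φ m) =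
        ∑ k ∈ range (N + 1), (g (A + k) : ℂ) * expTwoPi (φ (A + k)) := by
      have e : Ioc ⌊a⌋₊ ⌊b⌋₊ = Ico (⌊a⌋₊ + 1) (⌊a⌋₊ + 1 + (N + 1)) := by
        ext m
        simp only [mem_Ioc, mem_Ico]
        omega
      rw [e, sum_Ico_eq_sum_range, add_tsub_cancel_left]
      refine sum_congr rfl fun k _ => ?_
      push_cast
      rfl
    have hAb : A + N ≤ b := by rw [hAN]; exact hq
    have hNr := N.cast_nonneg (α := ℝ)
    have i1 := intervalIntegral.integral_add_adjacent_intervals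
      (hFint a A le_rfl hp'.le (by linarith)) (hFint A (A + N) hp'.le (by linarith) hAb)
    have i2 := intervalIntegral.integral_add_adjacent_intervals
      (hFint a (A + N) le_rfl (by linarith) hAb) (hFint (A + N) b (by linarith) hAb le_rfl)
    have s1 := hshort a A le_rfl hp'.le (by linarith) (by linarith)
    have s2 := hshort (A + N) b (by linarith) hAb le_rfl (by rw [hAN]; linarith)
    rw [hsum, ← i2, ← i1]
    have h' := norm_add₃_le_of_le key ((norm_neg _).trans_le s1) ((norm_neg _).trans_le s2)
    refine le_trans (le_of_eq_of_le (congrArg _ ?_) h') ?_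
    · ring
    · have j1 : G1 * N / η ≤ G1 * (b - a) / η := by
        gcongr
        linarith
      have j2 : (9 * G + 3 * G1 * N) / η = 9 * (G / η) + 3 * (G1 * N / η) := by ring
      rw [hfin, j2]
      linarith

/-- The stationary phase integral `∫₀^Y e(Λy²) dy`. -/
lemma norm_integral_expTwoPi_sq_sub_le {Λ Y : ℝ} (hΛ : 0 < Λ) (hY : 0 < Y) :
    ‖(∫ y in (0 : ℝ)..Y, expTwoPi (Λ * y ^ 2)) -
      ((1 / (2 * Real.sqrt (2 * Λ)) : ℝ) : ℂ) * expTwoPi (1 / 8)‖ ≤ 1 / (Λ * Y) := by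
  have hpi := Real.pi_pos
  have h := norm_fresnel_sub_le (a := 2 * Real.pi * Λ) (by positivity) hY
  have e1 : Real.sqrt (Real.pi / (2 * Real.pi * Λ)) / 2 = 1 / (2 * Real.sqrt (2 * Λ)) := by
    rw [show Real.pi / (2 * Real.pi * Λ) = 1 / (2 * Λ) by field_simp, Real.sqrt_div zero_le_one,
      Real.sqrt_one, div_div, mul_comm]
  have e2 : Complex.exp (Complex.I * (Real.pi / 4)) = expTwoPi (1 / 8) := by
    unfold expTwoPi
    congr 1
    push_cast
    ring
  have e3 : ∀ y : ℝ, Complex.exp (Complex.I * ((2 * Real.pi * Λ : ℝ) : ℂ) * (y : ℂ) ^ 2) =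
      expTwoPi (Λ * y ^ 2) := by
    intro y
    unfold expTwoPi
    congr 1
    push_cast
    ring
  simp only [e1, e2, e3] at h
  refine h.trans ?_
  gcongr
  nlinarith [Real.pi_gt_three]

lemma exists_pow_eq_add_mul (n : ℕ) : ∃ k k' : ℝ → ℝ,
    (∀ w, 0 < w → HasDerivAt k (k' w) w) ∧ ContinuousOn k' (Set.Ioi 0) ∧
    ∀ w, 0 < w → w ^ n = 1 / 2 * (1 + 1 / w ^ 2) + (w - 1 / w) * (1 + 1 / w ^ 2) * k w := by
  set k : ℝ → ℝ := fun w =>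
    w * (∑ i ∈ range (n + 2), w ^ i - (w + 1) / 2) / ((w + 1) * (w ^ 2 + 1)) with hk
  have hkd : ContDiffOn ℝ 1 k (Set.Ioi 0) := by
    refine ContDiffOn.div (by fun_prop) (by fun_prop) fun w hw => ?_
    have : 0 < w := hw
    positivity
  refine ⟨k, deriv k, fun w hw => ?_, hkd.continuousOn_deriv_of_isOpen isOpen_Ioi le_rfl, ?_⟩
  · exact ((hkd.differentiableOn one_ne_zero).differentiableAt (Ioi_mem_nhds hw)).hasDerivAt
  · intro w hw
    have hg := geom_sum_mul w (n + 2)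
    have h1 : (∑ i ∈ range (n + 2), w ^ i - (w + 1) / 2) * (w - 1) =
        w ^ (n + 2) - 1 - (w ^ 2 - 1) / 2 := by rw [sub_mul, hg]; ring
    have h2 : (w - 1 / w) * (1 + 1 / w ^ 2) * k w =
        (∑ i ∈ range (n + 2), w ^ i - (w + 1) / 2) * (w - 1) / w ^ 2 := by
      rw [hk]
      field_simp
      ring
    rw [h2, h1]
    field_simp
    ring

/-- Stationary phase at `w = 1` for the phase `(w - 1/w)²`, with a power weight. -/
lemma exists_norm_integral_pow_mul_expTwoPi_le (n : ℕ) {K : ℝ} (hK : 1 < K) :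
    ∃ C, 0 < C ∧ ∀ Λ β : ℝ, 0 < Λ → 1 / K ≤ β → β ≤ K → β ≠ 1 →
      ‖(∫ w in (1 : ℝ)..β, (w ^ n : ℝ) * expTwoPi (Λ * (w - 1 / w) ^ 2)) -
        SignType.sign (β - 1) * ((1 / (4 * Real.sqrt (2 * Λ)) : ℝ) : ℂ) * expTwoPi (1 / 8)‖ ≤
        C / (Λ * |β - 1|) := by
  obtain ⟨k, k', hk, hk', hpow⟩ := exists_pow_eq_add_mul n
  have hK0 : 0 < K := by linarith
  have hpos : ∀ w ∈ Set.Icc (1 / K) K, 0 < w := fun w hw => lt_of_lt_of_le (by positivity) hw.1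
  obtain ⟨B, hB⟩ := isCompact_Icc.exists_bound_of_continuousOn (s := Set.Icc (1 / K) K)
    (f := k) (fun w hw => (hk w (hpos w hw)).continuousAt.continuousWithinAt)
  obtain ⟨B', hB'⟩ := isCompact_Icc.exists_bound_of_continuousOn (s := Set.Icc (1 / K) K)
    (f := k') (hk'.mono fun w hw => hpos w hw)
  have h1K : (1 : ℝ) ∈ Set.Icc (1 / K) K := ⟨by rw [div_le_one hK0]; exact hK.le, hK.le⟩
  have hB0 : 0 ≤ B := (norm_nonneg _).trans (hB 1 h1K)
  have hB'0 : 0 ≤ B' := (norm_nonneg _).trans (hB' 1 h1K)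
  refine ⟨1 + (2 * B + B' * K) * K, by positivity, ?_⟩
  intro Λ β hΛ hβ1 hβ2 hβ
  have hβm : β ∈ Set.Icc (1 / K) K := ⟨hβ1, hβ2⟩
  have hβ0 := hpos β hβm
  have hsub : Set.uIcc 1 β ⊆ Set.Icc (1 / K) K := Set.uIcc_subset_Icc h1K hβm
  set y : ℝ → ℝ := fun w => w - 1 / w with hy
  set V : ℝ → ℂ := fun w => expTwoPi (Λ * y w ^ 2) with hV
  have hyd : ∀ w, 0 < w → HasDerivAt y (1 + 1 / w ^ 2) w := by
    intro w hw
    refine HasDerivAt.congr_deriv (f := y)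
      ((hasDerivAt_id w).sub ((hasDerivAt_const w (1 : ℝ)).div (hasDerivAt_id w) hw.ne')) ?_
    simp
    ring
  have hVd : ∀ w, 0 < w → HasDerivAt V
      (((2 * Real.pi * (Λ * (2 * y w * (1 + 1 / w ^ 2))) : ℝ) : ℂ) * Complex.I * V w) w := by
    intro w hw
    refine hasDerivAt_expTwoPi_comp (φ := fun w => Λ * y w ^ 2) ?_
    refine (((hyd w hw).pow 2).const_mul Λ).congr_deriv ?_
    simp
  have hVc : ContinuousOn V (Set.uIcc 1 β) := fun w hw =>
    (hVd w (hpos w (hsub hw))).continuousAt.continuousWithinAt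
  have hVn : ∀ w, ‖V w‖ = 1 := fun w => norm_expTwoPi _
  have hinvc : ContinuousOn (fun w : ℝ => 1 + 1 / w ^ 2) (Set.uIcc 1 β) := by
    refine continuousOn_const.add (continuousOn_const.div (by fun_prop) fun w hw => ?_)
    have := hpos w (hsub hw)
    positivity
  have hyc : ContinuousOn y (Set.uIcc 1 β) := fun w hw =>
    (hyd w (hpos w (hsub hw))).continuousAt.continuousWithinAt
  have hkc : ContinuousOn k (Set.uIcc 1 β) := fun w hw =>
    (hk w (hpos w (hsub hw))).continuousAt.continuousWithinAt
  have hk'c : ContinuousOn k' (Set.uIcc 1 β) := hk'.mono fun w hw => hpos w (hsub hw)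
  have ofR : ∀ {f : ℝ → ℝ} {s : Set ℝ}, ContinuousOn f s → ContinuousOn (fun w => (f w : ℂ)) s :=
    fun hf => Complex.continuous_ofReal.comp_continuousOn hf
  -- the smooth part
  have hI1 : IntervalIntegrable (fun w => (((1 + 1 / w ^ 2 : ℝ) : ℂ)) * V w)
      MeasureTheory.volume 1 β := ((ofR hinvc).mul hVc).intervalIntegrable
  have hI2 : IntervalIntegrable (fun w => ((y w * (1 + 1 / w ^ 2) * k w : ℝ) : ℂ) * V w)
      MeasureTheory.volume 1 β := ((ofR ((hyc.mul hinvc).mul hkc)).mul hVc).intervalIntegrable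
  have hI3 : IntervalIntegrable (fun w => (k' w : ℂ) * V w) MeasureTheory.volume 1 β :=
    ((ofR hk'c).mul hVc).intervalIntegrable
  have hsplit : ∫ w in (1 : ℝ)..β, (w ^ n : ℝ) * expTwoPi (Λ * (w - 1 / w) ^ 2) =
      1 / 2 * (∫ w in (1 : ℝ)..β, ((1 + 1 / w ^ 2 : ℝ) : ℂ) * V w) +
      ∫ w in (1 : ℝ)..β, ((y w * (1 + 1 / w ^ 2) * k w : ℝ) : ℂ) * V w := by
    rw [← intervalIntegral.integral_const_mul, ← intervalIntegral.integral_add (hI1.const_mul _) hI2]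
    refine intervalIntegral.integral_congr fun w hw => ?_
    simp only [hV, hy]
    rw [hpow w (hpos w (hsub hw))]
    push_cast
    ring
  have hparts : ((4 * Real.pi * Λ : ℝ) : ℂ) * Complex.I *
      (∫ w in (1 : ℝ)..β, ((y w * (1 + 1 / w ^ 2) * k w : ℝ) : ℂ) * V w) =
      k β * V β - k 1 * V 1 - ∫ w in (1 : ℝ)..β, (k' w : ℂ) * V w := by
    rw [← intervalIntegral.integral_const_mul, eq_sub_iff_add_eq,
      ← intervalIntegral.integral_add (hI2.const_mul _) hI3]
    refine intervalIntegral.integral_eq_sub_of_hasDerivAt (f := fun w => (k w : ℂ) * V w)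
      (fun w hw => ?_) ((hI2.const_mul _).add hI3)
    have hw0 := hpos w (hsub hw)
    refine ((hk w hw0).ofReal_comp.mul (hVd w hw0)).congr_deriv ?_
    push_cast
    ring
  have hpi := Real.pi_gt_three
  have hβK : |β - 1| ≤ K := by
    rw [abs_le]
    constructor <;> linarith
  have hpart2 : ‖∫ w in (1 : ℝ)..β, ((y w * (1 + 1 / w ^ 2) * k w : ℝ) : ℂ) * V w‖ ≤
      (2 * B + B' * K) / Λ := by
    have h3 : ‖∫ w in (1 : ℝ)..β, (k' w : ℂ) * V w‖ ≤ B' * K := by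
      refine (intervalIntegral.norm_integral_le_of_norm_le_const (C := B') fun w hw => ?_).trans ?_
      · rw [norm_mul, hVn, mul_one, Complex.norm_real]
        exact hB' w (hsub (Set.uIoc_subset_uIcc hw))
      · gcongr
    have h4 : ∀ w ∈ Set.Icc (1 / K) K, ‖(k w : ℂ) * V w‖ ≤ B := by
      intro w hw
      rw [norm_mul, hVn, mul_one, Complex.norm_real]
      exact hB w hw
    have h5 : ‖(k β : ℂ) * V β - k 1 * V 1 - ∫ w in (1 : ℝ)..β, (k' w : ℂ) * V w‖ ≤
        B + B + B' * K := (norm_sub_le_of_le (norm_sub_le_of_le (h4 β hβm) (h4 1 h1K)) h3)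
    rw [← hparts, norm_mul, norm_mul, Complex.norm_I, mul_one, Complex.norm_real,
      Real.norm_of_nonneg (by positivity)] at h5
    rw [le_div_iff₀ hΛ]
    have h6 : 1 * Λ ≤ 4 * Real.pi * Λ := by gcongr; linarith
    nlinarith [norm_nonneg (∫ w in (1 : ℝ)..β, ((y w * (1 + 1 / w ^ 2) * k w : ℝ) : ℂ) * V w)]
  -- the main part
  have hsubst : ∫ w in (1 : ℝ)..β, ((1 + 1 / w ^ 2 : ℝ) : ℂ) * V w =
      ∫ u in (0 : ℝ)..y β, expTwoPi (Λ * u ^ 2) := by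
    have hcont : Continuous fun u : ℝ => expTwoPi (Λ * u ^ 2) :=
      continuous_expTwoPi.comp (by fun_prop)
    have := intervalIntegral.integral_deriv_smul_comp' (f := y) (f' := fun w => 1 + 1 / w ^ 2)
      (g := fun u => expTwoPi (Λ * u ^ 2)) (fun w hw => hyd w (hpos w (hsub hw))) hinvc
      hcont.continuousOn
    rw [show y 1 = 0 by simp [hy]] at this
    simpa only [Complex.real_smul, Function.comp_def] using this
  have hyβ : y β = (β - 1) * ((β + 1) / β) := by
    simp only [hy]
    field_simp
    ring
  have hratio : 1 ≤ (β + 1) / β := by rw [le_div_iff₀ hβ0]; linarith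
  have hmain : ‖(∫ u in (0 : ℝ)..y β, expTwoPi (Λ * u ^ 2)) - SignType.sign (β - 1) *
      ((1 / (2 * Real.sqrt (2 * Λ)) : ℝ) : ℂ) * expTwoPi (1 / 8)‖ ≤ 1 / (Λ * |β - 1|) := by
    rcases lt_or_gt_of_ne hβ with h | h
    · have hneg : 0 < -y β := by rw [hyβ]; nlinarith
      have e : ∫ u in (0 : ℝ)..y β, expTwoPi (Λ * u ^ 2) =
          -∫ u in (0 : ℝ)..-y β, expTwoPi (Λ * u ^ 2) := by
        have := intervalIntegral.integral_comp_neg (a := 0) (b := -y β)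
          (fun u : ℝ => expTwoPi (Λ * u ^ 2))
        simp only [neg_sq, neg_neg, neg_zero] at this
        rw [this, intervalIntegral.integral_symm]
      rw [e, sign_neg (by linarith : β - 1 < 0)]
      have h0 := norm_integral_expTwoPi_sq_sub_le hΛ hneg
      have hle : |β - 1| ≤ -y β := by
        rw [abs_of_neg (by linarith), hyβ]
        nlinarith
      have habs : 0 < |β - 1| := abs_pos.2 (by linarith)
      rw [← norm_neg] at h0
      refine le_trans (le_of_eq_of_le (congrArg _ ?_) h0) (by gcongr)
      simp
      ring
    · have hpos' : 0 < y β := by rw [hyβ]; nlinarith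
      rw [sign_pos (by linarith : 0 < β - 1)]
      have h0 := norm_integral_expTwoPi_sq_sub_le hΛ hpos'
      have hle : |β - 1| ≤ y β := by
        rw [abs_of_pos (by linarith), hyβ]
        nlinarith
      have habs : 0 < |β - 1| := abs_pos.2 (by linarith)
      refine le_trans (le_of_eq_of_le (congrArg _ ?_) h0) (by gcongr)
      simp
  have habs : 0 < |β - 1| := abs_pos.2 (sub_ne_zero.2 hβ)
  rw [hsplit, hsubst]
  have hhalf : ‖(1 / 2 : ℂ) * ((∫ u in (0 : ℝ)..y β, expTwoPi (Λ * u ^ 2)) -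
      SignType.sign (β - 1) * ((1 / (2 * Real.sqrt (2 * Λ)) : ℝ) : ℂ) * expTwoPi (1 / 8))‖ ≤
      1 / (Λ * |β - 1|) := by
    rw [norm_mul]
    norm_num at hmain ⊢
    have : 0 ≤ (|β - 1|)⁻¹ * Λ⁻¹ := by positivity
    linarith
  refine le_trans (le_of_eq_of_le (congrArg _ ?_) (norm_add_le_of_le hhalf hpart2)) ?_
  · push_cast
    ring
  · rw [add_div, div_add_div _ _ (by positivity) hΛ.ne', div_add_div _ _ (by positivity)
      (by positivity), div_le_div_iff₀ (by positivity) (by positivity)]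
    have : 0 ≤ (2 * B + B' * K) := by positivity
    have h1 : (2 * B + B' * K) * |β - 1| ≤ (2 * B + B' * K) * K := by gcongr
    have h2 : 0 < Λ ^ 3 * |β - 1| ^ 2 := by positivity
    nlinarith

lemma integral_pow_mul_expTwoPi_eq (p : ℕ) {Λ t₀ β : ℝ} (ht₀ : 0 < t₀) (hβ : 0 < β) :
    ∫ t in t₀..t₀ * β ^ 2, (t ^ p : ℝ) * expTwoPi (Λ * (t₀ / t + t / t₀)) =
      ((2 * t₀ ^ (p + 1) : ℝ) : ℂ) * expTwoPi (2 * Λ) *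
        ∫ w in (1 : ℝ)..β, (w ^ (2 * p + 1) : ℝ) * expTwoPi (Λ * (w - 1 / w) ^ 2) := by
  have hpos : ∀ w ∈ Set.uIcc 1 β, 0 < w := fun w hw =>
    lt_of_lt_of_le (lt_min one_pos hβ) hw.1
  have hf : ∀ w ∈ Set.uIcc 1 β, HasDerivAt (fun w => t₀ * w ^ 2) (2 * t₀ * w) w := by
    intro w _
    refine ((hasDerivAt_pow 2 w).const_mul t₀).congr_deriv ?_
    norm_num
    ring
  have hg : ContinuousOn (fun t : ℝ => ((t ^ p : ℝ) : ℂ) * expTwoPi (Λ * (t₀ / t + t / t₀)))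
      ((fun w => t₀ * w ^ 2) '' Set.uIcc 1 β) := by
    refine ContinuousOn.mul (by fun_prop) (continuous_expTwoPi.comp_continuousOn ?_)
    refine continuousOn_const.mul (ContinuousOn.add ?_ (by fun_prop))
    refine continuousOn_const.div continuousOn_id ?_
    rintro _ ⟨w, hw, rfl⟩
    have := hpos w hw
    exact (by positivity : t₀ * w ^ 2 ≠ 0)
  have h := intervalIntegral.integral_deriv_smul_comp' hf (by fun_prop) hg
  simp only [one_pow, mul_one] at h
  rw [← h, ← intervalIntegral.integral_const_mul]
  refine intervalIntegral.integral_congr fun w hw => ?_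
  have hw0 := hpos w hw
  simp only [Function.comp_def, Complex.real_smul]
  have e : Λ * (t₀ / (t₀ * w ^ 2) + t₀ * w ^ 2 / t₀) = 2 * Λ + Λ * (w - 1 / w) ^ 2 := by
    field_simp
    ring
  rw [e, expTwoPi_add]
  push_cast
  ring

lemma exists_norm_integral_pow_mul_expTwoPi_one_sided_le (p : ℕ) {K : ℝ} (hK : 1 < K) :
    ∃ C, 0 < C ∧ ∀ Λ t₀ B : ℝ, 0 < Λ → 0 < t₀ → t₀ / K ≤ B → B ≤ K * t₀ → B ≠ t₀ →
      ‖(∫ t in t₀..B, (t ^ p : ℝ) * expTwoPi (Λ * (t₀ / t + t / t₀))) -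
        SignType.sign (B - t₀) * ((t₀ ^ (p + 1) / (2 * Real.sqrt (2 * Λ)) : ℝ) : ℂ) *
          expTwoPi (2 * Λ + 1 / 8)‖ ≤ C * (t₀ ^ (p + 2) / (Λ * |B - t₀|)) := by
  obtain ⟨C, hC, h⟩ := exists_norm_integral_pow_mul_expTwoPi_le (2 * p + 1) hK
  have hK0 : 0 < K := by linarith
  refine ⟨2 * C * (K + 1), by positivity, ?_⟩
  intro Λ t₀ B hΛ ht₀ hB1 hB2 hB
  set β := Real.sqrt (B / t₀) with hβ
  have hu1 : 1 / K ≤ B / t₀ := by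
    rw [div_le_div_iff₀ hK0 ht₀, one_mul]
    rwa [div_le_iff₀ hK0] at hB1
  have hu2 : B / t₀ ≤ K := by rwa [div_le_iff₀ ht₀]
  have hu0 : 0 < B / t₀ := lt_of_lt_of_le (by positivity) hu1
  have hβ0 : 0 < β := Real.sqrt_pos.2 hu0
  have hβsq : β ^ 2 = B / t₀ := Real.sq_sqrt hu0.le
  have hBβ : B = t₀ * β ^ 2 := by rw [hβsq]; field_simp
  have hβK : β ≤ K := by nlinarith
  have hβK' : 1 / K ≤ β := by
    have h1 : 1 / K ≤ 1 := by rw [div_le_one hK0]; exact hK.le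
    have h2 : 0 < 1 / K := by positivity
    by_contra hc
    push Not at hc
    nlinarith
  have hβ1 : β ≠ 1 := by
    intro h1
    rw [h1] at hBβ
    exact hB (by linarith)
  have hdiff : B - t₀ = t₀ * (β + 1) * (β - 1) := by rw [hBβ]; ring
  have hsign : SignType.sign (B - t₀) = SignType.sign (β - 1) := by
    rw [hdiff, sign_mul, sign_pos (by positivity), one_mul]
  have habs : 0 < |β - 1| := abs_pos.2 (sub_ne_zero.2 hβ1)
  have habsd : |B - t₀| = t₀ * (β + 1) * |β - 1| := by
    rw [hdiff, abs_mul, abs_of_pos (by positivity)]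
  have h0 := h Λ β hΛ hβK' hβK hβ1
  have hmul := mul_le_mul_of_nonneg_left h0 (by positivity : 0 ≤ 2 * t₀ ^ (p + 1))
  have hn : ‖((2 * t₀ ^ (p + 1) : ℝ) : ℂ) * expTwoPi (2 * Λ)‖ = 2 * t₀ ^ (p + 1) := by
    rw [norm_mul, norm_expTwoPi, mul_one, Complex.norm_real, Real.norm_of_nonneg (by positivity)]
  rw [← hn, ← norm_mul, hn, mul_sub, ← integral_pow_mul_expTwoPi_eq p ht₀ hβ0, ← hBβ] at hmul
  refine le_trans (le_of_eq_of_le (congrArg _ ?_) hmul) ?_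
  · rw [hsign, expTwoPi_add]
    push_cast
    ring
  · have hle : |B - t₀| ≤ t₀ * (K + 1) * |β - 1| := by
      rw [habsd]
      gcongr
    have hpos : 0 < |B - t₀| := abs_pos.2 (sub_ne_zero.2 hB)
    have e : 2 * t₀ ^ (p + 1) * (C / (Λ * |β - 1|)) =
        2 * C * (K + 1) * (t₀ ^ (p + 2) / (Λ * (t₀ * (K + 1) * |β - 1|))) := by
      field_simp
      ring
    rw [e]
    gcongr

/-- Stationary phase for `∫ t^p e(Λ(t₀/t + t/t₀)) dt` over an interval containing `t₀`. -/
lemma exists_norm_integral_pow_mul_expTwoPi_sub_le (p : ℕ) {K : ℝ} (hK : 1 < K) :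
    ∃ C, 0 < C ∧ ∀ Λ t₀ A B : ℝ, 0 < Λ → 0 < t₀ → t₀ / K ≤ A → A < t₀ → t₀ < B → B ≤ K * t₀ →
      ‖(∫ t in A..B, (t ^ p : ℝ) * expTwoPi (Λ * (t₀ / t + t / t₀))) -
        ((t₀ ^ (p + 1) / Real.sqrt (2 * Λ) : ℝ) : ℂ) * expTwoPi (2 * Λ + 1 / 8)‖ ≤
        C * (t₀ ^ (p + 2) / Λ) * (1 / (t₀ - A) + 1 / (B - t₀)) := by
  obtain ⟨C, hC, h⟩ := exists_norm_integral_pow_mul_expTwoPi_one_sided_le p hK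
  refine ⟨C, hC, ?_⟩
  intro Λ t₀ A B hΛ ht₀ hA hAt hBt hB
  have hK0 : 0 < K := by linarith
  have hA0 : 0 < A := lt_of_lt_of_le (by positivity) hA
  have h1 := h Λ t₀ A hΛ ht₀ hA (by nlinarith) hAt.ne
  have h2 := h Λ t₀ B hΛ ht₀ ((div_le_self ht₀.le hK.le).trans hBt.le) hB hBt.ne'
  have hint : ∀ u v : ℝ, 0 < u → 0 < v → IntervalIntegrable
      (fun t : ℝ => ((t ^ p : ℝ) : ℂ) * expTwoPi (Λ * (t₀ / t + t / t₀)))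
      MeasureTheory.volume u v := by
    intro u v hu hv
    refine ContinuousOn.intervalIntegrable
      (ContinuousOn.mul (by fun_prop) (continuous_expTwoPi.comp_continuousOn ?_))
    refine continuousOn_const.mul (ContinuousOn.add ?_ (by fun_prop))
    refine continuousOn_const.div continuousOn_id fun t ht => ?_
    exact (lt_of_lt_of_le (lt_min hu hv) ht.1).ne'
  have hadd := intervalIntegral.integral_add_adjacent_intervals (hint A t₀ hA0 ht₀)
    (hint t₀ B ht₀ (by linarith))
  rw [intervalIntegral.integral_symm t₀ A] at hadd
  rw [← hadd]
  rw [sign_neg (by linarith), abs_of_neg (by linarith)] at h1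
  rw [sign_pos (by linarith), abs_of_pos (by linarith)] at h2
  refine le_trans (le_of_eq_of_le (congrArg _ ?_) (norm_sub_le_of_le h2 h1)) (le_of_eq ?_)
  · simp only [SignType.coe_one, SignType.coe_neg]
    push_cast
    field_simp
    ring
  · rw [neg_sub]
    have : t₀ - A ≠ 0 := by linarith
    have : B - t₀ ≠ 0 := by linarith
    field_simp
    ring

lemma hasDerivAt_div_add_mul {y s t : ℝ} (ht : 0 < t) :
    HasDerivAt (fun t => y / (2 * t) + s * t / 2) (s / 2 - y / (2 * t ^ 2)) t := by
  have h1 : HasDerivAt (fun t : ℝ => 2 * t) 2 t := by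
    simpa using (hasDerivAt_id t).const_mul (2 : ℝ)
  have h2 := ((hasDerivAt_const t y).div h1 (by positivity)).add
    (((hasDerivAt_id t).const_mul s).div_const 2)
  refine HasDerivAt.congr_deriv (f := fun t => y / (2 * t) + s * t / 2) h2 ?_
  field_simp
  ring

set_option maxHeartbeats 400000 in
/-- Exponential sums near a single stationary point: Poisson summation and stationary phase. -/
lemma exists_norm_sum_pow_mul_expTwoPi_sub_le (p : ℕ) {K : ℝ} (hK : 1 < K) :
    ∃ C, 0 < C ∧ ∀ y s v₁ v₂ η : ℝ, 0 < y → 0 < s → 0 < v₂ → 0 < η → η ≤ 1 / 2 →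
      v₁ ≤ K ^ 2 * s → s ≤ K ^ 2 * v₂ → η ≤ v₁ - s → v₁ - s ≤ 2 * (1 - η) →
      η ≤ s - v₂ → s - v₂ ≤ 2 * (1 - η) →
      ‖(∑ m ∈ Ioc ⌊Real.sqrt (y / v₁)⌋₊ ⌊Real.sqrt (y / v₂)⌋₊,
          (((m : ℝ) ^ p : ℝ) : ℂ) * expTwoPi (y / (2 * m) + s * m / 2)) -
        ((Real.sqrt (y / s) ^ (p + 1) / Real.sqrt (Real.sqrt (y * s)) : ℝ) : ℂ) *
          expTwoPi (Real.sqrt (y * s) + 1 / 8)‖ ≤ C * (Real.sqrt (y / s) ^ p / η) := by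
  obtain ⟨C, hC, h⟩ := exists_norm_integral_pow_mul_expTwoPi_sub_le p hK
  have hK0 : 0 < K := by linarith
  refine ⟨10 * ((p + 1) * K ^ p) + C * (4 * K ^ 2 + 2 * (K + 1)), by positivity, ?_⟩
  intro y s v₁ v₂ η hy hs hv₂ hη hη' hv₁K hv₂K h1 h1' h2 h2'
  have hv₁ : 0 < v₁ := by linarith
  set t₀ := Real.sqrt (y / s) with ht₀
  set A := Real.sqrt (y / v₁) with hA
  set B := Real.sqrt (y / v₂) with hB
  have ht₀pos : 0 < t₀ := Real.sqrt_pos.2 (by positivity)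
  have hApos : 0 < A := Real.sqrt_pos.2 (by positivity)
  have hBpos : 0 < B := Real.sqrt_pos.2 (by positivity)
  have ht₀sq : t₀ ^ 2 = y / s := Real.sq_sqrt (by positivity)
  have hAsq : A ^ 2 = y / v₁ := Real.sq_sqrt (by positivity)
  have hBsq : B ^ 2 = y / v₂ := Real.sq_sqrt (by positivity)
  have hAt : A < t₀ := Real.sqrt_lt_sqrt (by positivity) (by gcongr; linarith)
  have htB : t₀ < B := Real.sqrt_lt_sqrt (by positivity) (by gcongr; linarith)
  have hAK : t₀ / K ≤ A := by
    refine abs_le_of_sq_le_sq' ?_ hApos.le |>.2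
    rw [div_pow, ht₀sq, hAsq, div_div, mul_comm s]
    gcongr
  have hBK : B ≤ K * t₀ := by
    refine abs_le_of_sq_le_sq' ?_ (by positivity) |>.2
    rw [mul_pow, ht₀sq, hBsq, mul_div_assoc', div_le_div_iff₀ hv₂ hs]
    nlinarith
  set Λ := Real.sqrt (y * s) / 2 with hΛ
  have hΛpos : 0 < Λ := by have := Real.sqrt_pos.2 (mul_pos hy hs); positivity
  have hΛt : Λ = s * t₀ / 2 := by
    rw [hΛ, show y * s = s ^ 2 * (y / s) by field_simp, Real.sqrt_mul (by positivity),
      Real.sqrt_sq hs.le]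
  have hyt : y = s * t₀ ^ 2 := by rw [ht₀sq]; field_simp
  have hphase : ∀ t : ℝ, 0 < t → Λ * (t₀ / t + t / t₀) = y / (2 * t) + s * t / 2 := by
    intro t ht
    rw [hΛt, hyt]
    field_simp
  have hpos : ∀ t ∈ Set.Icc A B, 0 < t := fun t ht => hApos.trans_le ht.1
  have hmono : MonotoneOn (fun t => s / 2 - y / (2 * t ^ 2)) (Set.Icc A B) := by
    intro a ha b hb hab
    have := hpos a ha
    simp only
    gcongr
  have hAI : A ∈ Set.Icc A B := ⟨le_rfl, (hAt.trans htB).le⟩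
  have hBI : B ∈ Set.Icc A B := ⟨(hAt.trans htB).le, le_rfl⟩
  have hdA : s / 2 - y / (2 * A ^ 2) = (s - v₁) / 2 := by rw [hAsq]; field_simp
  have hdB : s / 2 - y / (2 * B ^ 2) = (s - v₂) / 2 := by rw [hBsq]; field_simp
  have hd : ∀ t ∈ Set.Icc A B, |s / 2 - y / (2 * t ^ 2)| ≤ 1 - η := by
    intro t ht
    have i1 := hmono hAI ht ht.1
    have i2 := hmono ht hBI ht.2
    simp only [hdA, hdB] at i1 i2
    rw [abs_le]
    constructor <;> linarith
  have hsum := norm_sum_Ioc_mul_expTwoPi_sub_integral_le (g := fun t => t ^ p)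
    (g' := fun t => p * t ^ (p - 1)) (G := B ^ p) (G1 := p * B ^ (p - 1))
    hApos.le (hAt.trans htB).le hη hη' (fun t ht => hasDerivAt_div_add_mul (hpos t ht)) hmono hd
    (fun t _ => hasDerivAt_pow p t)
    (fun t ht => by
      have := hpos t ht
      rw [abs_of_nonneg (by positivity)]
      exact pow_le_pow_left₀ this.le ht.2 p)
    (fun t ht => by
      have := hpos t ht
      rw [abs_of_nonneg (by positivity)]
      have := pow_le_pow_left₀ this.le ht.2 (p - 1)
      gcongr)
  have hsp := h Λ t₀ A B hΛpos ht₀pos hAK hAt htB hBK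
  have hcongr : ∫ t in A..B, ((t ^ p : ℝ) : ℂ) * expTwoPi (Λ * (t₀ / t + t / t₀)) =
      ∫ t in A..B, ((t ^ p : ℝ) : ℂ) * expTwoPi (y / (2 * t) + s * t / 2) := by
    refine intervalIntegral.integral_congr fun t ht => ?_
    rw [Set.uIcc_of_le (hAt.trans htB).le] at ht
    simp only [hphase t (hpos t ht)]
  rw [hcongr, show 2 * Λ = Real.sqrt (y * s) by rw [hΛ]; ring] at hsp
  refine le_trans (le_of_eq_of_le (congrArg _ ?_) (norm_add_le_of_le hsum hsp)) ?_
  · ring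
  have hBp : B ^ p ≤ K ^ p * t₀ ^ p := by
    rw [← mul_pow]; exact pow_le_pow_left₀ hBpos.le hBK p
  have hG1 : (p : ℝ) * B ^ (p - 1) * (B - A) ≤ p * B ^ p := by
    rcases Nat.eq_zero_or_pos p with rfl | hp
    · simp
    · rw [mul_assoc]
      have : B ^ p = B ^ (p - 1) * B := by rw [← pow_succ, Nat.sub_add_cancel hp]
      rw [this]
      gcongr
      linarith
  have e1 : 10 * (B ^ p + p * B ^ (p - 1) * (B - A)) / η ≤
      10 * ((p + 1) * K ^ p) * (t₀ ^ p / η) := by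
    rw [mul_div_assoc', div_le_div_iff_of_pos_right hη]
    have := mul_le_mul_of_nonneg_left hBp (by positivity : (0 : ℝ) ≤ 10 * (p + 1))
    linarith
  have e2 : t₀ ^ (p + 2) / Λ * (1 / (t₀ - A)) ≤ 4 * K ^ 2 * (t₀ ^ p / η) := by
    have i1 : t₀ * η ≤ 2 * (K ^ 2 * s) * (t₀ - A) := by
      have j1 : t₀ ^ 2 * (v₁ - s) = v₁ * (t₀ ^ 2 - A ^ 2) := by
        rw [ht₀sq, hAsq]; field_simp
      have j2 : t₀ * (t₀ * (v₁ - s)) ≤ t₀ * (2 * v₁ * (t₀ - A)) := by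
        have : 0 ≤ v₁ * (t₀ - A) * (t₀ - A) :=
          mul_nonneg (mul_nonneg hv₁.le (by linarith)) (by linarith)
        linarith
      have j3 := le_of_mul_le_mul_left j2 ht₀pos
      have j4 : t₀ * η ≤ t₀ * (v₁ - s) := by gcongr
      have j5 : v₁ * (t₀ - A) ≤ K ^ 2 * s * (t₀ - A) :=
        mul_le_mul_of_nonneg_right hv₁K (by linarith)
      linarith
    have : 0 < t₀ - A := by linarith
    rw [hΛt, div_mul_div_comm, mul_one, mul_div_assoc', div_le_div_iff₀ (by positivity) hη]
    have e : t₀ ^ (p + 2) * η = t₀ ^ p * t₀ * (t₀ * η) := by ring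
    rw [e]
    have := mul_le_mul_of_nonneg_left i1 (by positivity : 0 ≤ t₀ ^ p * t₀)
    linarith
  have e3 : t₀ ^ (p + 2) / Λ * (1 / (B - t₀)) ≤ 2 * (K + 1) * (t₀ ^ p / η) := by
    have i1 : t₀ * η ≤ (K + 1) * s * (B - t₀) := by
      have j1 : t₀ ^ 2 * (s - v₂) = v₂ * (B ^ 2 - t₀ ^ 2) := by
        rw [ht₀sq, hBsq]; field_simp
      have j2 : t₀ * (t₀ * (s - v₂)) ≤ t₀ * ((K + 1) * v₂ * (B - t₀)) := by
        have : 0 ≤ v₂ * (B - t₀) * (K * t₀ - B) :=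
          mul_nonneg (mul_nonneg hv₂.le (by linarith)) (by linarith)
        linarith
      have j3 := le_of_mul_le_mul_left j2 ht₀pos
      have j4 : t₀ * η ≤ t₀ * (s - v₂) := by gcongr
      have j5 : (K + 1) * v₂ * (B - t₀) ≤ (K + 1) * s * (B - t₀) :=
        mul_le_mul_of_nonneg_right (by nlinarith) (by linarith)
      linarith
    have : 0 < B - t₀ := by linarith
    rw [hΛt, div_mul_div_comm, mul_one, mul_div_assoc', div_le_div_iff₀ (by positivity) hη]
    have e : t₀ ^ (p + 2) * η = t₀ ^ p * t₀ * (t₀ * η) := by ring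
    rw [e]
    have := mul_le_mul_of_nonneg_left i1 (by positivity : 0 ≤ t₀ ^ p * t₀)
    linarith
  have e4 := mul_le_mul_of_nonneg_left (add_le_add e2 e3) hC.le
  linarith

lemma exists_norm_sum_weight_mul_expTwoPi_sub_le (n : ℕ) {θ K : ℝ} (hθ : 0 < θ) (hK : 1 < K) :
    ∃ C, 0 < C ∧ ∀ x y s v₁ v₂ η : ℝ, 0 < x → 0 < y → 0 < s → 0 < v₂ → 0 < η → η ≤ 1 / 2 →
      v₁ ≤ K ^ 2 * s → s ≤ K ^ 2 * v₂ → η ≤ v₁ - s → v₁ - s ≤ 2 * (1 - η) →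
      η ≤ s - v₂ → s - v₂ ≤ 2 * (1 - η) → θ * (y / s) ≤ x →
      ‖(∑ m ∈ Ioc ⌊Real.sqrt (y / v₁)⌋₊ ⌊Real.sqrt (y / v₂)⌋₊,
          ((m * (x - θ * m ^ 2) ^ n : ℝ) : ℂ) * expTwoPi (y / (2 * m) + s * m / 2)) -
        ((y / s * (x - θ * (y / s)) ^ n / Real.sqrt (Real.sqrt (y * s)) : ℝ) : ℂ) *
          expTwoPi (Real.sqrt (y * s) + 1 / 8)‖ ≤ C * (x ^ n * Real.sqrt (y / s) / η) := by
  choose D hD h using fun p : ℕ => exists_norm_sum_pow_mul_expTwoPi_sub_le p hK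
  refine ⟨∑ j ∈ range (n + 1), D (2 * j + 1) * n.choose j, ?_, ?_⟩
  · exact sum_pos (fun j hj => mul_pos (hD _) (by
      exact_mod_cast Nat.choose_pos (Nat.lt_succ_iff.1 (mem_range.1 hj)))) ⟨0, by simp⟩
  intro x y s v₁ v₂ η hx hy hs hv₂ hη hη' hv₁K hv₂K h1 h1' h2 h2' hθy
  have hys : 0 < y / s := by positivity
  set t₀ := Real.sqrt (y / s) with ht₀
  have ht₀sq : t₀ ^ 2 = y / s := Real.sq_sqrt hys.le
  have ht₀pos : 0 < t₀ := Real.sqrt_pos.2 hys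
  have hexp : ∀ t : ℝ, t * (x - θ * t ^ 2) ^ n =
      ∑ j ∈ range (n + 1), (n.choose j * (-θ) ^ j * x ^ (n - j)) * t ^ (2 * j + 1) := by
    intro t
    rw [show x - θ * t ^ 2 = -θ * t ^ 2 + x by ring, add_pow, mul_sum]
    refine sum_congr rfl fun j _ => ?_
    rw [mul_pow]
    ring
  have hmain : ((y / s * (x - θ * (y / s)) ^ n / Real.sqrt (Real.sqrt (y * s)) : ℝ) : ℂ) *
      expTwoPi (Real.sqrt (y * s) + 1 / 8) = ∑ j ∈ range (n + 1),
      ((n.choose j * (-θ) ^ j * x ^ (n - j) : ℝ) : ℂ) *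
      (((t₀ ^ (2 * j + 1 + 1) / Real.sqrt (Real.sqrt (y * s)) : ℝ) : ℂ) *
          expTwoPi (Real.sqrt (y * s) + 1 / 8)) := by
    have e : y / s * (x - θ * (y / s)) ^ n / Real.sqrt (Real.sqrt (y * s)) =
        ∑ j ∈ range (n + 1), (n.choose j * (-θ) ^ j * x ^ (n - j)) *
          (t₀ ^ (2 * j + 1 + 1) / Real.sqrt (Real.sqrt (y * s))) := by
      rw [← ht₀sq, sq t₀, mul_assoc t₀ t₀, ← sq t₀, hexp, mul_sum, sum_div]
      refine sum_congr rfl fun j _ => ?_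
      ring
    rw [e]
    push_cast
    rw [sum_mul]
    refine sum_congr rfl fun j _ => ?_
    ring
  have hsum : ∑ m ∈ Ioc ⌊Real.sqrt (y / v₁)⌋₊ ⌊Real.sqrt (y / v₂)⌋₊,
      ((m * (x - θ * m ^ 2) ^ n : ℝ) : ℂ) * expTwoPi (y / (2 * m) + s * m / 2) =
      ∑ j ∈ range (n + 1), ((n.choose j * (-θ) ^ j * x ^ (n - j) : ℝ) : ℂ) *
      ∑ m ∈ Ioc ⌊Real.sqrt (y / v₁)⌋₊ ⌊Real.sqrt (y / v₂)⌋₊,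
          (((m : ℝ) ^ (2 * j + 1) : ℝ) : ℂ) * expTwoPi (y / (2 * m) + s * m / 2) := by
    simp_rw [mul_sum]
    rw [sum_comm]
    refine sum_congr rfl fun m _ => ?_
    rw [hexp]
    push_cast
    rw [sum_mul]
    refine sum_congr rfl fun j _ => ?_
    ring
  rw [hsum, hmain, ← sum_sub_distrib, sum_mul]
  refine norm_sum_le_of_le _ fun j hj => ?_
  have hjn : j ≤ n := Nat.lt_succ_iff.1 (mem_range.1 hj)
  rw [← mul_sub, norm_mul]
  have hj := h (2 * j + 1) y s v₁ v₂ η hy hs hv₂ hη hη' hv₁K hv₂K h1 h1' h2 h2'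
  have hc : ‖((n.choose j * (-θ) ^ j * x ^ (n - j) : ℝ) : ℂ)‖ =
      n.choose j * θ ^ j * x ^ (n - j) := by
    rw [Complex.norm_real, norm_mul, norm_mul, norm_pow, norm_pow, Real.norm_natCast, norm_neg,
      Real.norm_of_nonneg hθ.le, Real.norm_of_nonneg hx.le]
  rw [hc]
  have hDj := hD (2 * j + 1)
  refine (mul_le_mul_of_nonneg_left hj (by positivity)).trans ?_
  have e1 : t₀ ^ (2 * j + 1) = (y / s) ^ j * t₀ := by rw [← ht₀sq]; ring
  have e2 : (θ * (y / s)) ^ j * x ^ (n - j) ≤ x ^ n := by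
    calc (θ * (y / s)) ^ j * x ^ (n - j) ≤ x ^ j * x ^ (n - j) := by gcongr
      _ = x ^ n := by rw [← pow_add, Nat.add_sub_cancel' hjn]
  rw [← ht₀, e1]
  calc n.choose j * θ ^ j * x ^ (n - j) * (D (2 * j + 1) * ((y / s) ^ j * t₀ / η)) =
      D (2 * j + 1) * n.choose j * ((θ * (y / s)) ^ j * x ^ (n - j) * t₀ / η) := by
        rw [mul_pow]; ring
    _ ≤ _ := by gcongr

lemma sum_one_div_sqrt_le (R : ℕ) : ∑ r ∈ Icc 1 R, 1 / Real.sqrt r ≤ 2 * Real.sqrt R := by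
  induction R with
  | zero => simp
  | succ n ih =>
    rw [sum_Icc_succ_top (by omega)]
    have h1 : 0 < Real.sqrt ((n + 1 : ℕ) : ℝ) := Real.sqrt_pos.2 (by positivity)
    have h2 := Real.sq_sqrt (Nat.cast_nonneg (α := ℝ) (n + 1))
    have h3 := Real.sq_sqrt (Nat.cast_nonneg (α := ℝ) n)
    have h4 : 1 / Real.sqrt ((n + 1 : ℕ) : ℝ) ≤
        2 * Real.sqrt ((n + 1 : ℕ) : ℝ) - 2 * Real.sqrt n := by
      rw [div_le_iff₀ h1]
      push_cast at h2 ⊢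
      nlinarith [sq_nonneg (Real.sqrt (n + 1) - Real.sqrt n)]
    linarith

/-- The distance from `t` to the nearest integer. -/
noncomputable def distInt (t : ℝ) : ℝ := min (Int.fract t) (1 - Int.fract t)

/-- The points separating the stationary phase ranges of consecutive frequencies: frequency `r`
governs `√(hx/W r) < m ≤ √(hx/W (r-1))`. -/
noncomputable def freqBound (θ : ℝ) (h r : ℕ) : ℝ :=
  if r ≤ ⌊θ * h⌋₊ then θ * h else 2 * r + 1 - θ * h

lemma freqBound_pos {θ : ℝ} (hθ : 0 < θ) {h : ℕ} (hh : 1 ≤ h) (r : ℕ) : 0 < freqBound θ h r := by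
  have hh' : (1 : ℝ) ≤ h := by exact_mod_cast hh
  have hθh : 0 < θ * h := by positivity
  unfold freqBound
  split_ifs with hr
  · exact hθh
  · have := (Nat.floor_lt hθh.le).1 (not_le.1 hr)
    have := r.cast_nonneg (α := ℝ)
    linarith

lemma freqBound_mono {θ : ℝ} (hθ : 0 < θ) (h : ℕ) : Monotone (freqBound θ h) := by
  refine monotone_nat_of_le_succ fun r => ?_
  have hθh : 0 ≤ θ * h := by positivity
  unfold freqBound
  split_ifs with h1 h2 h2
  · exact le_rfl
  · have := (Nat.floor_lt hθh).1 (not_le.1 h2)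
    have : (0 : ℝ) ≤ ((r + 1 : ℕ) : ℝ) := Nat.cast_nonneg _
    linarith
  · omega
  · push_cast
    linarith

lemma exists_norm_sum_head_sub_le (n : ℕ) {θ : ℝ} (hθ : 0 < θ) :
    ∃ C, 0 < C ∧ ∀ (x : ℝ) (h R : ℕ), 0 < x → 1 ≤ h → 0 < distInt (θ * h) → ⌊θ * h⌋₊ ≤ R →
      ‖(∑ m ∈ Ioc ⌊Real.sqrt (h * x / freqBound θ h R)⌋₊ ⌊Real.sqrt (x / θ)⌋₊,
          ((m * (x - θ * m ^ 2) ^ n : ℝ) : ℂ) * expTwoPi (h * x / (2 * m) - θ * h * m / 2)) -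
        ∑ r ∈ Ioc ⌊θ * h⌋₊ R,
          (((h * x / (2 * r - θ * h) * (x - θ * (h * x / (2 * r - θ * h))) ^ n /
            Real.sqrt (Real.sqrt (h * x * (2 * r - θ * h)))) : ℝ) : ℂ) *
          expTwoPi (Real.sqrt (h * x * (2 * r - θ * h)) + 1 / 8)‖ ≤
        C * (x ^ n * Real.sqrt x * (Real.sqrt (h * R) + 1 / distInt (θ * h))) := by
  set K : ℝ := 2 + 2 / θ with hKdef
  have hK : 1 < K := by have : 0 < 2 / θ := by positivity
                        linarith
  obtain ⟨C, hC, hpiece⟩ := exists_norm_sum_weight_mul_expTwoPi_sub_le n hθ hK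
  refine ⟨C * (4 + 1 / Real.sqrt θ), by positivity, ?_⟩
  intro x h R hx hh hη hR
  have hh' : (1 : ℝ) ≤ h := by exact_mod_cast hh
  have hθh : 0 < θ * h := by positivity
  have hy : 0 < h * x := by positivity
  set r₀ := ⌊θ * h⌋₊ with hr₀
  set W := freqBound θ h with hW
  have hW0 : W r₀ = θ * h := by simp [hW, freqBound, hr₀]
  have hWr : ∀ r, r₀ < r → W r = 2 * r + 1 - θ * h := by
    intro r hr
    simp only [hW, freqBound, ← hr₀]
    rw [if_neg (by omega)]
  have hfl : (r₀ : ℝ) ≤ θ * h := Nat.floor_le hθh.le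
  have hfr : Int.fract (θ * h) = θ * h - r₀ := by
    rw [Int.fract, hr₀, ← natCast_floor_eq_intCast_floor hθh.le]
  set P : ℕ → ℕ → ℂ := fun r m => ((m * (x - θ * m ^ 2) ^ n : ℝ) : ℂ) *
    expTwoPi (h * x / (2 * m) + (2 * r - θ * h) * m / 2) with hP
  have hPr : ∀ r m, P r m = ((m * (x - θ * m ^ 2) ^ n : ℝ) : ℂ) *
      expTwoPi (h * x / (2 * m) - θ * h * m / 2) := by
    intro r m
    have e : h * x / (2 * m) + (2 * r - θ * h) * m / 2 =
        (h * x / (2 * m) - θ * h * m / 2) + ((r * m : ℕ) : ℝ) := by push_cast; ring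
    simp only [hP]
    rw [e, expTwoPi_add, expTwoPi_natCast, mul_one]
  have hsplit : ∑ m ∈ Ioc ⌊Real.sqrt (h * x / W R)⌋₊ ⌊Real.sqrt (x / θ)⌋₊,
      ((m * (x - θ * m ^ 2) ^ n : ℝ) : ℂ) * expTwoPi (h * x / (2 * m) - θ * h * m / 2) =
      ∑ r ∈ Ioc r₀ R, ∑ m ∈ Ioc ⌊Real.sqrt (h * x / W r)⌋₊ ⌊Real.sqrt (h * x / W (r - 1))⌋₊,
        P r m := by
    simp only [hPr]
    induction R, hR using Nat.le_induction with
    | base =>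
      rw [hW0, Ioc_self, sum_empty, show h * x / (θ * h) = x / θ by field_simp, Ioc_self,
        sum_empty]
    | succ k hk ih =>
      rw [← insert_Ioc_right_eq_Ioc_add_one hk, sum_insert (by simp), ← ih, Nat.add_sub_cancel]
      have m1 : ⌊Real.sqrt (h * x / W (k + 1))⌋₊ ≤ ⌊Real.sqrt (h * x / W k)⌋₊ := by
        have := freqBound_pos hθ hh k
        have := freqBound_mono hθ h (Nat.le_succ k)
        gcongr
      have m2 : ⌊Real.sqrt (h * x / W k)⌋₊ ≤ ⌊Real.sqrt (x / θ)⌋₊ := by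
        have := freqBound_mono hθ h hk
        rw [← hW, hW0] at this
        rw [show x / θ = h * x / (θ * h) by field_simp]
        gcongr
      rw [sum_Ioc_consecutive _ m1 m2]
  rw [hsplit, ← sum_sub_distrib]
  have hterm : ∀ r ∈ Ioc r₀ R,
      ‖(∑ m ∈ Ioc ⌊Real.sqrt (h * x / W r)⌋₊ ⌊Real.sqrt (h * x / W (r - 1))⌋₊, P r m) -
        (((h * x / (2 * r - θ * h) * (x - θ * (h * x / (2 * r - θ * h))) ^ n /
            Real.sqrt (Real.sqrt (h * x * (2 * r - θ * h)))) : ℝ) : ℂ) *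
          expTwoPi (Real.sqrt (h * x * (2 * r - θ * h)) + 1 / 8)‖ ≤
      C * (x ^ n * Real.sqrt x) * ((if r = r₀ + 1 then 1 / (Real.sqrt θ * distInt (θ * h)) else 0) +
        2 * Real.sqrt h * (1 / Real.sqrt r)) := by
    intro r hr
    rw [mem_Ioc] at hr
    have hrθ : θ * h < r := (Nat.floor_lt hθh.le).1 hr.1
    have hr0 : (0 : ℝ) < r := hθh.trans hrθ
    have hs : 0 < 2 * (r : ℝ) - θ * h := by linarith
    have hθh1 : θ ≤ θ * h := by nlinarith
    have hKs : ∀ v : ℝ, θ ≤ v → v + 2 ≤ K ^ 2 * v := by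
      intro v hv
      have : v + 2 ≤ K * v := by
        rw [hKdef]
        have : 2 ≤ 2 / θ * v := by
          rw [div_mul_eq_mul_div, le_div_iff₀ hθ]; linarith
        nlinarith
      nlinarith
    have hK1 := hKs (2 * r - θ * h) (by linarith)
    have hθx : θ * (h * x / (2 * r - θ * h)) ≤ x := by
      rw [mul_div_assoc', div_le_iff₀ hs]
      nlinarith
    have hsr : Real.sqrt (h * x / (2 * r - θ * h)) ≤ Real.sqrt x * (Real.sqrt h / Real.sqrt r) := by
      rw [← Real.sqrt_div (by positivity), ← Real.sqrt_mul hx.le]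
      refine Real.sqrt_le_sqrt ?_
      rw [mul_div_assoc', mul_comm x]
      gcongr
      linarith
    have hCx : 0 ≤ C * (x ^ n * Real.sqrt x) := by positivity
    by_cases hrr : r = r₀ + 1
    · have hWm : W (r - 1) = θ * h := by rw [hrr, Nat.add_sub_cancel, hW0]
      have hrc : (r : ℝ) = r₀ + 1 := by rw [hrr]; push_cast; ring
      have hd1 : distInt (θ * h) ≤ θ * h - r₀ := by rw [← hfr]; exact min_le_left _ _
      have hd2 : distInt (θ * h) ≤ 1 - (θ * h - r₀) := by rw [← hfr]; exact min_le_right _ _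
      have := hpiece x (h * x) (2 * r - θ * h) (W r) (W (r - 1)) (distInt (θ * h)) hx hy hs
        (by rw [hWm]; exact hθh) hη (by linarith) (by rw [hWr r hr.1]; linarith)
        (by rw [hWm]; linarith [hKs (θ * h) hθh1]) (by rw [hWr r hr.1]; linarith)
        (by rw [hWr r hr.1]; linarith) (by rw [hWm]; linarith) (by rw [hWm]; linarith) hθx
      refine this.trans ?_
      rw [if_pos hrr]
      have hsx : Real.sqrt (h * x / (2 * r - θ * h)) ≤ Real.sqrt x / Real.sqrt θ := by
        rw [← Real.sqrt_div hx.le]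
        refine Real.sqrt_le_sqrt ?_
        rw [le_div_iff₀ hθ]
        linarith
      calc C * (x ^ n * Real.sqrt (h * x / (2 * r - θ * h)) / distInt (θ * h)) ≤
          C * (x ^ n * (Real.sqrt x / Real.sqrt θ) / distInt (θ * h)) := by gcongr
        _ = C * (x ^ n * Real.sqrt x) * (1 / (Real.sqrt θ * distInt (θ * h)) + 0) := by
          field_simp
          ring
        _ ≤ _ := by gcongr; positivity
    · have hWm : W (r - 1) = 2 * r - 1 - θ * h := by
        rw [hWr (r - 1) (by omega), Nat.cast_sub (by omega)]
        push_cast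
        ring
      have hr2 : (r₀ : ℝ) + 1 + 1 ≤ r := by exact_mod_cast (by omega : r₀ + 1 + 1 ≤ r)
      have hlt := Nat.lt_floor_add_one (θ * h)
      rw [← hr₀] at hlt
      have := hpiece x (h * x) (2 * r - θ * h) (W r) (W (r - 1)) (1 / 2) hx hy hs
        (by rw [hWm]; linarith) (by norm_num) le_rfl (by rw [hWr r hr.1]; linarith)
        (by rw [hWm]; linarith [hKs (2 * r - 1 - θ * h) (by linarith)])
        (by rw [hWr r hr.1]; linarith) (by rw [hWr r hr.1]; linarith) (by rw [hWm]; linarith)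
        (by rw [hWm]; linarith) hθx
      refine this.trans ?_
      rw [if_neg hrr, zero_add]
      calc C * (x ^ n * Real.sqrt (h * x / (2 * r - θ * h)) / (1 / 2)) ≤
          C * (x ^ n * (Real.sqrt x * (Real.sqrt h / Real.sqrt r)) / (1 / 2)) := by gcongr
        _ = _ := by ring
  refine (norm_sum_le_of_le _ hterm).trans ?_
  rw [← mul_sum, sum_add_distrib, ← mul_sum]
  have hsq : ∑ r ∈ Ioc r₀ R, 1 / Real.sqrt r ≤ 2 * Real.sqrt R := by
    refine le_trans (sum_le_sum_of_subset_of_nonneg ?_ fun _ _ _ => by positivity)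
      (sum_one_div_sqrt_le R)
    intro r hr
    rw [mem_Ioc] at hr
    rw [mem_Icc]
    omega
  have hite : ∑ r ∈ Ioc r₀ R, (if r = r₀ + 1 then 1 / (Real.sqrt θ * distInt (θ * h)) else 0) ≤
      1 / (Real.sqrt θ * distInt (θ * h)) := by
    rw [sum_ite_eq']
    split_ifs
    · exact le_rfl
    · positivity
  calc C * (x ^ n * Real.sqrt x) * (∑ r ∈ Ioc r₀ R,
        (if r = r₀ + 1 then 1 / (Real.sqrt θ * distInt (θ * h)) else 0) +
        2 * Real.sqrt h * ∑ r ∈ Ioc r₀ R, 1 / Real.sqrt r) ≤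
      C * (x ^ n * Real.sqrt x) * (1 / (Real.sqrt θ * distInt (θ * h)) +
        2 * Real.sqrt h * (2 * Real.sqrt R)) := by gcongr
    _ = C * (x ^ n * Real.sqrt x * (4 * Real.sqrt (h * R) +
        1 / Real.sqrt θ * (1 / distInt (θ * h)))) := by
      rw [Real.sqrt_mul (by positivity)]
      field_simp
      ring
    _ ≤ C * (x ^ n * Real.sqrt x * ((4 + 1 / Real.sqrt θ) * Real.sqrt (h * R) +
        (4 + 1 / Real.sqrt θ) * (1 / distInt (θ * h)))) := by
      have : 0 < 1 / Real.sqrt θ := by positivity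
      gcongr <;> linarith
    _ = _ := by ring

lemma exists_le_abs_mul_sub {θ γ : ℝ} (htype : IsApproxType θ γ) {δ : ℝ} (hδ : 0 < δ) :
    ∃ c, 0 < c ∧ ∀ (q : ℕ) (p : ℤ), 1 ≤ q → c * (q : ℝ) ^ (-(γ + δ)) ≤ |θ * q - p| := by
  obtain ⟨c, hc, hcb⟩ := htype.2 δ hδ
  refine ⟨c, hc, fun q p hq => ?_⟩
  have hq' : (0 : ℝ) < q := by exact_mod_cast hq
  have h2 : |θ * q - p| = q * |θ - p / q| := by
    rw [← abs_of_pos hq', ← abs_mul, abs_of_pos hq']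
    congr 1
    field_simp
  have h3 : (q : ℝ) ^ (-(γ + δ)) = q * (q : ℝ) ^ (-γ - 1 - δ) := by
    rw [← Real.rpow_one_add' hq'.le (by linarith [htype.1])]
    congr 1
    ring
  rw [h2, h3]
  calc c * (q * (q : ℝ) ^ (-γ - 1 - δ)) = q * (c * (q : ℝ) ^ (-γ - 1 - δ)) := by ring
    _ ≤ _ := by
      gcongr
      exact hcb p q hq

lemma exists_one_div_distInt_le {θ γ : ℝ} (htype : IsApproxType θ γ) {δ : ℝ} (hδ : 0 < δ) :
    ∃ C, 0 < C ∧ ∀ h : ℕ, 1 ≤ h →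
      0 < distInt (θ * h) ∧ 1 / distInt (θ * h) ≤ C * (h : ℝ) ^ (γ + δ) := by
  obtain ⟨c, hc, key⟩ := exists_le_abs_mul_sub htype hδ
  refine ⟨1 / c, by positivity, fun h hh => ?_⟩
  have hh' : (0 : ℝ) < h := by exact_mod_cast hh
  have hd : c * (h : ℝ) ^ (-(γ + δ)) ≤ distInt (θ * h) := by
    refine le_min ?_ ?_
    · have := key h ⌊θ * h⌋ hh
      rwa [← Int.fract, abs_of_nonneg (Int.fract_nonneg _)] at this
    · have := key h (⌊θ * h⌋ + 1) hh
      have h4 : θ * h - ((⌊θ * h⌋ + 1 : ℤ) : ℝ) = -(1 - Int.fract (θ * h)) := by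
        push_cast [Int.fract]
        ring
      rwa [h4, abs_neg, abs_of_nonneg (by linarith [Int.fract_lt_one (θ * h)])] at this
  have hpos : 0 < c * (h : ℝ) ^ (-(γ + δ)) := by positivity
  refine ⟨hpos.trans_le hd, ?_⟩
  calc 1 / distInt (θ * h) ≤ 1 / (c * (h : ℝ) ^ (-(γ + δ))) := by gcongr
    _ = 1 / c * (h : ℝ) ^ (γ + δ) := by
      rw [Real.rpow_neg hh'.le]
      field_simp

/-- The normalising constant of `R1`. -/
noncomputable def normConst (l : ℕ) : ℝ := (2 : ℝ) ^ ((2 : ℤ) - l) / ((l - 1).factorial * Real.pi)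

lemma normConst_pos (l : ℕ) : 0 < normConst l := by
  unfold normConst
  have := Real.pi_pos
  positivity

/-- The frequency cutoff used for all `h ≤ N`. -/
noncomputable def freqCutoff (θ : ℝ) (N : ℕ) : ℕ := ⌈θ⌉₊ * N

lemma floor_le_freqCutoff {θ : ℝ} (hθ : 0 < θ) {N h : ℕ} (hN : h ≤ N) :
    ⌊θ * h⌋₊ ≤ freqCutoff θ N := by
  have : (h : ℝ) ≤ N := by exact_mod_cast hN
  refine Nat.floor_le_of_le ?_
  unfold freqCutoff
  push_cast
  have := Nat.le_ceil θ
  gcongr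

/-- The summand of `R1`. -/
noncomputable def oscTerm (l : ℕ) (θ : ℝ) (h m : ℕ) (x : ℝ) : ℝ :=
  (m : ℝ) * (x - θ * m ^ 2) ^ (l - 1) * Real.sin (2 * Real.pi * h * (x / (2 * m) - θ * m / 2))

/-- The part of `R1` with small `h` and large `m`. -/
noncomputable def headSum (l : ℕ) (θ : ℝ) (N : ℕ) (x : ℝ) : ℝ :=
  normConst l * ∑ h ∈ Icc 1 N, ((-1 : ℝ) ^ (l * h) / h) *
    ∑ m ∈ Ioc ⌊Real.sqrt (h * x / freqBound θ h (freqCutoff θ N))⌋₊ ⌊Real.sqrt (x / θ)⌋₊,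
      oscTerm l θ h m x

/-- The stationary phase main term of `headSum`. -/
noncomputable def mainSum (l : ℕ) (θ : ℝ) (N : ℕ) (x : ℝ) : ℝ :=
  normConst l * x ^ ((l : ℝ) - 1 / 4) * ∑ h ∈ Icc 1 N, ∑ r ∈ Ioc ⌊θ * h⌋₊ (freqCutoff θ N),
    uCoef l θ h r *
      Real.cos (2 * Real.pi * Real.sqrt (x * h * (2 * (r : ℝ) - θ * h)) - Real.pi / 4)

lemma uCoef_mul_rpow_eq {l : ℕ} (hl : 1 ≤ l) (θ : ℝ) {h r : ℕ} (hh : 1 ≤ h)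
    (hs : 0 < 2 * (r : ℝ) - θ * h) {x : ℝ} (hx : 0 < x) :
    uCoef l θ h r * x ^ ((l : ℝ) - 1 / 4) = ((-1 : ℝ) ^ (l * h) / h) *
      (h * x / (2 * r - θ * h) * (x - θ * (h * x / (2 * r - θ * h))) ^ (l - 1) /
            Real.sqrt (Real.sqrt (h * x * (2 * r - θ * h)))) := by
  have hh' : (0 : ℝ) < h := by exact_mod_cast hh
  obtain ⟨n, rfl⟩ : ∃ n, l = n + 1 := ⟨l - 1, by omega⟩
  unfold uCoef
  set s := 2 * (r : ℝ) - θ * h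
  simp only [Nat.add_sub_cancel]
  have h1 : Real.sqrt (Real.sqrt (h * x * s)) =
      (h : ℝ) ^ ((1 : ℝ) / 4) * x ^ ((1 : ℝ) / 4) * s ^ ((1 : ℝ) / 4) := by
    rw [Real.sqrt_eq_rpow, Real.sqrt_eq_rpow, ← Real.rpow_mul (by positivity),
      ← Real.mul_rpow hh'.le hx.le, ← Real.mul_rpow (by positivity) hs.le]
    norm_num
  have h2 : x - θ * (h * x / s) = x * (1 - θ * h / s) := by field_simp
  have h3 : x ^ (((n + 1 : ℕ) : ℝ) - 1 / 4) = x ^ n * x / x ^ ((1 : ℝ) / 4) := by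
    rw [Real.rpow_sub hx, Real.rpow_natCast, pow_succ]
  have h4 : (h : ℝ) ^ (-(1 : ℝ) / 4) = 1 / (h : ℝ) ^ ((1 : ℝ) / 4) := by
    rw [neg_div, Real.rpow_neg hh'.le, one_div ((h : ℝ) ^ _)]
  have h5 : s ^ (-(5 : ℝ) / 4) = 1 / (s * s ^ ((1 : ℝ) / 4)) := by
    rw [neg_div, Real.rpow_neg hs.le, ← Real.rpow_one_add' hs.le (by norm_num), one_div]
    norm_num
  rw [h1, h2, h3, h4, h5, mul_pow]
  have := Real.rpow_pos_of_pos hh' (1 / 4)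
  have := Real.rpow_pos_of_pos hx (1 / 4)
  have := Real.rpow_pos_of_pos hs (1 / 4)
  field_simp

lemma two_mul_sub_pos {θ : ℝ} (hθ : 0 < θ) {h r : ℕ} (hh : 1 ≤ h) (hr : ⌊θ * h⌋₊ < r) :
    0 < 2 * (r : ℝ) - θ * h := by
  have hh' : (0 : ℝ) < h := by exact_mod_cast hh
  have := (Nat.floor_lt (by positivity)).1 hr
  have : 0 < θ * h := by positivity
  linarith

lemma exists_abs_headSum_sub_mainSum_le {l : ℕ} (hl : 1 ≤ l) {θ γ : ℝ} (hθ : 0 < θ)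
    (htype : IsApproxType θ γ) {δ : ℝ} (hδ : 0 < δ) :
    ∃ C, 0 < C ∧ ∀ (x : ℝ) (N : ℕ), 0 < x → 1 ≤ N →
      |headSum l θ N x - mainSum l θ N x| ≤ C * (x ^ (l - 1) * Real.sqrt x * (N : ℝ) ^ (γ + δ)) := by
  obtain ⟨C₁, hC₁, hC₁b⟩ := exists_norm_sum_head_sub_le (l - 1) hθ
  obtain ⟨C₂, hC₂, hC₂b⟩ := exists_one_div_distInt_le htype hδ
  set κ : ℝ := Real.sqrt ⌈θ⌉₊ with hκ
  refine ⟨normConst l * C₁ * (2 * κ + C₂), ?_, fun x N hx hN => ?_⟩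
  · have := normConst_pos l
    positivity
  have hN' : (1 : ℝ) ≤ N := by exact_mod_cast hN
  have hγ := htype.1
  have hterm : ∀ h ∈ Icc 1 N, |((-1 : ℝ) ^ (l * h) / h) *
        (∑ m ∈ Ioc ⌊Real.sqrt (h * x / freqBound θ h (freqCutoff θ N))⌋₊ ⌊Real.sqrt (x / θ)⌋₊,
          oscTerm l θ h m x) - x ^ ((l : ℝ) - 1 / 4) * ∑ r ∈ Ioc ⌊θ * h⌋₊ (freqCutoff θ N),
        uCoef l θ h r *
          Real.cos (2 * Real.pi * Real.sqrt (x * h * (2 * (r : ℝ) - θ * h)) - Real.pi / 4)| ≤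
      C₁ * (x ^ (l - 1) * Real.sqrt x) *
        (κ * Real.sqrt N * (1 / Real.sqrt h) + C₂ * (N : ℝ) ^ (γ + δ - 1)) := by
    intro h hh
    rw [mem_Icc] at hh
    have hh' : (0 : ℝ) < h := by exact_mod_cast hh.1
    have hhN : (h : ℝ) ≤ N := by exact_mod_cast hh.2
    obtain ⟨hd, hdb⟩ := hC₂b h hh.1
    have hb := hC₁b x h _ hx hh.1 hd (floor_le_freqCutoff hθ hh.2)
    have him := (Complex.abs_im_le_norm _).trans hb
    rw [Complex.sub_im, Complex.im_sum, Complex.im_sum] at him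
    simp only [Complex.im_ofReal_mul, expTwoPi_im] at him
    have e1 : ∀ m : ℕ, (m * (x - θ * m ^ 2) ^ (l - 1)) *
        Real.sin (2 * Real.pi * (h * x / (2 * m) - θ * h * m / 2)) = oscTerm l θ h m x := by
      intro m
      unfold oscTerm
      congr 2
      ring
    simp only [e1] at him
    have e2 : x ^ ((l : ℝ) - 1 / 4) * ∑ r ∈ Ioc ⌊θ * h⌋₊ (freqCutoff θ N), uCoef l θ h r *
          Real.cos (2 * Real.pi * Real.sqrt (x * h * (2 * (r : ℝ) - θ * h)) - Real.pi / 4) =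
        ((-1 : ℝ) ^ (l * h) / h) * ∑ r ∈ Ioc ⌊θ * h⌋₊ (freqCutoff θ N),
          (h * x / (2 * r - θ * h) * (x - θ * (h * x / (2 * r - θ * h))) ^ (l - 1) /
            Real.sqrt (Real.sqrt (h * x * (2 * r - θ * h)))) *
          Real.sin (2 * Real.pi * (Real.sqrt (h * x * (2 * r - θ * h)) + 1 / 8)) := by
      rw [mul_sum, mul_sum]
      refine sum_congr rfl fun r hr => ?_
      have hs := two_mul_sub_pos hθ hh.1 (mem_Ioc.1 hr).1
      rw [← mul_assoc (((-1 : ℝ) ^ (l * h) / h)), ← uCoef_mul_rpow_eq hl θ hh.1 hs hx,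
        mul_comm x (h : ℝ)]
      have : 2 * Real.pi * (Real.sqrt (h * x * (2 * r - θ * h)) + 1 / 8) =
          2 * Real.pi * Real.sqrt (h * x * (2 * r - θ * h)) - Real.pi / 4 + Real.pi / 2 := by ring
      rw [this, Real.sin_add_pi_div_two]
      ring
    rw [e2, ← mul_sub, abs_mul, abs_div, abs_pow, abs_neg, abs_one, one_pow, abs_of_pos hh']
    calc 1 / (h : ℝ) * _ ≤ 1 / (h : ℝ) * (C₁ * (x ^ (l - 1) * Real.sqrt x *
          (Real.sqrt (h * freqCutoff θ N) + 1 / distInt (θ * h)))) := by gcongr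
      _ ≤ 1 / (h : ℝ) * (C₁ * (x ^ (l - 1) * Real.sqrt x *
          (Real.sqrt h * (κ * Real.sqrt N) + C₂ * (h : ℝ) ^ (γ + δ)))) := by
        gcongr
        unfold freqCutoff
        push_cast
        rw [Real.sqrt_mul hh'.le, Real.sqrt_mul (by positivity)]
      _ = C₁ * (x ^ (l - 1) * Real.sqrt x) *
        (κ * Real.sqrt N * (1 / Real.sqrt h) + C₂ * (h : ℝ) ^ (γ + δ - 1)) := by
        have hsq := Real.mul_self_sqrt hh'.le
        have hsp := Real.sqrt_pos.2 hh'
        rw [Real.rpow_sub_one hh'.ne']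
        have : 1 / Real.sqrt h = Real.sqrt h / h := by
          field_simp
          nlinarith
        rw [this]
        field_simp
      _ ≤ _ := by
        gcongr
        linarith
  unfold headSum mainSum
  rw [mul_assoc, ← mul_sub, abs_mul, abs_of_pos (normConst_pos l), mul_sum, ← sum_sub_distrib]
  calc normConst l * _ ≤ normConst l * ∑ h ∈ Icc 1 N, C₁ * (x ^ (l - 1) * Real.sqrt x) *
        (κ * Real.sqrt N * (1 / Real.sqrt h) + C₂ * (N : ℝ) ^ (γ + δ - 1)) := by
        have := (normConst_pos l).le
        gcongr
        exact (abs_sum_le_sum_abs _ _).trans (sum_le_sum hterm)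
    _ = normConst l * (C₁ * (x ^ (l - 1) * Real.sqrt x) *
        (κ * Real.sqrt N * (∑ h ∈ Icc 1 N, 1 / Real.sqrt h) + C₂ * (N : ℝ) ^ (γ + δ))) := by
        rw [← mul_sum, sum_add_distrib, ← mul_sum, sum_const, Nat.card_Icc, nsmul_eq_mul,
          Real.rpow_sub_one (by positivity)]
        congr 3
        push_cast [Nat.add_sub_cancel]
        field_simp
    _ ≤ normConst l * (C₁ * (x ^ (l - 1) * Real.sqrt x) *
        (κ * Real.sqrt N * (2 * Real.sqrt N) + C₂ * (N : ℝ) ^ (γ + δ))) := by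
        have := (normConst_pos l).le
        gcongr
        exact sum_one_div_sqrt_le N
    _ ≤ normConst l * (C₁ * (x ^ (l - 1) * Real.sqrt x) *
        (2 * κ * (N : ℝ) ^ (γ + δ) + C₂ * (N : ℝ) ^ (γ + δ))) := by
        have := (normConst_pos l).le
        have h1 : (N : ℝ) ≤ (N : ℝ) ^ (γ + δ) := by
          simpa using Real.rpow_le_rpow_of_exponent_le hN' (by linarith : (1 : ℝ) ≤ γ + δ)
        have h2 : κ * Real.sqrt N * (2 * Real.sqrt N) ≤ 2 * κ * (N : ℝ) ^ (γ + δ) := by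
          calc κ * Real.sqrt N * (2 * Real.sqrt N) = 2 * κ * (Real.sqrt N * Real.sqrt N) := by ring
            _ = 2 * κ * N := by rw [Real.mul_self_sqrt (by positivity)]
            _ ≤ _ := by gcongr
        refine mul_le_mul_of_nonneg_left (mul_le_mul_of_nonneg_left ?_ (by positivity)) this
        linarith
    _ = _ := by ring

lemma abs_integral_pow_mul_cos_sqrt_le (k : ℕ) {T : ℝ} (hT : 0 < T) {c : ℝ} (hc : c ≠ 0) (β : ℝ) :
    |∫ x in T..(2 * T), x ^ k / Real.sqrt x * Real.cos (c * Real.sqrt x + β)| ≤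
      4 * (2 * T) ^ k / |c| := by
  wlog hc0 : 0 < c generalizing c β
  · have h := this (c := -c) (neg_ne_zero.2 hc) (-β)
      (neg_pos.2 (lt_of_le_of_ne (not_lt.1 hc0) hc))
    rw [abs_neg] at h
    convert h using 5
    rw [← Real.cos_neg]
    congr 1
    ring
  have hpos : ∀ x ∈ Set.Icc T (2 * T), 0 < x := fun x hx => hT.trans_le hx.1
  have hsc : ContinuousOn (fun x : ℝ => c / (2 * Real.sqrt x)) (Set.Icc T (2 * T)) := by
    refine ContinuousOn.div continuousOn_const (by fun_prop) fun x hx => ?_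
    have := Real.sqrt_pos.2 (hpos x hx)
    positivity
  have h := abs_integral_mul_deriv_mul_cos_le (a := T) (b := 2 * T) (by linarith)
    (φ := fun x => c * Real.sqrt x + β) (φ' := fun x => c / (2 * Real.sqrt x))
    (G := fun x => 2 / c * x ^ k) (G' := fun x => 2 / c * (k * x ^ (k - 1)))
    (fun x hx => by
      refine HasDerivAt.congr_deriv
        (((Real.hasDerivAt_sqrt (hpos x hx).ne').const_mul c).add_const β) ?_
      field_simp)
    (fun x _ => (hasDerivAt_pow k x).const_mul _) hsc
    (by fun_prop) (by positivity)
    (fun x hx => by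
      have := hpos x hx
      positivity)
  rw [abs_of_pos hc0]
  have e : ∫ x in T..(2 * T), x ^ k / Real.sqrt x * Real.cos (c * Real.sqrt x + β) =
      ∫ x in T..(2 * T), 2 / c * x ^ k *
        (c / (2 * Real.sqrt x) * Real.cos (c * Real.sqrt x + β)) := by
    congr 1
    ext x
    field_simp
  rw [e]
  refine h.trans_eq ?_
  ring

/-- The mean square of a sum of waves in `√x` is given by its diagonal, up to a sum over pairs of
distinct frequencies. -/
lemma abs_integral_sum_cos_sqrt_sq_sub_le {ι : Type*} [DecidableEq ι] (k : ℕ) {T : ℝ} (hT : 0 < T)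
    (S : Finset ι) (a c : ι → ℝ) (hc : ∀ i ∈ S, 0 < c i)
    (hne : ∀ i ∈ S, ∀ j ∈ S, i ≠ j → c i ≠ c j) :
    |(∫ x in T..(2 * T), x ^ k / Real.sqrt x *
        (∑ i ∈ S, a i * Real.cos (c i * Real.sqrt x - Real.pi / 4)) ^ 2) -
      1 / 2 * (∑ i ∈ S, a i ^ 2) * ∫ x in T..(2 * T), x ^ k / Real.sqrt x| ≤
      4 * (2 * T) ^ k * (∑ i ∈ S, a i ^ 2 / c i +
        ∑ i ∈ S, ∑ j ∈ S.erase i, |a i * a j| / |c i - c j|) := by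
  have hpos : ∀ x ∈ Set.uIcc T (2 * T), 0 < x := fun x hx => by
    rw [Set.uIcc_of_le (by linarith)] at hx
    exact hT.trans_le hx.1
  have hw : ContinuousOn (fun x : ℝ => x ^ k / Real.sqrt x) (Set.uIcc T (2 * T)) := by
    refine ContinuousOn.div (by fun_prop) (by fun_prop) fun x hx => ?_
    exact (Real.sqrt_pos.2 (hpos x hx)).ne'
  have hint : ∀ d β : ℝ, IntervalIntegrable
      (fun x : ℝ => x ^ k / Real.sqrt x * Real.cos (d * Real.sqrt x + β)) MeasureTheory.volume
      T (2 * T) := fun d β =>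
    (hw.mul (by fun_prop)).intervalIntegrable
  set I : ℝ → ℝ → ℝ := fun d β =>
    ∫ x in T..(2 * T), x ^ k / Real.sqrt x * Real.cos (d * Real.sqrt x + β) with hI
  set I₀ : ℝ := ∫ x in T..(2 * T), x ^ k / Real.sqrt x with hI₀
  have hI0 : I 0 0 = I₀ := by simp [hI, hI₀]
  have e1 : (∫ x in T..(2 * T), x ^ k / Real.sqrt x *
        (∑ i ∈ S, a i * Real.cos (c i * Real.sqrt x - Real.pi / 4)) ^ 2) =
      ∑ i ∈ S, ∑ j ∈ S, a i * a j * (1 / 2 * (I (c i - c j) 0 + I (c i + c j) (-(Real.pi / 2)))) := by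
    have : ∀ x : ℝ, x ^ k / Real.sqrt x *
        (∑ i ∈ S, a i * Real.cos (c i * Real.sqrt x - Real.pi / 4)) ^ 2 =
        ∑ i ∈ S, ∑ j ∈ S, a i * a j * (1 / 2 *
          (x ^ k / Real.sqrt x * Real.cos ((c i - c j) * Real.sqrt x + 0) +
          x ^ k / Real.sqrt x * Real.cos ((c i + c j) * Real.sqrt x + -(Real.pi / 2)))) := by
      intro x
      rw [sq, sum_mul_sum, mul_sum]
      refine sum_congr rfl fun i _ => ?_
      rw [mul_sum]
      refine sum_congr rfl fun j _ => ?_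
      have h1 : (c i - c j) * Real.sqrt x + 0 =
        (c i * Real.sqrt x - Real.pi / 4) - (c j * Real.sqrt x - Real.pi / 4) := by ring
      have h2 : (c i + c j) * Real.sqrt x + -(Real.pi / 2) =
        (c i * Real.sqrt x - Real.pi / 4) + (c j * Real.sqrt x - Real.pi / 4) := by ring
      rw [h1, h2, Real.cos_add, Real.cos_sub (c i * Real.sqrt x - Real.pi / 4)]
      ring
    simp_rw [this]
    rw [intervalIntegral.integral_finsetSum fun i _ => by
      simpa only [Finset.sum_fn] using IntervalIntegrable.sum S fun j _ =>
        (((hint (c i - c j) 0).add (hint (c i + c j) (-(Real.pi / 2)))).const_mul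
          (1 / 2)).const_mul (a i * a j)]
    refine sum_congr rfl fun i _ => ?_
    rw [intervalIntegral.integral_finsetSum fun j _ =>
      (((hint _ _).add (hint _ _)).const_mul _).const_mul _]
    refine sum_congr rfl fun j _ => ?_
    rw [intervalIntegral.integral_const_mul, intervalIntegral.integral_const_mul,
      intervalIntegral.integral_add (hint _ _) (hint _ _)]
  have e2 : (∑ i ∈ S, ∑ j ∈ S, a i * a j *
        (1 / 2 * (I (c i - c j) 0 + I (c i + c j) (-(Real.pi / 2))))) -
      1 / 2 * (∑ i ∈ S, a i ^ 2) * I₀ = ∑ i ∈ S, (a i ^ 2 * (1 / 2 * I (c i + c i) (-(Real.pi / 2))) +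
        ∑ j ∈ S.erase i, a i * a j *
          (1 / 2 * (I (c i - c j) 0 + I (c i + c j) (-(Real.pi / 2))))) := by
    rw [mul_sum, sum_mul, ← sum_sub_distrib]
    refine sum_congr rfl fun i hi => ?_
    rw [← add_sum_erase S _ hi, sub_self, hI0]
    ring
  rw [e1, e2, ← sum_add_distrib, mul_sum]
  refine (abs_sum_le_sum_abs _ _).trans (sum_le_sum fun i hi => ?_)
  have hK : 0 ≤ 4 * (2 * T) ^ k := by positivity
  refine (abs_add_le _ _).trans ?_
  rw [mul_add, mul_sum]
  refine add_le_add ?_ ((abs_sum_le_sum_abs _ _).trans (sum_le_sum fun j hj => ?_))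
  · have hci := hc i hi
    have h := abs_integral_pow_mul_cos_sqrt_le k hT (add_pos hci hci).ne' (-(Real.pi / 2))
    rw [abs_of_pos (add_pos hci hci)] at h
    rw [abs_mul, abs_of_nonneg (sq_nonneg _), abs_mul, abs_of_pos (by norm_num : (0 : ℝ) < 1 / 2)]
    calc a i ^ 2 * (1 / 2 * |I (c i + c i) (-(Real.pi / 2))|)
        ≤ a i ^ 2 * (1 / 2 * (4 * (2 * T) ^ k / (c i + c i))) := by gcongr
      _ = 4 * (2 * T) ^ k * (a i ^ 2 / c i) * (1 / 4) := by
        field_simp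
        ring
      _ ≤ _ := by
        have : 0 ≤ 4 * (2 * T) ^ k * (a i ^ 2 / c i) := by positivity
        linarith
  · have hci := hc i hi
    have hcj := hc j (mem_of_mem_erase hj)
    have hij := sub_ne_zero.2 (hne i hi j (mem_of_mem_erase hj) (ne_of_mem_erase hj).symm)
    have h1 := abs_integral_pow_mul_cos_sqrt_le k hT hij 0
    have h2 := abs_integral_pow_mul_cos_sqrt_le k hT (add_pos hci hcj).ne' (-(Real.pi / 2))
    have h3 : 4 * (2 * T) ^ k / |c i + c j| ≤ 4 * (2 * T) ^ k / |c i - c j| := by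
      have := abs_pos.2 hij
      have h4 : |c i - c j| ≤ |c i + c j| := by
        rw [abs_of_pos (add_pos hci hcj), abs_le]
        constructor <;> linarith
      exact div_le_div_of_nonneg_left hK this h4
    rw [abs_mul]
    calc |a i * a j| * |1 / 2 * (I (c i - c j) 0 + I (c i + c j) (-(Real.pi / 2)))|
        ≤ |a i * a j| * (4 * (2 * T) ^ k / |c i - c j|) := by
          gcongr
          rw [abs_mul, abs_of_pos (by norm_num : (0 : ℝ) < 1 / 2)]
          have := abs_add_le (I (c i - c j) 0) (I (c i + c j) (-(Real.pi / 2)))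
          linarith
      _ = _ := by ring

/-- The lattice points `(h, r)` occurring in `mainSum`. -/
noncomputable def freqSet (θ : ℝ) (N : ℕ) : Finset (ℕ × ℕ) :=
  (Icc 1 N ×ˢ Icc 1 (freqCutoff θ N)).filter fun p => ⌊θ * p.1⌋₊ < p.2

lemma mem_freqSet {θ : ℝ} {N : ℕ} {p : ℕ × ℕ} :
    p ∈ freqSet θ N ↔ (1 ≤ p.1 ∧ p.1 ≤ N) ∧ ⌊θ * p.1⌋₊ < p.2 ∧ p.2 ≤ freqCutoff θ N := by
  simp only [freqSet, mem_filter, mem_product, mem_Icc]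
  constructor
  · rintro ⟨⟨h1, h2⟩, h3⟩
    exact ⟨h1, h3, h2.2⟩
  · rintro ⟨h1, h2, h3⟩
    exact ⟨⟨h1, by omega, h3⟩, h2⟩

lemma sum_freqSet (θ : ℝ) (N : ℕ) (f : ℕ → ℕ → ℝ) :
    ∑ p ∈ freqSet θ N, f p.1 p.2 =
      ∑ h ∈ Icc 1 N, ∑ r ∈ Ioc ⌊θ * h⌋₊ (freqCutoff θ N), f h r := by
  rw [freqSet, sum_filter, sum_product]
  refine sum_congr rfl fun h _ => ?_
  rw [← sum_filter]
  refine sum_congr ?_ fun _ _ => rfl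
  ext r
  simp only [mem_filter, mem_Icc, mem_Ioc]
  omega

/-- The frequency attached to `(h, r)`. -/
noncomputable def freq (θ : ℝ) (p : ℕ × ℕ) : ℝ := p.1 * (2 * (p.2 : ℝ) - θ * p.1)

lemma mainSum_eq {θ : ℝ} (l N : ℕ) {x : ℝ} (hx : 0 ≤ x) :
    mainSum l θ N x = x ^ ((l : ℝ) - 1 / 4) * ∑ p ∈ freqSet θ N, normConst l * uCoef l θ p.1 p.2 *
      Real.cos (2 * Real.pi * Real.sqrt (freq θ p) * Real.sqrt x - Real.pi / 4) := by
  unfold mainSum freq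
  rw [sum_freqSet θ N fun h r => normConst l * uCoef l θ h r * Real.cos (2 * Real.pi *
    Real.sqrt (h * (2 * (r : ℝ) - θ * h)) * Real.sqrt x - Real.pi / 4), mul_sum, mul_sum]
  refine sum_congr rfl fun h _ => ?_
  rw [mul_sum, mul_sum]
  refine sum_congr rfl fun r _ => ?_
  rw [mul_assoc x, Real.sqrt_mul hx]
  have : ∀ a : ℝ, 2 * Real.pi * (Real.sqrt x * a) = 2 * Real.pi * a * Real.sqrt x := fun a => by
    ring
  rw [this]
  ring

lemma freqSet_bounds {θ : ℝ} (hθ : 0 < θ) {N : ℕ} {p : ℕ × ℕ} (hp : p ∈ freqSet θ N) :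
    (1 : ℝ) ≤ p.1 ∧ (1 : ℝ) ≤ p.2 ∧ θ * p.1 < p.2 ∧ (p.2 : ℝ) ≤ 2 * (p.2 : ℝ) - θ * p.1 := by
  obtain ⟨h1, h2, -⟩ := mem_freqSet.1 hp
  have h3 : (1 : ℝ) ≤ p.1 := by exact_mod_cast h1.1
  have h4 := (Nat.floor_lt (by positivity)).1 h2
  refine ⟨h3, ?_, h4, by linarith⟩
  have : 1 ≤ p.2 := by omega
  exact_mod_cast this

lemma abs_uCoef_le (l : ℕ) {θ : ℝ} (hθ : 0 < θ) {h r : ℕ} (hr : θ * h < r) :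
    |uCoef l θ h r| ≤ (h : ℝ) ^ (-(1 : ℝ) / 4) * (2 * (r : ℝ) - θ * h) ^ (-(5 : ℝ) / 4) := by
  have hr0 : 0 ≤ θ * h := by positivity
  have hs : 0 < 2 * (r : ℝ) - θ * h := by linarith
  unfold uCoef
  have h1 : 0 ≤ 1 - θ * h / (2 * (r : ℝ) - θ * h) := by
    rw [sub_nonneg, div_le_one hs]
    linarith
  have h2 : 1 - θ * h / (2 * (r : ℝ) - θ * h) ≤ 1 := by
    have : 0 ≤ θ * h / (2 * (r : ℝ) - θ * h) := by positivity
    linarith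
  rw [abs_mul, abs_mul, abs_mul, abs_pow, abs_neg, abs_one, one_pow, one_mul, abs_pow,
    abs_of_nonneg h1, abs_of_nonneg (by positivity : 0 ≤ (h : ℝ) ^ (-(1 : ℝ) / 4)),
    abs_of_nonneg (by positivity : 0 ≤ (2 * (r : ℝ) - θ * h) ^ (-(5 : ℝ) / 4))]
  exact mul_le_of_le_one_right (by positivity) (pow_le_one₀ h1 h2)

lemma exists_le_abs_freq_sub {θ γ : ℝ} (htype : IsApproxType θ γ) {δ : ℝ} (hδ : 0 < δ) :
    ∃ c, 0 < c ∧ ∀ N : ℕ, 1 ≤ N → ∀ p ∈ freqSet θ N, ∀ p' ∈ freqSet θ N, p ≠ p' →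
      c * (N : ℝ) ^ (-(2 * (γ + δ))) ≤ |freq θ p - freq θ p'| := by
  obtain ⟨c, hc, hcb⟩ := exists_le_abs_mul_sub htype hδ
  have hγ := htype.1
  refine ⟨min c 1, by positivity, fun N hN p hp p' hp' hne => ?_⟩
  have hN' : (1 : ℝ) ≤ N := by exact_mod_cast hN
  wlog hle : p.1 ≤ p'.1 generalizing p p'
  · rw [abs_sub_comm]
    exact this p' hp' p hp hne.symm (by omega)
  obtain ⟨⟨h1, -⟩, -⟩ := mem_freqSet.1 hp
  obtain ⟨⟨-, h2⟩, -⟩ := mem_freqSet.1 hp'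
  rcases hle.eq_or_lt with heq | hlt
  · have hr : p.2 ≠ p'.2 := fun h => hne (Prod.ext heq h)
    have e : freq θ p - freq θ p' = ((2 * p'.1 * ((p.2 : ℤ) - p'.2) : ℤ) : ℝ) := by
      unfold freq
      rw [heq]
      push_cast
      ring
    have hz : 2 * (p'.1 : ℤ) * ((p.2 : ℤ) - p'.2) ≠ 0 := by
      have : (p.2 : ℤ) - p'.2 ≠ 0 := by omega
      have h0 : (p'.1 : ℤ) ≠ 0 := by omega
      positivity
    have h3 : (1 : ℝ) ≤ |freq θ p - freq θ p'| := by
      rw [e, ← Int.cast_abs]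
      exact_mod_cast Int.one_le_abs hz
    refine le_trans ?_ h3
    exact mul_le_one₀ (min_le_right _ _) (by positivity)
      (Real.rpow_le_one_of_one_le_of_nonpos hN' (by linarith))
  · have hb : 1 ≤ p'.1 ^ 2 - p.1 ^ 2 := by
      have : p.1 ^ 2 < p'.1 ^ 2 := Nat.pow_lt_pow_left hlt (by norm_num)
      omega
    have hbN : p'.1 ^ 2 - p.1 ^ 2 ≤ N ^ 2 := (Nat.sub_le _ _).trans (Nat.pow_le_pow_left h2 2)
    have h3 := hcb (p'.1 ^ 2 - p.1 ^ 2) (2 * (p'.1 * p'.2 - p.1 * p.2)) hb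
    have e : freq θ p - freq θ p' = θ * ((p'.1 ^ 2 - p.1 ^ 2 : ℕ) : ℝ) -
        ((2 * (p'.1 * p'.2 - p.1 * p.2) : ℤ) : ℝ) := by
      unfold freq
      rw [Nat.cast_sub (Nat.pow_le_pow_left hle 2)]
      push_cast
      ring
    rw [e]
    refine le_trans ?_ h3
    have hb' : (1 : ℝ) ≤ ((p'.1 ^ 2 - p.1 ^ 2 : ℕ) : ℝ) := by exact_mod_cast hb
    have hbN' : ((p'.1 ^ 2 - p.1 ^ 2 : ℕ) : ℝ) ≤ (N : ℝ) ^ 2 := by exact_mod_cast hbN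
    refine mul_le_mul (min_le_left _ _) ?_ (by positivity) hc.le
    calc (N : ℝ) ^ (-(2 * (γ + δ))) = ((N : ℝ) ^ 2) ^ (-(γ + δ)) := by
          rw [← Real.rpow_natCast, ← Real.rpow_mul (by positivity)]
          congr 1
          push_cast
          ring
      _ ≤ _ := Real.rpow_le_rpow_of_nonpos (by linarith) hbN' (by linarith)

lemma sum_freqSet_one_div_le (θ : ℝ) (N : ℕ) :
    ∑ p ∈ freqSet θ N, 1 / ((p.1 : ℝ) * p.2) ≤
      (1 + Real.log N) * (1 + Real.log (freqCutoff θ N)) := by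
  calc _ ≤ ∑ p ∈ Icc 1 N ×ˢ Icc 1 (freqCutoff θ N), 1 / ((p.1 : ℝ) * p.2) :=
        sum_le_sum_of_subset_of_nonneg (filter_subset _ _) fun _ _ _ => by positivity
    _ = (∑ h ∈ Icc 1 N, 1 / (h : ℝ)) * ∑ r ∈ Icc 1 (freqCutoff θ N), 1 / (r : ℝ) := by
        rw [sum_mul_sum, sum_product]
        simp only [one_div_mul_one_div]
    _ ≤ _ := mul_le_mul (sum_Icc_one_div_le N) (sum_Icc_one_div_le _)
        (sum_nonneg fun _ _ => by positivity) (by have := Real.log_natCast_nonneg N; linarith)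

/-- A pointwise bound separating the close pairs of square roots from the distant ones. -/
lemma mul_div_abs_sqrt_sub_le {a b m n : ℝ} (ha : 0 ≤ a) (hb : 0 ≤ b) (hm : 0 < m) (hn : 0 < n)
    (hmn : m ≠ n) :
    a * b / |Real.sqrt m - Real.sqrt n| ≤
      3 / 2 * (a ^ 2 * Real.sqrt m + b ^ 2 * Real.sqrt n) / |m - n| +
        2 * ((a / Real.sqrt (Real.sqrt m)) * (b / Real.sqrt (Real.sqrt n))) := by
  wlog h : n ≤ m generalizing a b m n
  · have := this hb ha hn hm hmn.symm (le_of_not_ge h)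
    rw [abs_sub_comm, abs_sub_comm m, mul_comm a, add_comm (a ^ 2 * _), mul_comm (a / _)]
    exact this
  obtain ⟨s, hs, rfl⟩ : ∃ s, 0 < s ∧ m = s ^ 2 :=
    ⟨Real.sqrt m, Real.sqrt_pos.2 hm, (Real.sq_sqrt hm.le).symm⟩
  obtain ⟨t, ht, rfl⟩ : ∃ t, 0 < t ∧ n = t ^ 2 :=
    ⟨Real.sqrt n, Real.sqrt_pos.2 hn, (Real.sq_sqrt hn.le).symm⟩
  rw [Real.sqrt_sq hs.le, Real.sqrt_sq ht.le]
  have hlt : t ^ 2 < s ^ 2 := lt_of_le_of_ne h (Ne.symm hmn)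
  have hts : t < s := lt_of_pow_lt_pow_left₀ 2 hs.le hlt
  rw [abs_of_pos (sub_pos.2 hts), abs_of_pos (sub_pos.2 hlt)]
  have hd : 0 < s - t := sub_pos.2 hts
  by_cases hcase : s ≤ 2 * t
  · have h1 : a * b / (s - t) = a * b * (s + t) / (s ^ 2 - t ^ 2) := by
      have : s ^ 2 - t ^ 2 = (s + t) * (s - t) := by ring
      rw [this]
      field_simp
    have h2 : a * b * (s + t) ≤ 3 / 2 * (a ^ 2 * s + b ^ 2 * t) := by
      have h3 : a * b ≤ (a ^ 2 + b ^ 2) / 2 := by linarith [sq_nonneg (a - b)]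
      have h4 : a * b * (s + t) ≤ (a ^ 2 + b ^ 2) / 2 * (s + t) := by gcongr
      have h5 : a ^ 2 * t ≤ a ^ 2 * s := by gcongr
      have h6 : b ^ 2 * s ≤ b ^ 2 * (2 * t) := by gcongr
      have h7 : 0 ≤ a ^ 2 * s := by positivity
      linarith
    have h3 : 0 < s ^ 2 - t ^ 2 := sub_pos.2 hlt
    rw [h1]
    have h4 : a * b * (s + t) / (s ^ 2 - t ^ 2) ≤
        3 / 2 * (a ^ 2 * s + b ^ 2 * t) / (s ^ 2 - t ^ 2) := by gcongr
    have : 0 ≤ 2 * ((a / Real.sqrt s) * (b / Real.sqrt t)) := by positivity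
    linarith
  · have h1 : Real.sqrt s * Real.sqrt t / 2 ≤ s - t := by
      have h2 : Real.sqrt s * Real.sqrt t ≤ Real.sqrt s * Real.sqrt s := by gcongr
      rw [Real.mul_self_sqrt hs.le] at h2
      linarith
    have h3 : 0 < s ^ 2 - t ^ 2 := sub_pos.2 hlt
    have h4 : 0 ≤ 3 / 2 * (a ^ 2 * s + b ^ 2 * t) / (s ^ 2 - t ^ 2) := by positivity
    have hs' := Real.sqrt_pos.2 hs
    have ht' := Real.sqrt_pos.2 ht
    calc a * b / (s - t) ≤ a * b / (Real.sqrt s * Real.sqrt t / 2) := by gcongr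
      _ = 2 * ((a / Real.sqrt s) * (b / Real.sqrt t)) := by field_simp
      _ ≤ _ := by linarith

lemma exists_pow_four_eq {a : ℝ} (ha : 0 < a) : ∃ t, 0 < t ∧ a = t ^ 4 :=
  ⟨a ^ ((1 : ℝ) / 4), by positivity, by rw [← Real.rpow_mul_natCast ha.le]; norm_num⟩

lemma rpow_mul_rpow_sq_mul_sqrt {a s : ℝ} (ha : 0 < a) (hs : 0 < s) :
    (a ^ (-(1 : ℝ) / 4) * s ^ (-(5 : ℝ) / 4)) ^ 2 * Real.sqrt (a * s) = 1 / s ^ 2 ∧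
    a ^ (-(1 : ℝ) / 4) * s ^ (-(5 : ℝ) / 4) / Real.sqrt (Real.sqrt (a * s)) =
      1 / (Real.sqrt a * (s * Real.sqrt s)) := by
  obtain ⟨t, ht, rfl⟩ := exists_pow_four_eq ha
  obtain ⟨v, hv, rfl⟩ := exists_pow_four_eq hs
  have h1 : (t ^ 4) ^ (-(1 : ℝ) / 4) = 1 / t := by
    rw [← Real.rpow_natCast, ← Real.rpow_mul ht.le]
    norm_num [Real.rpow_neg_one]
  have h2 : (v ^ 4) ^ (-(5 : ℝ) / 4) = 1 / v ^ 5 := by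
    rw [← Real.rpow_natCast, ← Real.rpow_mul hv.le, one_div, ← Real.rpow_natCast v 5,
      ← Real.rpow_neg hv.le]
    norm_num
  have h3 : ∀ y : ℝ, 0 ≤ y → Real.sqrt (y ^ 4) = y ^ 2 := fun y hy => by
    rw [show y ^ 4 = (y ^ 2) ^ 2 by ring, Real.sqrt_sq (by positivity)]
  rw [h1, h2, ← mul_pow, h3 _ (by positivity), Real.sqrt_sq (by positivity), h3 t ht.le, h3 v hv.le]
  constructor <;> field_simp

lemma freqSet_weight_le {θ : ℝ} (hθ : 0 < θ) {N : ℕ} {p : ℕ × ℕ} (hp : p ∈ freqSet θ N) :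
    (((p.1 : ℝ) ^ (-(1 : ℝ) / 4) * (2 * (p.2 : ℝ) - θ * p.1) ^ (-(5 : ℝ) / 4)) ^ 2 *
      Real.sqrt (freq θ p) ≤ 1 / θ * (1 / ((p.1 : ℝ) * p.2))) ∧
    ((p.1 : ℝ) ^ (-(1 : ℝ) / 4) * (2 * (p.2 : ℝ) - θ * p.1) ^ (-(5 : ℝ) / 4) /
      Real.sqrt (Real.sqrt (freq θ p)) ≤ 1 / Real.sqrt θ * (1 / ((p.1 : ℝ) * p.2))) := by
  obtain ⟨h1, h2, h3, h4⟩ := freqSet_bounds hθ hp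
  have hh : (0 : ℝ) < p.1 := by linarith
  have hr : (0 : ℝ) < p.2 := by linarith
  unfold freq
  set s := 2 * (p.2 : ℝ) - θ * p.1
  have hs : 0 < s := by linarith
  obtain ⟨e1, e2⟩ := rpow_mul_rpow_sq_mul_sqrt hh hs
  rw [e1, e2, one_div_mul_one_div, one_div_mul_one_div]
  constructor
  · refine one_div_le_one_div_of_le (by positivity) ?_
    calc θ * (p.1 * p.2) = (θ * p.1) * p.2 := by ring
      _ ≤ s * s := by gcongr; linarith
      _ = s ^ 2 := by ring
  · refine one_div_le_one_div_of_le (by positivity) ?_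
    have h6 := Real.mul_self_sqrt hh.le
    have h5 : Real.sqrt θ * Real.sqrt p.1 ≤ Real.sqrt s := by
      rw [← Real.sqrt_mul hθ.le]
      exact Real.sqrt_le_sqrt (by linarith)
    calc Real.sqrt θ * (p.1 * p.2) = Real.sqrt θ * ((Real.sqrt p.1 * Real.sqrt p.1) * p.2) := by
          rw [h6]
      _ = Real.sqrt p.1 * (p.2 * (Real.sqrt θ * Real.sqrt p.1)) := by ring
      _ ≤ _ := by gcongr

lemma freq_pos {θ : ℝ} (hθ : 0 < θ) {N : ℕ} {p : ℕ × ℕ} (hp : p ∈ freqSet θ N) :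
    1 ≤ freq θ p := by
  obtain ⟨h1, h2, h3, h4⟩ := freqSet_bounds hθ hp
  unfold freq
  nlinarith

lemma card_freqSet_le (θ : ℝ) (N : ℕ) : #(freqSet θ N) ≤ N * freqCutoff θ N :=
  (card_filter_le _ _).trans (by simp)

/-- The diagonal error terms and the sum over distinct frequencies in the mean square of
`mainSum`. -/
lemma sum_freqSet_uCoef_le {l : ℕ} {θ : ℝ} (hθ : 0 < θ) {N : ℕ} (hN : 1 ≤ N) {g : ℝ} (hg : 0 < g)
    (hgap : ∀ p ∈ freqSet θ N, ∀ p' ∈ freqSet θ N, p ≠ p' → g ≤ |freq θ p - freq θ p'|) :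
    ∑ p ∈ freqSet θ N, uCoef l θ p.1 p.2 ^ 2 / Real.sqrt (freq θ p) +
      ∑ p ∈ freqSet θ N, ∑ p' ∈ (freqSet θ N).erase p, |uCoef l θ p.1 p.2 * uCoef l θ p'.1 p'.2| /
        |Real.sqrt (freq θ p) - Real.sqrt (freq θ p')| ≤
      (1 + 6 / g + 2) / θ * ((1 + Real.log N) * (1 + Real.log (freqCutoff θ N))) ^ 2 := by
  set S := freqSet θ N with hS
  set b : ℕ × ℕ → ℝ := fun p =>
    (p.1 : ℝ) ^ (-(1 : ℝ) / 4) * (2 * (p.2 : ℝ) - θ * p.1) ^ (-(5 : ℝ) / 4) with hb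
  set w : ℕ × ℕ → ℝ := fun p => 1 / ((p.1 : ℝ) * p.2) with hw
  set Λ := (1 + Real.log N) * (1 + Real.log (freqCutoff θ N)) with hΛ
  have hub : ∀ p ∈ S, |uCoef l θ p.1 p.2| ≤ b p := fun p hp =>
    abs_uCoef_le l hθ (freqSet_bounds hθ hp).2.2.1
  have hb0 : ∀ p ∈ S, 0 ≤ b p := fun p hp => (abs_nonneg _).trans (hub p hp)
  have hn1 : ∀ p ∈ S, 1 ≤ freq θ p := fun p hp => freq_pos hθ hp
  have hw1 : ∀ p ∈ S, b p ^ 2 * Real.sqrt (freq θ p) ≤ 1 / θ * w p := fun p hp =>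
    (freqSet_weight_le hθ hp).1
  have hw2 : ∀ p ∈ S, b p / Real.sqrt (Real.sqrt (freq θ p)) ≤ 1 / Real.sqrt θ * w p :=
    fun p hp => (freqSet_weight_le hθ hp).2
  have hw0 : ∀ p, 0 ≤ w p := fun p => by positivity
  have hwΛ : ∑ p ∈ S, w p ≤ Λ := sum_freqSet_one_div_le θ N
  have hlogN : 0 ≤ Real.log N := Real.log_natCast_nonneg N
  have hlogR : 0 ≤ Real.log (freqCutoff θ N) := Real.log_natCast_nonneg _
  have hΛ1 : 1 ≤ Λ := by
    rw [hΛ]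
    nlinarith [mul_nonneg hlogN hlogR]
  have hR : 1 ≤ freqCutoff θ N := Nat.one_le_iff_ne_zero.2
    (Nat.mul_ne_zero (Nat.ceil_pos.2 hθ).ne' (by omega))
  have hcard : 1 + Real.log (#S) ≤ Λ := by
    have h1 : Real.log (#S) ≤ Real.log N + Real.log (freqCutoff θ N) := by
      rw [← Real.log_mul (by positivity) (by positivity)]
      rcases Nat.eq_zero_or_pos (#S) with h0 | h0
      · rw [h0, Nat.cast_zero, Real.log_zero]
        rw [← Nat.cast_mul]
        exact Real.log_natCast_nonneg _
      · refine Real.log_le_log (by exact_mod_cast h0) ?_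
        exact_mod_cast card_freqSet_le θ N
    rw [hΛ]
    nlinarith [mul_nonneg hlogN hlogR]
  have hd : ∑ p ∈ S, uCoef l θ p.1 p.2 ^ 2 / Real.sqrt (freq θ p) ≤ 1 / θ * Λ := by
    calc _ ≤ ∑ p ∈ S, 1 / θ * w p := by
          refine sum_le_sum fun p hp => le_trans ?_ (hw1 p hp)
          have h1 : 1 ≤ Real.sqrt (freq θ p) := Real.one_le_sqrt.2 (hn1 p hp)
          calc uCoef l θ p.1 p.2 ^ 2 / Real.sqrt (freq θ p) ≤ uCoef l θ p.1 p.2 ^ 2 :=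
                div_le_self (sq_nonneg _) h1
            _ ≤ b p ^ 2 := sq_le_sq' (by linarith [neg_abs_le (uCoef l θ p.1 p.2), hub p hp])
                ((le_abs_self _).trans (hub p hp))
            _ ≤ _ := le_mul_of_one_le_right (sq_nonneg _) h1
      _ ≤ _ := by
          rw [← mul_sum]
          gcongr
  set D : ℕ × ℕ → ℕ × ℕ → ℝ := fun p p' => 1 / |freq θ p - freq θ p'| with hD
  have hDsum : ∀ p ∈ S, ∑ p' ∈ S.erase p, D p p' ≤ 2 / g * Λ := fun p hp =>
    (sum_one_div_dist_le S (freq θ) hg hgap hp).trans (by gcongr)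
  have hnear : ∑ p ∈ S, ∑ p' ∈ S.erase p, w p * D p p' ≤ 2 / g * Λ ^ 2 := by
    calc _ ≤ ∑ p ∈ S, w p * (2 / g * Λ) := by
          refine sum_le_sum fun p hp => ?_
          rw [← mul_sum]
          exact mul_le_mul_of_nonneg_left (hDsum p hp) (hw0 p)
      _ = (∑ p ∈ S, w p) * (2 / g * Λ) := by rw [sum_mul]
      _ ≤ Λ * (2 / g * Λ) := by gcongr
      _ = _ := by ring
  have hnear' : ∑ p ∈ S, ∑ p' ∈ S.erase p, w p' * D p p' ≤ 2 / g * Λ ^ 2 := by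
    have : ∑ p ∈ S, ∑ p' ∈ S.erase p, w p' * D p p' =
        ∑ p ∈ S, ∑ p' ∈ S.erase p, w p * D p p' := by
      rw [sum_comm' (t' := S) (s' := fun p => S.erase p)]
      · refine sum_congr rfl fun p _ => sum_congr rfl fun p' _ => ?_
        simp only [hD, abs_sub_comm]
      · intro p p'
        simp only [mem_erase]
        tauto
    rw [this]
    exact hnear
  have hfar : ∑ p ∈ S, ∑ p' ∈ S.erase p, w p * w p' ≤ Λ ^ 2 := by
    calc _ ≤ ∑ p ∈ S, ∑ p' ∈ S, w p * w p' := sum_le_sum fun p _ =>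
          sum_le_sum_of_subset_of_nonneg (erase_subset _ _) fun p' _ _ =>
            mul_nonneg (hw0 p) (hw0 p')
      _ = (∑ p ∈ S, w p) ^ 2 := by rw [sq, sum_mul_sum]
      _ ≤ _ := by
          have := sum_nonneg fun p (_ : p ∈ S) => hw0 p
          gcongr
  have hoff : ∑ p ∈ S, ∑ p' ∈ S.erase p, |uCoef l θ p.1 p.2 * uCoef l θ p'.1 p'.2| /
        |Real.sqrt (freq θ p) - Real.sqrt (freq θ p')| ≤
      ∑ p ∈ S, ∑ p' ∈ S.erase p, (3 / 2 * (1 / θ) * (w p * D p p') +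
        3 / 2 * (1 / θ) * (w p' * D p p') + 2 * (1 / θ) * (w p * w p')) := by
    refine sum_le_sum fun p hp => sum_le_sum fun p' hp' => ?_
    have hp'S := mem_of_mem_erase hp'
    have hne := (ne_of_mem_erase hp').symm
    have hpos := hg.trans_le (hgap p hp p' hp'S hne)
    have hnen : freq θ p ≠ freq θ p' := sub_ne_zero.1 (abs_pos.1 hpos)
    have h1 := mul_div_abs_sqrt_sub_le (hb0 p hp) (hb0 p' hp'S) (zero_lt_one.trans_le (hn1 p hp))
      (zero_lt_one.trans_le (hn1 p' hp'S)) hnen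
    calc _ ≤ b p * b p' / |Real.sqrt (freq θ p) - Real.sqrt (freq θ p')| := by
          rw [abs_mul]
          have := hb0 p hp
          gcongr
          · exact hub p hp
          · exact hub p' hp'S
      _ ≤ _ := h1
      _ ≤ 3 / 2 * (1 / θ * w p + 1 / θ * w p') / |freq θ p - freq θ p'| +
          2 * ((1 / Real.sqrt θ * w p) * (1 / Real.sqrt θ * w p')) := by
          have h2 := hw1 p hp
          have h3 := hw1 p' hp'S
          have h4 := hw2 p hp
          have h5 := hw2 p' hp'S
          have h6 : 0 ≤ b p' / Real.sqrt (Real.sqrt (freq θ p')) := by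
            have := hb0 p' hp'S
            positivity
          have := hw0 p
          gcongr
      _ = 3 / 2 * (1 / θ * w p + 1 / θ * w p') / |freq θ p - freq θ p'| +
          2 * (1 / (Real.sqrt θ * Real.sqrt θ) * w p * w p') := by
          field_simp
      _ = _ := by
          rw [Real.mul_self_sqrt hθ.le]
          simp only [hD]
          ring
  have hoff' : ∑ p ∈ S, ∑ p' ∈ S.erase p, |uCoef l θ p.1 p.2 * uCoef l θ p'.1 p'.2| /
        |Real.sqrt (freq θ p) - Real.sqrt (freq θ p')| ≤
      3 / 2 * (1 / θ) * (2 / g * Λ ^ 2) + 3 / 2 * (1 / θ) * (2 / g * Λ ^ 2) +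
        2 * (1 / θ) * Λ ^ 2 := by
    refine hoff.trans ?_
    simp only [sum_add_distrib, ← mul_sum]
    simp only [← mul_sum] at hnear hfar
    gcongr
  have hΛ2 : 1 / θ * Λ ≤ 1 / θ * Λ ^ 2 := by
    gcongr
    exact le_self_pow₀ hΛ1 (by norm_num)
  calc _ ≤ 1 / θ * Λ ^ 2 + (3 / 2 * (1 / θ) * (2 / g * Λ ^ 2) +
        3 / 2 * (1 / θ) * (2 / g * Λ ^ 2) + 2 * (1 / θ) * Λ ^ 2) := by linarith
    _ = _ := by ring

lemma one_add_log_le_rpow {η x : ℝ} (hη : 0 < η) (hx : 1 ≤ x) :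
    1 + Real.log x ≤ (1 + 1 / η) * x ^ η := by
  have h1 := Real.log_le_rpow_div (by linarith : 0 ≤ x) hη
  have h2 : 1 ≤ x ^ η := Real.one_le_rpow hx hη.le
  calc 1 + Real.log x ≤ x ^ η + x ^ η / η := by linarith
    _ = _ := by ring

lemma rpow_two_mul_sub_half (l : ℕ) {x : ℝ} (hx : 0 < x) :
    x ^ (2 * (l : ℝ) - 1 / 2) = x ^ (2 * l) / Real.sqrt x := by
  rw [Real.rpow_sub hx, ← Real.sqrt_eq_rpow]
  congr 1
  exact_mod_cast Real.rpow_natCast x (2 * l)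

/-- The mean square of the stationary phase main term. -/
lemma exists_abs_integral_mainSum_sq_sub_le (l : ℕ) {θ γ : ℝ} (hθ : 0 < θ)
    (htype : IsApproxType θ γ) {δ : ℝ} (hδ : 0 < δ) :
    ∃ C, 0 < C ∧ ∀ (T : ℝ) (N : ℕ), 0 < T → 1 ≤ N →
      |(∫ x in T..(2 * T), mainSum l θ N x ^ 2) -
        1 / 2 * (normConst l ^ 2 * ∑ p ∈ freqSet θ N, uCoef l θ p.1 p.2 ^ 2) *
          ∫ x in T..(2 * T), x ^ (2 * (l : ℝ) - 1 / 2)| ≤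
      C * (T ^ (2 * l) * (N : ℝ) ^ (2 * γ + δ)) := by
  obtain ⟨c, hc, hgap⟩ := exists_le_abs_freq_sub htype (show 0 < δ / 4 by positivity)
  have hκ : (1 : ℝ) ≤ ⌈θ⌉₊ := by exact_mod_cast Nat.ceil_pos.2 hθ
  have hlogκ := Real.log_nonneg hκ
  have hnc := normConst_pos l
  set K := (1 + Real.log ⌈θ⌉₊) * (1 + 1 / (δ / 8)) ^ 2 with hK
  have hK0 : 0 < K := by positivity
  refine ⟨4 * 2 ^ (2 * l) * (normConst l ^ 2 * ((3 + 6 / c) / θ * K ^ 2)), by positivity,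
    fun T N hT hN => ?_⟩
  have hN' : (1 : ℝ) ≤ N := by exact_mod_cast hN
  have hN0 : (0 : ℝ) < N := by linarith
  have hγ := htype.1
  set g := c * (N : ℝ) ^ (-(2 * (γ + δ / 4))) with hg
  have hg0 : 0 < g := by positivity
  have hsum := sum_freqSet_uCoef_le (l := l) hθ hN hg0 (hgap N hN)
  have hpos : ∀ x ∈ Set.uIcc T (2 * T), 0 < x := fun x hx => by
    rw [Set.uIcc_of_le (by linarith)] at hx
    exact hT.trans_le hx.1
  set S := freqSet θ N with hS
  have hms := abs_integral_sum_cos_sqrt_sq_sub_le (2 * l) hT S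
    (fun p => normConst l * uCoef l θ p.1 p.2)
    (fun p => 2 * Real.pi * Real.sqrt (freq θ p))
    (fun p hp => by
      have := Real.sqrt_pos.2 (zero_lt_one.trans_le (freq_pos hθ hp))
      positivity)
    (fun p hp p' hp' hne h => by
      have h1 : Real.sqrt (freq θ p) = Real.sqrt (freq θ p') :=
        mul_left_cancel₀ (by positivity : 2 * Real.pi ≠ 0) h
      rw [Real.sqrt_inj (by linarith [freq_pos hθ hp]) (by linarith [freq_pos hθ hp'])] at h1
      have h2 := hgap N hN p hp p' hp' hne
      rw [h1, sub_self, abs_zero] at h2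
      exact absurd h2 (not_le.2 hg0))
  have e1 : ∫ x in T..(2 * T), mainSum l θ N x ^ 2 = ∫ x in T..(2 * T),
      x ^ (2 * l) / Real.sqrt x * (∑ p ∈ S, normConst l * uCoef l θ p.1 p.2 *
        Real.cos (2 * Real.pi * Real.sqrt (freq θ p) * Real.sqrt x - Real.pi / 4)) ^ 2 := by
    refine intervalIntegral.integral_congr fun x hx => ?_
    have hx0 := hpos x hx
    rw [mainSum_eq l N hx0.le, mul_pow, ← rpow_two_mul_sub_half l hx0, ← Real.rpow_natCast,
      ← Real.rpow_mul hx0.le]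
    congr 2
    push_cast
    ring
  have e2 : ∫ x in T..(2 * T), x ^ (2 * (l : ℝ) - 1 / 2) =
      ∫ x in T..(2 * T), x ^ (2 * l) / Real.sqrt x :=
    intervalIntegral.integral_congr fun x hx => rpow_two_mul_sub_half l (hpos x hx)
  have e3 : ∑ p ∈ S, (normConst l * uCoef l θ p.1 p.2) ^ 2 =
      normConst l ^ 2 * ∑ p ∈ S, uCoef l θ p.1 p.2 ^ 2 := by
    rw [mul_sum]
    exact sum_congr rfl fun _ _ => mul_pow _ _ _
  rw [e1, e2, ← e3]
  refine hms.trans ?_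
  have e4 : ∀ p, (normConst l * uCoef l θ p.1 p.2) ^ 2 / (2 * Real.pi * Real.sqrt (freq θ p)) =
      normConst l ^ 2 / (2 * Real.pi) * (uCoef l θ p.1 p.2 ^ 2 / Real.sqrt (freq θ p)) := by
    intro p
    rw [mul_pow, mul_div_mul_comm]
  have e5 : ∀ p p' : ℕ × ℕ, |normConst l * uCoef l θ p.1 p.2 * (normConst l * uCoef l θ p'.1 p'.2)| /
      |2 * Real.pi * Real.sqrt (freq θ p) - 2 * Real.pi * Real.sqrt (freq θ p')| =
      normConst l ^ 2 / (2 * Real.pi) * (|uCoef l θ p.1 p.2 * uCoef l θ p'.1 p'.2| /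
        |Real.sqrt (freq θ p) - Real.sqrt (freq θ p')|) := by
    intro p p'
    have h1 : normConst l * uCoef l θ p.1 p.2 * (normConst l * uCoef l θ p'.1 p'.2) =
      normConst l ^ 2 * (uCoef l θ p.1 p.2 * uCoef l θ p'.1 p'.2) := by ring
    rw [h1, ← mul_sub, abs_mul, abs_mul (2 * Real.pi), abs_of_pos (by positivity : 0 < 2 * Real.pi),
      abs_of_pos (by positivity : 0 < normConst l ^ 2), mul_div_mul_comm]
  simp only [e4, e5, ← mul_sum, ← mul_add]
  have hpi : normConst l ^ 2 / (2 * Real.pi) ≤ normConst l ^ 2 :=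
    div_le_self (by positivity) (by linarith [Real.pi_gt_three])
  set Λ := (1 + Real.log N) * (1 + Real.log (freqCutoff θ N)) with hΛ
  have hlogN : 0 ≤ Real.log N := Real.log_natCast_nonneg N
  have hΛK : Λ ≤ K * (N : ℝ) ^ (δ / 4) := by
    have h1 : Real.log (freqCutoff θ N) = Real.log ⌈θ⌉₊ + Real.log N := by
      unfold freqCutoff
      push_cast
      exact Real.log_mul (by positivity) (by positivity)
    have h2 : 1 + Real.log (freqCutoff θ N) ≤ (1 + Real.log ⌈θ⌉₊) * (1 + Real.log N) := by
      rw [h1]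
      nlinarith [mul_nonneg hlogκ hlogN]
    have h3 := one_add_log_le_rpow (show 0 < δ / 8 by positivity) hN'
    calc Λ ≤ (1 + Real.log N) * ((1 + Real.log ⌈θ⌉₊) * (1 + Real.log N)) := by
          rw [hΛ]
          gcongr
      _ ≤ ((1 + 1 / (δ / 8)) * (N : ℝ) ^ (δ / 8)) * ((1 + Real.log ⌈θ⌉₊) *
          ((1 + 1 / (δ / 8)) * (N : ℝ) ^ (δ / 8))) := by gcongr
      _ = K * ((N : ℝ) ^ (δ / 8) * (N : ℝ) ^ (δ / 8)) := by
          rw [hK]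
          ring
      _ = _ := by
          rw [← Real.rpow_add hN0]
          ring_nf
  have hΛ0 : 0 ≤ Λ := by
    have := Real.log_natCast_nonneg (freqCutoff θ N)
    positivity
  have hg' : 1 + 6 / g + 2 ≤ (3 + 6 / c) * (N : ℝ) ^ (2 * (γ + δ / 4)) := by
    have h1 : 1 ≤ (N : ℝ) ^ (2 * (γ + δ / 4)) := Real.one_le_rpow hN' (by positivity)
    have h2 : 6 / g = 6 / c * (N : ℝ) ^ (2 * (γ + δ / 4)) := by
      rw [hg, Real.rpow_neg hN0.le]
      field_simp
    rw [h2]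
    linarith
  calc 4 * (2 * T) ^ (2 * l) * (normConst l ^ 2 / (2 * Real.pi) * _)
      ≤ 4 * (2 * T) ^ (2 * l) * (normConst l ^ 2 * ((1 + 6 / g + 2) / θ * Λ ^ 2)) := by
        gcongr
    _ ≤ 4 * (2 * T) ^ (2 * l) * (normConst l ^ 2 * ((3 + 6 / c) * (N : ℝ) ^ (2 * (γ + δ / 4)) / θ *
        (K * (N : ℝ) ^ (δ / 4)) ^ 2)) := by
        gcongr
    _ = 4 * 2 ^ (2 * l) * (normConst l ^ 2 * ((3 + 6 / c) / θ * K ^ 2)) *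
        (T ^ (2 * l) * ((N : ℝ) ^ (2 * (γ + δ / 4)) * ((N : ℝ) ^ (δ / 4)) ^ 2)) := by
        rw [mul_pow]
        ring
    _ = _ := by
        rw [← Real.rpow_natCast ((N : ℝ) ^ (δ / 4)), ← Real.rpow_mul hN0.le, ← Real.rpow_add hN0]
        congr 3
        push_cast
        ring

lemma uCoef_sq {l : ℕ} {θ : ℝ} (hθ : 0 < θ) {h r : ℕ} (hr : θ * h < r) :
    uCoef l θ h r ^ 2 = (1 - θ * h / (2 * (r : ℝ) - θ * h)) ^ (2 * l - 2) *
        (h : ℝ) ^ (-(1 : ℝ) / 2) * (2 * (r : ℝ) - θ * h) ^ (-(5 : ℝ) / 2) := by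
  have hr0 : 0 ≤ θ * h := by positivity
  have hs : 0 ≤ 2 * (r : ℝ) - θ * h := by linarith
  unfold uCoef
  have h1 : ((h : ℝ) ^ (-(1 : ℝ) / 4)) ^ 2 = (h : ℝ) ^ (-(1 : ℝ) / 2) := by
    rw [← Real.rpow_mul_natCast (by positivity)]
    norm_num
  have h2 : ((2 * (r : ℝ) - θ * h) ^ (-(5 : ℝ) / 4)) ^ 2 =
      (2 * (r : ℝ) - θ * h) ^ (-(5 : ℝ) / 2) := by
    rw [← Real.rpow_mul_natCast hs]
    norm_num
  have h3 : ((-1 : ℝ) ^ (l * h)) ^ 2 = 1 := by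
    rw [← pow_mul, mul_comm, pow_mul]
    norm_num
  rw [mul_pow, mul_pow, mul_pow, h1, h2, h3, ← pow_mul, show (l - 1) * 2 = 2 * l - 2 by omega]
  ring

lemma uCoef_sq_le (l : ℕ) {θ : ℝ} (hθ : 0 < θ) {h r : ℕ} (hh : 1 ≤ h) (hr : θ * h < r) :
    uCoef l θ h r ^ 2 ≤ θ ^ (-(3 : ℝ) / 4) * (r : ℝ) ^ (-(1 : ℝ) / 2) *
      ((h : ℝ) ^ (-(5 : ℝ) / 4) * (r : ℝ) ^ (-(5 : ℝ) / 4)) := by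
  have hh' : (0 : ℝ) < h := by exact_mod_cast hh
  have hr0 : 0 < θ * h := by positivity
  have hr' : (0 : ℝ) < r := by linarith
  have hs : (r : ℝ) ≤ 2 * (r : ℝ) - θ * h := by linarith
  have h1 := abs_uCoef_le l hθ hr
  calc uCoef l θ h r ^ 2 ≤ ((h : ℝ) ^ (-(1 : ℝ) / 4) * (2 * (r : ℝ) - θ * h) ^ (-(5 : ℝ) / 4)) ^ 2 :=
        sq_le_sq' (by linarith [neg_abs_le (uCoef l θ h r)]) ((le_abs_self _).trans h1)
    _ ≤ ((h : ℝ) ^ (-(1 : ℝ) / 4) * (r : ℝ) ^ (-(5 : ℝ) / 4)) ^ 2 := by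
        have := Real.rpow_le_rpow_of_nonpos hr' hs (by norm_num : -(5 : ℝ) / 4 ≤ 0)
        have := hr'.trans_le hs
        gcongr
    _ = (h : ℝ) ^ (-(1 : ℝ) / 2) * ((r : ℝ) ^ (-(3 : ℝ) / 4) * ((r : ℝ) ^ (-(1 : ℝ) / 2) *
        (r : ℝ) ^ (-(5 : ℝ) / 4))) := by
        rw [mul_pow, ← Real.rpow_mul_natCast hh'.le, ← Real.rpow_mul_natCast hr'.le,
          ← Real.rpow_add hr', ← Real.rpow_add hr']
        norm_num
    _ ≤ (h : ℝ) ^ (-(1 : ℝ) / 2) * ((θ * h) ^ (-(3 : ℝ) / 4) * ((r : ℝ) ^ (-(1 : ℝ) / 2) *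
        (r : ℝ) ^ (-(5 : ℝ) / 4))) := by
        have := Real.rpow_le_rpow_of_nonpos hr0 hr.le (by norm_num : -(3 : ℝ) / 4 ≤ 0)
        gcongr
    _ = θ ^ (-(3 : ℝ) / 4) * (r : ℝ) ^ (-(1 : ℝ) / 2) *
        (((h : ℝ) ^ (-(1 : ℝ) / 2) * (h : ℝ) ^ (-(3 : ℝ) / 4)) * (r : ℝ) ^ (-(5 : ℝ) / 4)) := by
        rw [Real.mul_rpow hθ.le hh'.le]
        ring
    _ = _ := by
        rw [← Real.rpow_add hh']
        norm_num

open Classical in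
lemma exists_Cconst_bounds (l : ℕ) {θ : ℝ} (hθ : 0 < θ) :
    ∃ C, 0 < C ∧ ∀ N : ℕ, 1 ≤ N →
      ∑ p ∈ freqSet θ N, uCoef l θ p.1 p.2 ^ 2 ≤ Cconst l θ ∧
      Cconst l θ ≤ ∑ p ∈ freqSet θ N, uCoef l θ p.1 p.2 ^ 2 + C * (N : ℝ) ^ (-(1 : ℝ) / 2) := by
  set F : ℕ × ℕ → ℝ := fun p => if 1 ≤ p.1 ∧ 1 ≤ p.2 ∧ θ * p.1 < (p.2 : ℝ) then
      (1 - θ * p.1 / (2 * (p.2 : ℝ) - θ * p.1)) ^ (2 * l - 2) *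
        (p.1 : ℝ) ^ (-(1 : ℝ) / 2) * (2 * (p.2 : ℝ) - θ * p.1) ^ (-(5 : ℝ) / 2)
    else 0 with hF
  set w : ℕ × ℕ → ℝ := fun p => (p.1 : ℝ) ^ (-(5 : ℝ) / 4) * (p.2 : ℝ) ^ (-(5 : ℝ) / 4) with hw
  have hFu : ∀ p : ℕ × ℕ, 1 ≤ p.1 → 1 ≤ p.2 → θ * p.1 < (p.2 : ℝ) → F p = uCoef l θ p.1 p.2 ^ 2 :=
    fun p h1 h2 h3 => by rw [uCoef_sq hθ h3, hF]; exact if_pos ⟨h1, h2, h3⟩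
  have hF0 : ∀ p, 0 ≤ F p := fun p => by
    by_cases hp : 1 ≤ p.1 ∧ 1 ≤ p.2 ∧ θ * p.1 < (p.2 : ℝ)
    · rw [hFu p hp.1 hp.2.1 hp.2.2]
      positivity
    · simp only [hF, if_neg hp, le_refl]
  have hw0 : ∀ p, 0 ≤ w p := fun p => by positivity
  have hws : Summable w := by
    have h1 : Summable fun n : ℕ => (n : ℝ) ^ (-(5 : ℝ) / 4) :=
      Real.summable_nat_rpow.2 (by norm_num)
    exact h1.mul_of_nonneg h1 (fun _ => by positivity) fun _ => by positivity
  set c : ℝ := θ ^ (-(3 : ℝ) / 4) with hc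
  have hc0 : 0 < c := by positivity
  have hFs : Summable F := by
    refine Summable.of_nonneg_of_le hF0 (fun p => ?_) (hws.mul_left c)
    by_cases hp : 1 ≤ p.1 ∧ 1 ≤ p.2 ∧ θ * p.1 < (p.2 : ℝ)
    · rw [hFu p hp.1 hp.2.1 hp.2.2]
      refine (uCoef_sq_le l hθ hp.1 hp.2.2).trans ?_
      have h1 : (p.2 : ℝ) ^ (-(1 : ℝ) / 2) ≤ 1 :=
        Real.rpow_le_one_of_one_le_of_nonpos (by exact_mod_cast hp.2.1) (by norm_num)
      exact mul_le_mul_of_nonneg_right (mul_le_of_le_one_right hc0.le h1) (hw0 p)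
    · simp only [hF, if_neg hp]
      exact mul_nonneg hc0.le (hw0 p)
  have hC : Cconst l θ = ∑' p, F p := rfl
  set m : ℝ := min θ 1 with hm
  have hm0 : 0 < m := lt_min hθ one_pos
  refine ⟨c * m ^ (-(1 : ℝ) / 2) * (∑' p, w p + 1), ?_, fun N hN => ?_⟩
  · have : 0 ≤ ∑' p, w p := tsum_nonneg hw0
    positivity
  have hN' : (0 : ℝ) < N := by exact_mod_cast hN
  have hSF : ∑ p ∈ freqSet θ N, uCoef l θ p.1 p.2 ^ 2 = ∑ p ∈ freqSet θ N, F p := by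
    refine sum_congr rfl fun p hp => ?_
    obtain ⟨h1, h2, h3, -⟩ := freqSet_bounds hθ hp
    exact (hFu p (by exact_mod_cast h1) (by exact_mod_cast h2) h3).symm
  rw [hSF, hC]
  refine ⟨hFs.sum_le_tsum _ fun p _ => hF0 p, ?_⟩
  set K := c * (m * N) ^ (-(1 : ℝ) / 2) with hK
  have hK0 : 0 ≤ K := by positivity
  have hpt : ∀ p, F p ≤ (if p ∈ freqSet θ N then F p else 0) + K * w p := by
    intro p
    have hKw : 0 ≤ K * w p := mul_nonneg hK0 (hw0 p)
    by_cases hpS : p ∈ freqSet θ N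
    · rw [if_pos hpS]
      linarith
    rw [if_neg hpS, zero_add]
    by_cases hp : 1 ≤ p.1 ∧ 1 ≤ p.2 ∧ θ * p.1 < (p.2 : ℝ)
    · rw [hFu p hp.1 hp.2.1 hp.2.2]
      refine (uCoef_sq_le l hθ hp.1 hp.2.2).trans ?_
      have h1 : m * N ≤ p.2 := by
        rw [mem_freqSet] at hpS
        by_cases hhN : p.1 ≤ N
        · have h2 : freqCutoff θ N < p.2 := by
            by_contra h3
            exact hpS ⟨⟨hp.1, hhN⟩, (Nat.floor_lt (by positivity)).2 hp.2.2, not_lt.1 h3⟩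
          have h4 : N ≤ freqCutoff θ N := Nat.le_mul_of_pos_left N (Nat.ceil_pos.2 hθ)
          have h5 : (N : ℝ) ≤ p.2 := by exact_mod_cast h4.trans h2.le
          exact (mul_le_of_le_one_left hN'.le (min_le_right _ _)).trans h5
        · have h2 : (N : ℝ) ≤ p.1 := by exact_mod_cast (not_le.1 hhN).le
          calc m * N ≤ θ * p.1 := by
                gcongr
                exact min_le_left _ _
            _ ≤ _ := hp.2.2.le
      have h2 := Real.rpow_le_rpow_of_nonpos (by positivity : 0 < m * N) h1
        (by norm_num : -(1 : ℝ) / 2 ≤ 0)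
      exact mul_le_mul_of_nonneg_right (mul_le_mul_of_nonneg_left h2 hc0.le) (hw0 p)
    · simpa only [hF, if_neg hp] using hKw
  have hsm : Summable fun p => if p ∈ freqSet θ N then F p else 0 :=
    summable_of_ne_finset_zero (s := freqSet θ N) fun p hp => if_neg hp
  calc ∑' p, F p ≤ ∑' p, ((if p ∈ freqSet θ N then F p else 0) + K * w p) :=
        hFs.tsum_le_tsum hpt (hsm.add (hws.mul_left K))
    _ = ∑ p ∈ freqSet θ N, F p + K * ∑' p, w p := by
        rw [hsm.tsum_add (hws.mul_left K), tsum_mul_left, tsum_eq_sum (s := freqSet θ N)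
          fun p hp => if_neg hp]
        congr 1
        exact sum_congr rfl fun p hp => if_pos hp
    _ ≤ ∑ p ∈ freqSet θ N, F p + K * (∑' p, w p + 1) := by
        gcongr
        linarith
    _ = _ := by
        rw [hK, Real.mul_rpow hm0.le hN'.le]
        ring

lemma integral_indicator_Ici {T U : ℝ} (hTU : T ≤ U) (b : ℝ) (f : ℝ → ℝ) :
    ∫ x in T..U, (Set.Ici b).indicator f x = if b ≤ U then ∫ x in (max T b)..U, f x else 0 := by
  rw [intervalIntegral.integral_of_le hTU, MeasureTheory.setIntegral_indicator measurableSet_Ici]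
  split_ifs with hb
  · rw [intervalIntegral.integral_of_le (max_le hTU hb)]
    rcases le_total b T with h | h
    · rw [max_eq_left h]
      congr 2
      exact Set.inter_eq_left.2 fun x hx => h.trans hx.1.le
    · rw [max_eq_right h, ← MeasureTheory.integral_Icc_eq_integral_Ioc]
      rcases h.eq_or_lt with rfl | h'
      · rw [MeasureTheory.integral_Icc_eq_integral_Ioc]
        congr 2
        exact Set.inter_eq_left.2 fun x hx => hx.1.le
      · congr 2
        ext x
        simp only [Set.mem_inter_iff, Set.mem_Ioc, Set.mem_Ici, Set.mem_Icc]
        constructor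
        · rintro ⟨⟨_, h2⟩, h3⟩
          exact ⟨h3, h2⟩
        · rintro ⟨h1, h2⟩
          exact ⟨⟨h'.trans_le h1, h2⟩, h1⟩
  · have : Set.Ioc T U ∩ Set.Ici b = ∅ := by
      ext x
      simp only [Set.mem_inter_iff, Set.mem_Ioc, Set.mem_Ici, Set.mem_empty_iff_false, iff_false]
      rintro ⟨⟨_, h2⟩, h3⟩
      exact hb (h3.trans h2)
    rw [this, MeasureTheory.setIntegral_empty]

lemma abs_integral_pow_mul_pow_mul_cos_le (n : ℕ) {u v b U ω : ℝ} (hu : u ≤ b) (hv : v ≤ b)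
    (hbU : b ≤ U) (hω : ω ≠ 0) (β : ℝ) :
    |∫ x in b..U, (x - u) ^ n * (x - v) ^ n * Real.cos (ω * x + β)| ≤
      2 * ((U - u) ^ n * (U - v) ^ n) / |ω| := by
  have h := abs_integral_mul_deriv_mul_cos_le hbU
    (φ := fun x => ω * x + β) (φ' := fun _ => ω)
    (G := fun x => (x - u) ^ n * (x - v) ^ n)
    (G' := fun x => n * (x - u) ^ (n - 1) * (x - v) ^ n + (x - u) ^ n * (n * (x - v) ^ (n - 1)))
    (fun x _ => by simpa using ((hasDerivAt_id x).const_mul ω).add_const β)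
    (fun x _ => by
      have h1 := ((hasDerivAt_id x).sub_const u).pow n
      have h2 := ((hasDerivAt_id x).sub_const v).pow n
      refine (h1.mul h2).congr_deriv ?_
      simp)
    continuousOn_const (by fun_prop)
    (by
      have := sub_nonneg.2 hu
      have := sub_nonneg.2 hv
      positivity)
    (fun x hx => by
      have := sub_nonneg.2 (hu.trans hx.1)
      have := sub_nonneg.2 (hv.trans hx.1)
      positivity)
  have e : ∫ x in b..U, (x - u) ^ n * (x - v) ^ n * (ω * Real.cos (ω * x + β)) =
      ω * ∫ x in b..U, (x - u) ^ n * (x - v) ^ n * Real.cos (ω * x + β) := by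
    rw [← intervalIntegral.integral_const_mul]
    congr 1
    ext x
    ring
  rw [e, abs_mul] at h
  rw [le_div_iff₀ (abs_pos.2 hω)]
  linarith

lemma continuous_oscTerm (l : ℕ) (θ : ℝ) (h m : ℕ) : Continuous (oscTerm l θ h m) := by
  unfold oscTerm
  fun_prop

lemma abs_integral_oscTerm_mul_le (l : ℕ) {θ : ℝ} (hθ : 0 < θ) {h m h' m' : ℕ} (hh : 1 ≤ h)
    (hm : 1 ≤ m) (hh' : 1 ≤ h') (hm' : 1 ≤ m') {b U : ℝ} (hb : θ * m ^ 2 ≤ b)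
    (hb' : θ * m' ^ 2 ≤ b) (hbU : b ≤ U) :
    |∫ x in b..U, oscTerm l θ h m x * oscTerm l θ h' m' x| ≤
      m * m' * U ^ (2 * (l - 1)) *
        if (h : ℚ) / m = (h' : ℚ) / m' then U - b else 1 / |(h : ℝ) / m - h' / m'| := by
  have hm0 : (0 : ℝ) < m := by exact_mod_cast hm
  have hm0' : (0 : ℝ) < m' := by exact_mod_cast hm'
  have hh0 : (0 : ℝ) < h := by exact_mod_cast hh
  have hh0' : (0 : ℝ) < h' := by exact_mod_cast hh'
  set n := l - 1 with hn
  set u := θ * (m : ℝ) ^ 2 with hu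
  set v := θ * (m' : ℝ) ^ 2 with hv
  have hu0 : 0 < u := by positivity
  have hv0 : 0 < v := by positivity
  have hG : ∀ x, b ≤ x → x ≤ U → 0 ≤ (x - u) ^ n * (x - v) ^ n ∧
      (x - u) ^ n * (x - v) ^ n ≤ U ^ (2 * n) := by
    intro x hx hxU
    have h1 : 0 ≤ x - u := by linarith
    have h2 : 0 ≤ x - v := by linarith
    have hU0 : 0 ≤ U := by linarith
    refine ⟨by positivity, ?_⟩
    calc (x - u) ^ n * (x - v) ^ n ≤ U ^ n * U ^ n := by
          gcongr <;> linarith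
      _ = _ := by rw [← pow_add, two_mul]
  split_ifs with hq
  · have hbd : ∀ x ∈ Set.uIoc b U, ‖oscTerm l θ h m x * oscTerm l θ h' m' x‖ ≤
        m * m' * U ^ (2 * n) := by
      intro x hx
      rw [Set.uIoc_of_le hbU] at hx
      obtain ⟨h1, h2⟩ := hG x hx.1.le hx.2
      have e : oscTerm l θ h m x * oscTerm l θ h' m' x = m * m' * ((x - u) ^ n * (x - v) ^ n) *
          (Real.sin (2 * Real.pi * h * (x / (2 * m) - θ * m / 2)) *
            Real.sin (2 * Real.pi * h' * (x / (2 * m') - θ * m' / 2))) := by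
        unfold oscTerm
        ring
      rw [Real.norm_eq_abs, e, abs_mul, abs_of_nonneg (by positivity), abs_mul]
      calc _ ≤ m * m' * ((x - u) ^ n * (x - v) ^ n) * (1 * 1) := by
            gcongr
            · exact Real.abs_sin_le_one _
            · exact Real.abs_sin_le_one _
        _ ≤ _ := by
            rw [mul_one, mul_one]
            gcongr
    have := intervalIntegral.norm_integral_le_of_norm_le_const hbd
    rwa [Real.norm_eq_abs, abs_of_nonneg (sub_nonneg.2 hbU)] at this
  · set q := (h : ℝ) / m with hqd
    set q' := (h' : ℝ) / m' with hqd'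
    have hq0 : 0 < q := by positivity
    have hq0' : 0 < q' := by positivity
    have hne : q - q' ≠ 0 := by
      rw [sub_ne_zero]
      intro h1
      refine hq ?_
      have h2 : (((h : ℚ) / m : ℚ) : ℝ) = (((h' : ℚ) / m' : ℚ) : ℝ) := by
        push_cast
        exact h1
      exact_mod_cast h2
    set β := -(Real.pi * h * θ * m) with hβ
    set β' := -(Real.pi * h' * θ * m') with hβ'
    have e : ∀ x, oscTerm l θ h m x * oscTerm l θ h' m' x = m * m' / 2 *
        ((x - u) ^ n * (x - v) ^ n * Real.cos (Real.pi * (q - q') * x + (β - β')) -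
          (x - u) ^ n * (x - v) ^ n * Real.cos (Real.pi * (q + q') * x + (β + β'))) := by
      intro x
      have h1 : 2 * Real.pi * h * (x / (2 * m) - θ * m / 2) = Real.pi * q * x + β := by
        rw [hqd, hβ]
        field_simp
        ring
      have h2 : 2 * Real.pi * h' * (x / (2 * m') - θ * m' / 2) = Real.pi * q' * x + β' := by
        rw [hqd', hβ']
        field_simp
        ring
      have h3 : Real.pi * (q - q') * x + (β - β') =
        (Real.pi * q * x + β) - (Real.pi * q' * x + β') := by ring
      have h4 : Real.pi * (q + q') * x + (β + β') =
        (Real.pi * q * x + β) + (Real.pi * q' * x + β') := by ring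
      unfold oscTerm
      rw [h1, h2, h3, h4, Real.cos_add (Real.pi * q * x + β), Real.cos_sub (Real.pi * q * x + β)]
      ring
    simp_rw [e]
    rw [intervalIntegral.integral_const_mul, intervalIntegral.integral_sub
      (Continuous.intervalIntegrable (by fun_prop) _ _)
      (Continuous.intervalIntegrable (by fun_prop) _ _), abs_mul, abs_of_pos (by positivity)]
    have hpi := Real.pi_pos
    have h1 := abs_integral_pow_mul_pow_mul_cos_le n hb hb' hbU
      (mul_ne_zero hpi.ne' hne) (β - β')
    have h2 := abs_integral_pow_mul_pow_mul_cos_le n hb hb' hbU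
      (mul_ne_zero hpi.ne' (add_pos hq0 hq0').ne') (β + β')
    have hle : |q - q'| ≤ |q + q'| := by
      rw [abs_of_pos (add_pos hq0 hq0'), abs_le]
      constructor <;> linarith
    have hU := hG U hbU le_rfl
    have hqpos := abs_pos.2 hne
    have hcommon : ∀ y, |q - q'| ≤ |y| →
        2 * ((U - u) ^ n * (U - v) ^ n) / |Real.pi * y| ≤ U ^ (2 * n) * (1 / |q - q'|) := by
      intro y hy
      rw [abs_mul, abs_of_pos hpi]
      calc 2 * ((U - u) ^ n * (U - v) ^ n) / (Real.pi * |y|)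
          ≤ 2 * U ^ (2 * n) / (2 * |q - q'|) := by
            have := hU.2
            have := hU.1.trans hU.2
            have := Real.two_le_pi
            gcongr
        _ = _ := by field_simp
    calc _ ≤ (m : ℝ) * m' / 2 * (U ^ (2 * n) * (1 / |q - q'|) + U ^ (2 * n) * (1 / |q - q'|)) := by
          gcongr
          refine (abs_sub _ _).trans (add_le_add (h1.trans (hcommon _ le_rfl))
            (h2.trans (hcommon _ hle)))
      _ = _ := by ring

/-- The summand `(h, m)` of `R1` is not in `headSum` once `x` exceeds `tailStart θ N h * m ^ 2`. -/
noncomputable def tailStart (θ : ℝ) (N h : ℕ) : ℝ :=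
  if h ≤ N then freqBound θ h (freqCutoff θ N) / h else θ

lemma mul_le_freqBound {θ : ℝ} (hθ : 0 < θ) {N h : ℕ} (hN : h ≤ N) :
    θ * N ≤ freqBound θ h (freqCutoff θ N) := by
  have h1 : θ * N ≤ (freqCutoff θ N : ℝ) := by
    unfold freqCutoff
    push_cast
    have := Nat.le_ceil θ
    gcongr
  have h2 : (h : ℝ) ≤ N := by exact_mod_cast hN
  have h3 : θ * h ≤ θ * N := by gcongr
  unfold freqBound
  split_ifs with hr
  · exact h1.trans ((Nat.le_floor_iff (by positivity)).1 hr)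
  · linarith

lemma le_tailStart {θ : ℝ} (hθ : 0 < θ) (N : ℕ) {h : ℕ} (hh : 1 ≤ h) : θ ≤ tailStart θ N h := by
  unfold tailStart
  split_ifs with hN
  · have h1 : (h : ℝ) ≤ N := by exact_mod_cast hN
    rw [le_div_iff₀ (by exact_mod_cast hh)]
    exact (by gcongr : θ * h ≤ θ * N).trans (mul_le_freqBound hθ hN)
  · exact le_rfl

lemma sq_mul_pow_six_le {θ : ℝ} (hθ : 0 < θ) {N h m : ℕ} (hN : 1 ≤ N) (hh : 1 ≤ h) {U : ℝ}
    (hU : tailStart θ N h * m ^ 2 ≤ U) :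
    (N : ℝ) ^ 2 * (m : ℝ) ^ 6 ≤ U ^ 3 / θ ^ 3 * (h : ℝ) ^ 2 := by
  have hh0 : (0 : ℝ) < h := by exact_mod_cast hh
  have hN0 : (0 : ℝ) < N := by exact_mod_cast hN
  unfold tailStart at hU
  split_ifs at hU with hle
  · have hle' : (h : ℝ) ≤ N := by exact_mod_cast hle
    have h1 : θ * N * m ^ 2 ≤ U * h := by
      calc θ * N * m ^ 2 ≤ freqBound θ h (freqCutoff θ N) * m ^ 2 := by
            gcongr
            exact mul_le_freqBound hθ hle
        _ = freqBound θ h (freqCutoff θ N) / h * m ^ 2 * h := by field_simp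
        _ ≤ U * h := by gcongr
    have h2 : (θ * N * m ^ 2) ^ 3 ≤ (U * h) ^ 3 := by gcongr
    have hU0 : 0 ≤ U := by
      by_contra hneg
      have : U * h < 0 := mul_neg_of_neg_of_pos (not_le.1 hneg) hh0
      have : 0 ≤ θ * N * m ^ 2 := by positivity
      linarith
    rw [div_mul_eq_mul_div, le_div_iff₀ (by positivity)]
    refine le_of_mul_le_mul_right ?_ hN0
    calc (N : ℝ) ^ 2 * (m : ℝ) ^ 6 * θ ^ 3 * N = (θ * N * m ^ 2) ^ 3 := by ring
      _ ≤ (U * h) ^ 3 := h2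
      _ = U ^ 3 * (h : ℝ) ^ 2 * h := by ring
      _ ≤ _ := by gcongr
  · have hle' : (N : ℝ) ≤ h := by exact_mod_cast (not_le.1 hle).le
    have h2 : (θ * m ^ 2) ^ 3 ≤ U ^ 3 := by gcongr
    rw [div_mul_eq_mul_div, le_div_iff₀ (by positivity)]
    calc (N : ℝ) ^ 2 * (m : ℝ) ^ 6 * θ ^ 3 = (θ * m ^ 2) ^ 3 * (N : ℝ) ^ 2 := by ring
      _ ≤ U ^ 3 * (h : ℝ) ^ 2 := by
        have : 0 ≤ U ^ 3 := le_trans (by positivity) h2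
        gcongr

/-- The part of `R1` complementary to `headSum`. -/
noncomputable def tailSum (l : ℕ) (θ : ℝ) (N : ℕ) (P : Finset (ℕ × ℕ)) (x : ℝ) : ℝ :=
  normConst l * ∑ p ∈ P, ((-1 : ℝ) ^ (l * p.1) / p.1) *
    (Set.Ici (tailStart θ N p.1 * p.2 ^ 2)).indicator (oscTerm l θ p.1 p.2) x

lemma sum_indicator_Ici_mul_sq (f : ℕ → ℝ → ℝ) {c x : ℝ} (hc : 0 < c) (hx : 0 ≤ x) {M : ℕ}
    (hM : ⌊Real.sqrt (x / c)⌋₊ ≤ M) :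
    ∑ m ∈ Icc 1 M, (Set.Ici (c * (m : ℝ) ^ 2)).indicator (f m) x =
      ∑ m ∈ Icc 1 ⌊Real.sqrt (x / c)⌋₊, f m x := by
  have key : ∀ m : ℕ, c * (m : ℝ) ^ 2 ≤ x ↔ m ≤ ⌊Real.sqrt (x / c)⌋₊ := by
    intro m
    rw [Nat.le_floor_iff (Real.sqrt_nonneg _), Real.le_sqrt (by positivity) (by positivity),
      le_div_iff₀ hc, mul_comm]
  simp only [Set.indicator_apply, Set.mem_Ici, key]
  rw [← sum_filter]
  refine sum_congr ?_ fun _ _ => rfl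
  ext m
  simp only [mem_filter, mem_Icc]
  omega

lemma R1_eq_headSum_add_tailSum (l : ℕ) {θ : ℝ} (hθ : 0 < θ) {x U H : ℝ} (hx : 0 < x)
    (hxU : x ≤ U) {N : ℕ} (hN : N ≤ ⌊H⌋₊) :
    R1 l θ x H = headSum l θ N x +
      tailSum l θ N (Icc 1 ⌊H⌋₊ ×ˢ Icc 1 ⌊Real.sqrt (U / θ)⌋₊) x := by
  unfold R1 headSum tailSum
  rw [sum_product, ← mul_add]
  change normConst l * _ = _
  congr 1
  have e1 : ∑ h ∈ Icc 1 N, ((-1 : ℝ) ^ (l * h) / h) *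
      ∑ m ∈ Ioc ⌊Real.sqrt (h * x / freqBound θ h (freqCutoff θ N))⌋₊ ⌊Real.sqrt (x / θ)⌋₊,
        oscTerm l θ h m x = ∑ h ∈ Icc 1 ⌊H⌋₊, ((-1 : ℝ) ^ (l * h) / h) *
      ∑ m ∈ Ioc ⌊Real.sqrt (x / tailStart θ N h)⌋₊ ⌊Real.sqrt (x / θ)⌋₊, oscTerm l θ h m x := by
    have h1 : ∀ h ∈ Icc 1 N, ((-1 : ℝ) ^ (l * h) / h) *
        ∑ m ∈ Ioc ⌊Real.sqrt (h * x / freqBound θ h (freqCutoff θ N))⌋₊ ⌊Real.sqrt (x / θ)⌋₊,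
          oscTerm l θ h m x = ((-1 : ℝ) ^ (l * h) / h) *
        ∑ m ∈ Ioc ⌊Real.sqrt (x / tailStart θ N h)⌋₊ ⌊Real.sqrt (x / θ)⌋₊, oscTerm l θ h m x := by
      intro h hh
      rw [tailStart, if_pos (mem_Icc.1 hh).2, div_div_eq_mul_div, mul_comm x]
    rw [sum_congr rfl h1]
    refine sum_subset (Icc_subset_Icc_right hN) fun h hh hh' => ?_
    have : ¬ h ≤ N := fun h2 => hh' (mem_Icc.2 ⟨(mem_Icc.1 hh).1, h2⟩)
    rw [tailStart, if_neg this, Ioc_self, sum_empty, mul_zero]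
  rw [e1, ← sum_add_distrib]
  refine sum_congr rfl fun h hh => ?_
  have hh1 := (mem_Icc.1 hh).1
  have hc := le_tailStart hθ N hh1
  have hk : ⌊Real.sqrt (x / tailStart θ N h)⌋₊ ≤ ⌊Real.sqrt (x / θ)⌋₊ := by
    gcongr
  have hM : ⌊Real.sqrt (x / θ)⌋₊ ≤ ⌊Real.sqrt (U / θ)⌋₊ := by
    gcongr
  dsimp only
  rw [← mul_sum, sum_indicator_Ici_mul_sq (fun m => oscTerm l θ h m) (hθ.trans_le hc) hx.le
    (hk.trans hM), ← mul_add]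
  congr 1
  change ∑ m ∈ Icc 1 ⌊Real.sqrt (x / θ)⌋₊, oscTerm l θ h m x = _
  rw [add_comm, ← sum_union]
  · refine sum_congr ?_ fun _ _ => rfl
    ext m
    simp only [mem_union, mem_Icc, mem_Ioc]
    omega
  · rw [disjoint_left]
    intro m h1 h2
    simp only [mem_Icc, mem_Ioc] at h1 h2
    omega

/-- The kernel bounding the correlation of two summands of `tailSum`. -/
noncomputable def corrKernel (T : ℝ) (q q' : ℚ) : ℝ :=
  if q = q' then T else 1 / |(q : ℝ) - q'|

lemma abs_integral_indicator_mul_le (l : ℕ) {θ T : ℝ} (hθ : 0 < θ) (hT : 0 < T) (N : ℕ)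
    {p p' : ℕ × ℕ} (hp : 1 ≤ p.1 ∧ 1 ≤ p.2) (hp' : 1 ≤ p'.1 ∧ 1 ≤ p'.2) :
    |∫ x in T..(2 * T), (Set.Ici (tailStart θ N p.1 * p.2 ^ 2)).indicator (oscTerm l θ p.1 p.2) x *
      (Set.Ici (tailStart θ N p'.1 * p'.2 ^ 2)).indicator (oscTerm l θ p'.1 p'.2) x| ≤
    if tailStart θ N p.1 * p.2 ^ 2 ≤ 2 * T ∧ tailStart θ N p'.1 * p'.2 ^ 2 ≤ 2 * T then
      p.2 * p'.2 * (2 * T) ^ (2 * (l - 1)) *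
        corrKernel T ((p.1 : ℚ) / p.2) ((p'.1 : ℚ) / p'.2) else 0 := by
  set L := tailStart θ N p.1 * (p.2 : ℝ) ^ 2 with hL
  set L' := tailStart θ N p'.1 * (p'.2 : ℝ) ^ 2 with hL'
  have e : ∀ x, (Set.Ici L).indicator (oscTerm l θ p.1 p.2) x *
      (Set.Ici L').indicator (oscTerm l θ p'.1 p'.2) x = (Set.Ici (max L L')).indicator
        (fun x => oscTerm l θ p.1 p.2 x * oscTerm l θ p'.1 p'.2 x) x := by
    intro x
    rw [← Set.Ici_inter_Ici, ← Set.inter_indicator_mul]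
  simp_rw [e]
  rw [integral_indicator_Ici (by linarith)]
  simp only [max_le_iff]
  split_ifs with hcond
  · have h1 : θ * (p.2 : ℝ) ^ 2 ≤ L := by
      rw [hL]
      gcongr
      exact le_tailStart hθ N hp.1
    have h2 : θ * (p'.2 : ℝ) ^ 2 ≤ L' := by
      rw [hL']
      gcongr
      exact le_tailStart hθ N hp'.1
    have h3 := le_max_left L L'
    have h4 := le_max_right L L'
    have h5 := le_max_right T (max L L')
    have h6 : max T (max L L') ≤ 2 * T := max_le (by linarith) (max_le hcond.1 hcond.2)
    refine (abs_integral_oscTerm_mul_le l hθ hp.1 hp.2 hp'.1 hp'.2 (h1.trans (h3.trans h5))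
      (h2.trans (h4.trans h5)) h6).trans ?_
    refine mul_le_mul_of_nonneg_left ?_ (by positivity)
    unfold corrKernel
    split_ifs with hq
    · have := le_max_left T (max L L')
      linarith
    · push_cast
      exact le_rfl
  · simp

lemma intervalIntegrable_indicator_Ici {f : ℝ → ℝ} (hf : Continuous f) (b T U : ℝ) :
    IntervalIntegrable ((Set.Ici b).indicator f) MeasureTheory.volume T U :=
  ⟨(hf.intervalIntegrable T U).1.indicator measurableSet_Ici,
    (hf.intervalIntegrable T U).2.indicator measurableSet_Ici⟩

lemma intervalIntegrable_indicator_Ici_mul {f g : ℝ → ℝ} (hf : Continuous f) (hg : Continuous g)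
    (b c T U : ℝ) : IntervalIntegrable
      (fun x => (Set.Ici b).indicator f x * (Set.Ici c).indicator g x)
      MeasureTheory.volume T U := by
  refine (intervalIntegrable_indicator_Ici (hf.mul hg) (max b c) T U).congr fun x _ => ?_
  rw [← Set.Ici_inter_Ici]
  exact Set.inter_indicator_mul _ _ x

lemma tailSum_sq (l : ℕ) (θ : ℝ) (N : ℕ) (P : Finset (ℕ × ℕ)) (x : ℝ) :
    tailSum l θ N P x ^ 2 = normConst l ^ 2 * ∑ p ∈ P, ∑ p' ∈ P,
      (((-1 : ℝ) ^ (l * p.1) / p.1) * ((-1 : ℝ) ^ (l * p'.1) / p'.1)) *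
        ((Set.Ici (tailStart θ N p.1 * p.2 ^ 2)).indicator (oscTerm l θ p.1 p.2) x *
          (Set.Ici (tailStart θ N p'.1 * p'.2 ^ 2)).indicator (oscTerm l θ p'.1 p'.2) x) := by
  unfold tailSum
  rw [mul_pow, sq (∑ p ∈ P, _), sum_mul_sum]
  congr 1
  refine sum_congr rfl fun p _ => sum_congr rfl fun p' _ => ?_
  ring

lemma intervalIntegrable_tailSum_sq (l : ℕ) (θ : ℝ) (N : ℕ) (P : Finset (ℕ × ℕ)) (T U : ℝ) :
    IntervalIntegrable (fun x => tailSum l θ N P x ^ 2) MeasureTheory.volume T U := by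
  simp_rw [tailSum_sq]
  refine IntervalIntegrable.const_mul ?_ _
  simpa only [Finset.sum_fn] using IntervalIntegrable.sum P fun p _ => by
    simpa only [Finset.sum_fn] using IntervalIntegrable.sum P fun p' _ =>
      (intervalIntegrable_indicator_Ici_mul (continuous_oscTerm l θ p.1 p.2)
        (continuous_oscTerm l θ p'.1 p'.2) (tailStart θ N p.1 * p.2 ^ 2)
        (tailStart θ N p'.1 * p'.2 ^ 2) T U).const_mul
          (((-1 : ℝ) ^ (l * p.1) / p.1) * ((-1 : ℝ) ^ (l * p'.1) / p'.1))

lemma integral_tailSum_sq_le (l : ℕ) {θ T : ℝ} (hθ : 0 < θ) (hT : 0 < T) (N : ℕ)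
    {P : Finset (ℕ × ℕ)} (hP : ∀ p ∈ P, 1 ≤ p.1 ∧ 1 ≤ p.2) :
    ∫ x in T..(2 * T), tailSum l θ N P x ^ 2 ≤ normConst l ^ 2 * (2 * T) ^ (2 * (l - 1)) *
      ∑ p ∈ P.filter (fun p => tailStart θ N p.1 * p.2 ^ 2 ≤ 2 * T),
        ∑ p' ∈ P.filter (fun p => tailStart θ N p.1 * p.2 ^ 2 ≤ 2 * T),
          ((p.2 : ℝ) / p.1) * ((p'.2 : ℝ) / p'.1) *
            corrKernel T ((p.1 : ℚ) / p.2) ((p'.1 : ℚ) / p'.2) := by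
  set g : ℕ × ℕ → ℝ → ℝ := fun p =>
    (Set.Ici (tailStart θ N p.1 * p.2 ^ 2)).indicator (oscTerm l θ p.1 p.2) with hg
  set a : ℕ × ℕ → ℝ := fun p => (-1 : ℝ) ^ (l * p.1) / p.1 with ha
  have hgg : ∀ p p' : ℕ × ℕ, IntervalIntegrable (fun x => g p x * g p' x) MeasureTheory.volume
      T (2 * T) := fun p p' =>
    intervalIntegrable_indicator_Ici_mul (continuous_oscTerm l θ p.1 p.2)
      (continuous_oscTerm l θ p'.1 p'.2) _ _ T (2 * T)
  have e1 : ∫ x in T..(2 * T), tailSum l θ N P x ^ 2 =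
      normConst l ^ 2 * ∑ p ∈ P, ∑ p' ∈ P, a p * a p' * ∫ x in T..(2 * T), g p x * g p' x := by
    have : ∀ x, tailSum l θ N P x ^ 2 =
        normConst l ^ 2 * ∑ p ∈ P, ∑ p' ∈ P, a p * a p' * (g p x * g p' x) :=
      tailSum_sq l θ N P
    simp_rw [this]
    rw [intervalIntegral.integral_const_mul, intervalIntegral.integral_finsetSum fun p _ => by
      simpa only [Finset.sum_fn] using IntervalIntegrable.sum P fun p' _ =>
        (hgg p p').const_mul (a p * a p')]
    congr 1
    refine sum_congr rfl fun p _ => ?_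
    rw [intervalIntegral.integral_finsetSum fun p' _ => (hgg p p').const_mul (a p * a p')]
    exact sum_congr rfl fun p' _ => intervalIntegral.integral_const_mul _ _
  rw [e1, mul_assoc]
  refine mul_le_mul_of_nonneg_left ?_ (sq_nonneg _)
  rw [sum_filter, mul_sum]
  refine sum_le_sum fun p hp => ?_
  rw [sum_filter]
  have habs : ∀ p : ℕ × ℕ, |a p| = 1 / p.1 := fun p => by
    rw [ha, abs_div, abs_pow, abs_neg, abs_one, one_pow, Nat.abs_cast]
  have hpair : ∀ p' ∈ P, a p * a p' * ∫ x in T..(2 * T), g p x * g p' x ≤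
      if tailStart θ N p.1 * p.2 ^ 2 ≤ 2 * T ∧ tailStart θ N p'.1 * p'.2 ^ 2 ≤ 2 * T then
        (2 * T) ^ (2 * (l - 1)) * (((p.2 : ℝ) / p.1) * ((p'.2 : ℝ) / p'.1) *
            corrKernel T ((p.1 : ℚ) / p.2) ((p'.1 : ℚ) / p'.2)) else 0 := by
    intro p' hp'
    have h1 := abs_integral_indicator_mul_le l hθ hT N (hP p hp) (hP p' hp')
    refine (le_abs_self _).trans ?_
    rw [abs_mul, abs_mul, habs, habs]
    refine (mul_le_mul_of_nonneg_left h1 (by positivity)).trans_eq ?_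
    split_ifs
    · ring
    · rw [mul_zero]
  refine (sum_le_sum hpair).trans_eq ?_
  by_cases hc : tailStart θ N p.1 * (p.2 : ℝ) ^ 2 ≤ 2 * T
  · simp only [hc, true_and, if_true]
    rw [mul_sum]
    refine sum_congr rfl fun p' _ => ?_
    rw [mul_ite, mul_zero]
  · simp [hc]

lemma sum_sum_mul_comp_eq {α β : Type*} [DecidableEq β] (S : Finset α) (ρ : α → β) (w : α → ℝ)
    (κ : β → β → ℝ) :
    ∑ p ∈ S, ∑ p' ∈ S, w p * w p' * κ (ρ p) (ρ p') =
      ∑ q ∈ S.image ρ, ∑ q' ∈ S.image ρ,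
        (∑ p ∈ S with ρ p = q, w p) * (∑ p ∈ S with ρ p = q', w p) * κ q q' := by
  rw [← sum_fiberwise_of_maps_to (t := S.image ρ) (g := ρ) fun p hp => mem_image_of_mem ρ hp]
  refine sum_congr rfl fun q _ => ?_
  rw [sum_comm]
  rw [← sum_fiberwise_of_maps_to (t := S.image ρ) (g := ρ) fun p hp => mem_image_of_mem ρ hp]
  refine sum_congr rfl fun q' _ => ?_
  rw [sum_mul_sum, sum_mul, sum_comm]
  refine sum_congr rfl fun p hp => ?_
  rw [sum_mul]
  refine sum_congr rfl fun p' hp' => ?_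
  rw [(mem_filter.1 hp).2, (mem_filter.1 hp').2]

lemma sum_sum_mul_corrKernel_le {Q : Finset ℚ} {T g : ℝ} (hT : 0 ≤ T) (hg : 0 < g)
    (hQ : ∀ q ∈ Q, ∀ q' ∈ Q, q ≠ q' → g ≤ |(q : ℝ) - q'|) (W : ℚ → ℝ) :
    ∑ q ∈ Q, ∑ q' ∈ Q, W q * W q' * corrKernel T q q' ≤
      (T + 2 / g * (1 + Real.log #Q)) * ∑ q ∈ Q, W q ^ 2 := by
  have hsymm : ∀ q q', corrKernel T q q' = corrKernel T q' q := by
    intro q q'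
    unfold corrKernel
    simp only [eq_comm (a := q), abs_sub_comm (q : ℝ)]
  have hnn : ∀ q q', 0 ≤ corrKernel T q q' := by
    intro q q'
    unfold corrKernel
    split_ifs <;> positivity
  have h1 : ∑ q ∈ Q, ∑ q' ∈ Q, W q * W q' * corrKernel T q q' ≤
      ∑ q ∈ Q, ∑ q' ∈ Q, (W q ^ 2 / 2 * corrKernel T q q' + W q' ^ 2 / 2 * corrKernel T q q') := by
    refine sum_le_sum fun q _ => sum_le_sum fun q' _ => ?_
    rw [← add_mul]
    refine mul_le_mul_of_nonneg_right ?_ (hnn q q')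
    nlinarith [sq_nonneg (W q - W q')]
  have h2 : ∑ q ∈ Q, ∑ q' ∈ Q, W q' ^ 2 / 2 * corrKernel T q q' =
      ∑ q ∈ Q, ∑ q' ∈ Q, W q ^ 2 / 2 * corrKernel T q q' := by
    rw [sum_comm]
    exact sum_congr rfl fun q _ => sum_congr rfl fun q' _ => by rw [hsymm]
  refine h1.trans ?_
  simp_rw [sum_add_distrib]
  rw [h2, ← sum_add_distrib, mul_sum]
  refine sum_le_sum fun q hq => ?_
  rw [← mul_sum]
  have h3 : ∑ q' ∈ Q, corrKernel T q q' ≤ T + 2 / g * (1 + Real.log #Q) := by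
    rw [← add_sum_erase Q _ hq]
    refine add_le_add (by simp [corrKernel]) ?_
    refine le_trans (le_of_eq (sum_congr rfl fun q' hq' => ?_))
      (sum_one_div_dist_le Q (fun q : ℚ => (q : ℝ)) hg hQ hq)
    rw [corrKernel, if_neg (ne_of_mem_erase hq').symm]
  nlinarith [mul_le_mul_of_nonneg_left h3 (sq_nonneg (W q))]

lemma exists_eq_mul_num_den (h : ℕ) {m : ℕ} (hm : 1 ≤ m) :
    ∃ k : ℕ, h = k * ((h : ℚ) / m).num.natAbs ∧ m = k * ((h : ℚ) / m).den := by
  obtain ⟨c, h1, h2⟩ := Rat.exists_eq_mul_div_num_and_eq_mul_div_den (h : ℤ) (d := (m : ℤ))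
    (by omega)
  refine ⟨c.natAbs, ?_, ?_⟩
  · have := congrArg Int.natAbs h1
    simpa [Int.natAbs_mul] using this
  · have := congrArg Int.natAbs h2
    simpa [Int.natAbs_mul] using this

lemma one_le_num_den_le {h m : ℕ} (hh : 1 ≤ h) (hm : 1 ≤ m) :
    (1 ≤ ((h : ℚ) / m).num.natAbs ∧ ((h : ℚ) / m).num.natAbs ≤ h) ∧
      1 ≤ ((h : ℚ) / m).den ∧ ((h : ℚ) / m).den ≤ m := by
  obtain ⟨k, h1, h2⟩ := exists_eq_mul_num_den h hm
  have hk : 1 ≤ k := Nat.one_le_iff_ne_zero.2 fun h0 => by simp [h0] at h2; omega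
  refine ⟨⟨Nat.one_le_iff_ne_zero.2 fun h0 => ?_, ?_⟩, Rat.den_pos _, ?_⟩
  · rw [h0] at h1; omega
  · exact (Nat.le_mul_of_pos_left _ hk).trans_eq h1.symm
  · exact (Nat.le_mul_of_pos_left _ hk).trans_eq h2.symm

lemma sq_sum_fiber_le {S : Finset (ℕ × ℕ)} {N : ℕ} {K : ℝ} (hN : 1 ≤ N) (hK : 0 ≤ K)
    (hS : ∀ p ∈ S, (1 ≤ p.1 ∧ 1 ≤ p.2) ∧ (N : ℝ) ^ 2 * (p.2 : ℝ) ^ 6 ≤ K * (p.1 : ℝ) ^ 2) {q : ℚ}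
    (hq : q ∈ S.image fun p => (p.1 : ℚ) / p.2) :
    (∑ p ∈ S with (p.1 : ℚ) / p.2 = q, (p.2 : ℝ) / p.1) ^ 2 ≤
      Real.sqrt K / N * (1 / q.num.natAbs * (1 / q.den)) := by
  obtain ⟨p₀, hp₀, rfl⟩ := mem_image.1 hq
  obtain ⟨⟨ha, -⟩, hb, -⟩ := one_le_num_den_le (hS p₀ hp₀).1.1 (hS p₀ hp₀).1.2
  set q : ℚ := (p₀.1 : ℚ) / p₀.2 with hqd
  set a : ℕ := q.num.natAbs
  set b : ℕ := q.den
  have ha' : (0 : ℝ) < a := by exact_mod_cast ha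
  have hb' : (0 : ℝ) < b := by exact_mod_cast hb
  have hN' : (0 : ℝ) < N := by exact_mod_cast hN
  set X : ℝ := Real.sqrt (Real.sqrt K * a / (N * b ^ 3)) with hX
  have hrep : ∀ p ∈ S.filter (fun p => (p.1 : ℚ) / p.2 = q), ∃ k : ℕ, 1 ≤ k ∧ k ≤ ⌊X⌋₊ ∧
      p.1 = k * a ∧ p.2 = k * b := by
    intro p hp
    obtain ⟨hpS, hpq⟩ := mem_filter.1 hp
    obtain ⟨⟨hp1, hp2⟩, hp3⟩ := hS p hpS
    obtain ⟨k, h1, h2⟩ := exists_eq_mul_num_den p.1 hp2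
    rw [hpq] at h1 h2
    change p.1 = k * a at h1
    change p.2 = k * b at h2
    have hk : 1 ≤ k := Nat.one_le_iff_ne_zero.2 fun h0 => by
      rw [h0, zero_mul] at h2
      omega
    have hk' : (0 : ℝ) < k := by exact_mod_cast hk
    refine ⟨k, hk, Nat.le_floor (Real.le_sqrt_of_sq_le ?_), h1, h2⟩
    rw [le_div_iff₀ (by positivity)]
    rw [h1, h2] at hp3
    push_cast at hp3
    have h4 : (k : ℝ) ^ 2 * ((k : ℝ) ^ 2 * (N * b ^ 3)) ^ 2 ≤ (k : ℝ) ^ 2 * (Real.sqrt K * a) ^ 2 := by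
      rw [mul_pow (Real.sqrt K), Real.sq_sqrt hK]
      linarith
    exact (pow_le_pow_iff_left₀ (by positivity) (by positivity) two_ne_zero).1
      (le_of_mul_le_mul_left h4 (by positivity))
  have hcard : (#(S.filter fun p => (p.1 : ℚ) / p.2 = q) : ℝ) ≤ X := by
    have h1 : #(S.filter fun p => (p.1 : ℚ) / p.2 = q) ≤ #(Icc 1 ⌊X⌋₊) := by
      refine card_le_card_of_surjOn (fun k => (k * a, k * b)) fun p hp => ?_
      obtain ⟨k, hk1, hkX, e1, e2⟩ := hrep p hp
      exact ⟨k, by simp [hk1, hkX], Prod.ext e1.symm e2.symm⟩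
    rw [Nat.card_Icc, Nat.add_sub_cancel] at h1
    exact (Nat.cast_le.2 h1).trans (Nat.floor_le (Real.sqrt_nonneg _))
  have hterm : ∀ p ∈ S.filter (fun p => (p.1 : ℚ) / p.2 = q), (p.2 : ℝ) / p.1 = b / a := by
    intro p hp
    obtain ⟨k, hk1, -, e1, e2⟩ := hrep p hp
    have hk' : (k : ℝ) ≠ 0 := by positivity
    rw [e1, e2]
    push_cast
    exact mul_div_mul_left _ _ hk'
  rw [sum_congr rfl hterm, sum_const, nsmul_eq_mul, mul_pow]
  calc (#(S.filter fun p => (p.1 : ℚ) / p.2 = q) : ℝ) ^ 2 * ((b : ℝ) / a) ^ 2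
      ≤ X ^ 2 * ((b : ℝ) / a) ^ 2 := by gcongr
    _ = Real.sqrt K / N * (1 / a * (1 / b)) := by
      rw [hX, Real.sq_sqrt (by positivity)]
      field_simp

lemma sum_one_div_num_den_le {S : Finset (ℕ × ℕ)} {H M : ℕ}
    (hS : S ⊆ Icc 1 H ×ˢ Icc 1 M) :
    ∑ q ∈ S.image (fun p => (p.1 : ℚ) / p.2), (1 : ℝ) / q.num.natAbs * (1 / q.den) ≤
      (1 + Real.log H) * (1 + Real.log M) := by
  have h1 : ∑ q ∈ S.image (fun p => (p.1 : ℚ) / p.2), (1 : ℝ) / q.num.natAbs * (1 / q.den) ≤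
      ∑ p ∈ Icc 1 H ×ˢ Icc 1 M, (1 : ℝ) / p.1 * (1 / p.2) := by
    have hinj : Set.InjOn (fun q : ℚ => (q.num.natAbs, q.den))
        (S.image fun p => (p.1 : ℚ) / p.2) := by
      have hnn : ∀ q ∈ S.image (fun p => (p.1 : ℚ) / p.2), 0 ≤ q.num := by
        intro q hq
        obtain ⟨p, -, rfl⟩ := mem_image.1 hq
        exact Rat.num_nonneg.2 (by positivity)
      intro q hq q' hq' hqq
      simp only [Prod.mk.injEq] at hqq
      have h1 := hnn q hq
      have h2 := hnn q' hq'
      exact Rat.ext (by omega) hqq.2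
    rw [← sum_image (f := fun p : ℕ × ℕ => (1 : ℝ) / p.1 * (1 / p.2)) hinj]
    refine sum_le_sum_of_subset_of_nonneg ?_ fun _ _ _ => by positivity
    intro r hr
    obtain ⟨q, hq, rfl⟩ := mem_image.1 hr
    obtain ⟨p, hp, rfl⟩ := mem_image.1 hq
    have hp' := hS hp
    simp only [mem_product, mem_Icc] at hp' ⊢
    have := one_le_num_den_le hp'.1.1 hp'.2.1
    omega
  refine h1.trans ?_
  rw [sum_product]
  simp_rw [← mul_sum]
  rw [← sum_mul]
  have hnn : ∀ n : ℕ, (0 : ℝ) ≤ ∑ k ∈ Icc 1 n, (1 : ℝ) / k := fun n =>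
    sum_nonneg fun _ _ => by positivity
  exact mul_le_mul (sum_Icc_one_div_le H) (sum_Icc_one_div_le M) (hnn M)
    ((hnn H).trans (sum_Icc_one_div_le H))

lemma one_div_sq_le_abs_sub_ratio {h m h' m' M : ℕ} (hm : 1 ≤ m) (hm' : 1 ≤ m') (hM : m ≤ M)
    (hM' : m' ≤ M) (hne : (h : ℚ) / m ≠ (h' : ℚ) / m') :
    1 / (M : ℝ) ^ 2 ≤ |(((h : ℚ) / m : ℚ) : ℝ) - (((h' : ℚ) / m' : ℚ) : ℝ)| := by
  have hm0 : (0 : ℝ) < m := by exact_mod_cast hm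
  have hm0' : (0 : ℝ) < m' := by exact_mod_cast hm'
  have hne' : ((h * m' : ℤ) - h' * m) ≠ 0 := by
    intro h0
    apply hne
    rw [div_eq_div_iff (by positivity) (by positivity)]
    exact_mod_cast sub_eq_zero.1 h0
  have h1 : (1 : ℝ) ≤ |(h : ℝ) * m' - h' * m| := by
    have := Int.one_le_abs hne'
    exact_mod_cast this
  push_cast
  rw [div_sub_div _ _ hm0.ne' hm0'.ne', abs_div, abs_of_pos (mul_pos hm0 hm0'), mul_comm (m : ℝ) h']
  have : (m : ℝ) * m' ≤ M ^ 2 := by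
    rw [sq]
    gcongr
  exact div_le_div₀ (by positivity) h1 (by positivity) this

lemma sum_sum_ratio_mul_corrKernel_le {S : Finset (ℕ × ℕ)} {H M N : ℕ} {T K : ℝ} (hT : 0 ≤ T)
    (hM : 1 ≤ M) (hH : 1 ≤ H) (hN : 1 ≤ N) (hK : 0 ≤ K) (hSP : S ⊆ Icc 1 H ×ˢ Icc 1 M)
    (hS : ∀ p ∈ S, (N : ℝ) ^ 2 * (p.2 : ℝ) ^ 6 ≤ K * (p.1 : ℝ) ^ 2) :
    ∑ p ∈ S, ∑ p' ∈ S, ((p.2 : ℝ) / p.1) * ((p'.2 : ℝ) / p'.1) *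
        corrKernel T ((p.1 : ℚ) / p.2) ((p'.1 : ℚ) / p'.2) ≤
      (T + 2 * M ^ 2 * (1 + Real.log (H * M))) *
        (Real.sqrt K / N * ((1 + Real.log H) * (1 + Real.log M))) := by
  have hmem : ∀ p ∈ S, (1 ≤ p.1 ∧ p.1 ≤ H) ∧ 1 ≤ p.2 ∧ p.2 ≤ M := by
    intro p hp
    have := hSP hp
    simpa only [mem_product, mem_Icc] using this
  have hM' : (1 : ℝ) ≤ M := by exact_mod_cast hM
  have hH' : (1 : ℝ) ≤ H := by exact_mod_cast hH
  rw [sum_sum_mul_comp_eq S (fun p => (p.1 : ℚ) / p.2) (fun p => (p.2 : ℝ) / p.1) (corrKernel T)]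
  set Q := S.image (fun p => (p.1 : ℚ) / p.2) with hQ
  have hcard : (#Q : ℝ) ≤ H * M := by
    have h1 : #Q ≤ #(Icc 1 H ×ˢ Icc 1 M) := card_image_le.trans (card_le_card hSP)
    rw [card_product, Nat.card_Icc, Nat.card_Icc, Nat.add_sub_cancel, Nat.add_sub_cancel] at h1
    exact_mod_cast h1
  have hlog : Real.log #Q ≤ Real.log (H * M) := by
    rcases Nat.eq_zero_or_pos #Q with h0 | h0
    · rw [h0, Nat.cast_zero, Real.log_zero]
      exact Real.log_nonneg (one_le_mul_of_one_le_of_one_le hH' hM')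
    · exact Real.log_le_log (by exact_mod_cast h0) hcard
  refine (sum_sum_mul_corrKernel_le hT (g := 1 / (M : ℝ) ^ 2) (by positivity) ?_ _).trans ?_
  · intro q hq q' hq' hne
    obtain ⟨p, hp, rfl⟩ := mem_image.1 hq
    obtain ⟨p', hp', rfl⟩ := mem_image.1 hq'
    exact one_div_sq_le_abs_sub_ratio (hmem p hp).2.1 (hmem p' hp').2.1 (hmem p hp).2.2
      (hmem p' hp').2.2 hne
  have hL : 0 ≤ Real.log (H * M) :=
    Real.log_nonneg (one_le_mul_of_one_le_of_one_le hH' hM')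
  refine mul_le_mul ?_ ?_ (sum_nonneg fun _ _ => sq_nonneg _) (by positivity)
  · rw [div_div_eq_mul_div, div_one]
    gcongr
  · refine le_trans (sum_le_sum fun q hq => sq_sum_fiber_le hN hK (fun p hp =>
      ⟨⟨(hmem p hp).1.1, (hmem p hp).2.1⟩, hS p hp⟩) hq) ?_
    rw [← mul_sum]
    exact mul_le_mul_of_nonneg_left (sum_one_div_num_den_le hSP) (by positivity)

lemma exists_integral_tailSum_sq_le {l : ℕ} (hl : 1 ≤ l) {θ : ℝ} (hθ : 0 < θ) {δ : ℝ}
    (hδ : 0 < δ) :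
    ∃ C, 0 < C ∧ ∀ (T : ℝ) (N : ℕ), 1 ≤ T → θ ≤ T → 1 ≤ N →
      ∫ x in T..(2 * T),
        tailSum l θ N (Icc 1 ⌊T ^ 2⌋₊ ×ˢ Icc 1 ⌊Real.sqrt (2 * T / θ)⌋₊) x ^ 2 ≤
      C * (T ^ (2 * l) * Real.sqrt T / N * T ^ δ) := by
  set η := δ / 9 with hη
  set κ : ℝ := 2 / θ + 1 with hκ
  have hη0 : 0 < η := by positivity
  have hκ1 : 1 ≤ κ := by
    have : 0 < 2 / θ := by positivity
    linarith
  set A : ℝ := (1 + 1 / η) * κ ^ η with hA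
  have hA0 : 0 < A := by positivity
  have hnc := normConst_pos l
  refine ⟨normConst l ^ 2 * 2 ^ (2 * (l - 1)) * ((1 + 4 / θ) * Real.sqrt (8 / θ ^ 3)) * A ^ 3,
    by positivity, fun T N hT hTθ hN => ?_⟩
  have hT0 : 0 < T := by linarith
  set H := ⌊T ^ 2⌋₊ with hH
  set M := ⌊Real.sqrt (2 * T / θ)⌋₊ with hM
  have hH1 : 1 ≤ H := Nat.le_floor (by exact_mod_cast one_le_pow₀ hT)
  have hM1 : 1 ≤ M := by
    refine Nat.le_floor ?_
    rw [Nat.cast_one, Real.one_le_sqrt, one_le_div hθ]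
    linarith
  have hH1' : (1 : ℝ) ≤ H := by exact_mod_cast hH1
  have hM1' : (1 : ℝ) ≤ M := by exact_mod_cast hM1
  have hHT : (H : ℝ) ≤ T ^ 2 := Nat.floor_le (by positivity)
  have hM2 : (M : ℝ) ^ 2 ≤ 2 * T / θ :=
    (pow_le_pow_left₀ (by positivity) (Nat.floor_le (Real.sqrt_nonneg _)) 2).trans_eq
      (Real.sq_sqrt (by positivity))
  have hMT : (M : ℝ) ≤ κ * T := by
    have h1 : (M : ℝ) ≤ M ^ 2 := by nlinarith
    have h2 : 2 * T / θ = (2 / θ) * T := by ring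
    rw [hκ]
    linarith
  have hHM : (H : ℝ) * M ≤ κ * T ^ 3 := by
    calc (H : ℝ) * M ≤ T ^ 2 * (κ * T) := by gcongr
      _ = κ * T ^ 3 := by ring
  have hHM1 : (1 : ℝ) ≤ H * M := one_le_mul_of_one_le_of_one_le hH1' hM1'
  set Λ := A * (T ^ (δ / 3)) with hΛ
  have hlog : ∀ y : ℝ, 1 ≤ y → y ≤ H * M → 1 + Real.log y ≤ Λ := by
    intro y hy1 hy
    have hy0 : 0 ≤ y := by linarith
    refine (one_add_log_le_rpow hη0 hy1).trans ?_
    rw [hΛ, hA, mul_assoc]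
    have h1 : y ^ η ≤ (κ * T ^ 3) ^ η :=
      Real.rpow_le_rpow hy0 (hy.trans hHM) hη0.le
    have h2 : (κ * T ^ 3) ^ η = κ ^ η * T ^ (δ / 3) := by
      rw [Real.mul_rpow (by positivity) (by positivity), ← Real.rpow_natCast, ← Real.rpow_mul hT0.le]
      congr 2
      rw [hη]
      push_cast
      ring
    rw [h2] at h1
    exact mul_le_mul_of_nonneg_left h1 (by positivity)
  have hlog1 := hlog _ hHM1 le_rfl
  have hlog2 := hlog _ hH1' (le_mul_of_one_le_right (by positivity) hM1')
  have hlog3 := hlog _ hM1' (le_mul_of_one_le_left (by positivity) hH1')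
  have hl1 : 0 ≤ Real.log (H * M) := Real.log_nonneg hHM1
  have hl2 : 0 ≤ Real.log H := Real.log_nonneg hH1'
  have hl3 : 0 ≤ Real.log M := Real.log_nonneg hM1'
  have hΛ1 : 1 ≤ Λ := by linarith
  have hP : ∀ p ∈ Icc 1 H ×ˢ Icc 1 M, 1 ≤ p.1 ∧ 1 ≤ p.2 := by
    intro p hp
    simp only [mem_product, mem_Icc] at hp
    exact ⟨hp.1.1, hp.2.1⟩
  have hsqrt : Real.sqrt ((2 * T) ^ 3 / θ ^ 3) = Real.sqrt (8 / θ ^ 3) * (T * Real.sqrt T) := by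
    have : (2 * T) ^ 3 / θ ^ 3 = (8 / θ ^ 3) * (T ^ 2 * T) := by ring
    rw [this, Real.sqrt_mul (by positivity), Real.sqrt_mul (by positivity), Real.sqrt_sq hT0.le]
  have hkey := sum_sum_ratio_mul_corrKernel_le (S := (Icc 1 H ×ˢ Icc 1 M).filter
      (fun p => tailStart θ N p.1 * p.2 ^ 2 ≤ 2 * T)) (K := (2 * T) ^ 3 / θ ^ 3) hT0.le hM1 hH1 hN
    (by positivity) (filter_subset _ _) (by
      intro p hp
      obtain ⟨h1, h2⟩ := mem_filter.1 hp
      exact sq_mul_pow_six_le hθ hN (hP p h1).1 h2)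
  refine (integral_tailSum_sq_le l hθ hT0 N hP).trans ?_
  refine (mul_le_mul_of_nonneg_left hkey (by positivity)).trans ?_
  have hfac : (T + 2 * M ^ 2 * (1 + Real.log (H * M))) ≤ (1 + 4 / θ) * T * Λ := by
    calc (T + 2 * M ^ 2 * (1 + Real.log (H * M))) ≤ T * Λ + 2 * (2 * T / θ) * Λ := by
          gcongr
          exact le_mul_of_one_le_right hT0.le hΛ1
      _ = (1 + 4 / θ) * T * Λ := by ring
  have hfac2 : (1 + Real.log H) * (1 + Real.log M) ≤ Λ * Λ := by gcongr
  have hΛ3 : Λ ^ 3 = A ^ 3 * T ^ δ := by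
    rw [hΛ, mul_pow, ← Real.rpow_natCast (T ^ (δ / 3)), ← Real.rpow_mul hT0.le]
    congr 2
    push_cast
    ring
  rw [hsqrt]
  have hTl : T ^ (2 * l) = T ^ (2 * (l - 1)) * T ^ 2 := by
    rw [← pow_add]
    congr 1
    omega
  calc normConst l ^ 2 * (2 * T) ^ (2 * (l - 1)) * ((T + 2 * M ^ 2 * (1 + Real.log (H * M))) *
        (Real.sqrt (8 / θ ^ 3) * (T * Real.sqrt T) / N * ((1 + Real.log H) * (1 + Real.log M))))
      ≤ normConst l ^ 2 * (2 * T) ^ (2 * (l - 1)) * (((1 + 4 / θ) * T * Λ) *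
        (Real.sqrt (8 / θ ^ 3) * (T * Real.sqrt T) / N * (Λ * Λ))) := by
        refine mul_le_mul_of_nonneg_left ?_ (by positivity)
        refine mul_le_mul hfac (mul_le_mul_of_nonneg_left hfac2 (by positivity)) (by positivity)
          (by positivity)
    _ = normConst l ^ 2 * 2 ^ (2 * (l - 1)) * ((1 + 4 / θ) * Real.sqrt (8 / θ ^ 3)) * Λ ^ 3 *
        (T ^ (2 * l) * Real.sqrt T / N) := by
        rw [hTl, mul_pow 2 T]
        ring
    _ = _ := by
        rw [hΛ3]
        ring

lemma abs_integral_sq_sub_le {f A t : ℝ → ℝ} {T η D : ℝ} (hT : 0 < T) (hη : 0 < η)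
    (hf : IntervalIntegrable (fun x => f x ^ 2) MeasureTheory.volume T (2 * T))
    (hA : IntervalIntegrable (fun x => A x ^ 2) MeasureTheory.volume T (2 * T))
    (ht : IntervalIntegrable (fun x => t x ^ 2) MeasureTheory.volume T (2 * T))
    (hD : ∀ x ∈ Set.Icc T (2 * T), |f x - A x - t x| ≤ D) :
    |(∫ x in T..(2 * T), f x ^ 2) - ∫ x in T..(2 * T), A x ^ 2| ≤
      η * (∫ x in T..(2 * T), A x ^ 2) +
        (1 + 1 / η) * (2 * (∫ x in T..(2 * T), t x ^ 2) + 2 * (D ^ 2 * T)) := by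
  have hTT : T ≤ 2 * T := by linarith
  have hpt : ∀ x ∈ Set.Icc T (2 * T), |f x ^ 2 - A x ^ 2| ≤
      η * A x ^ 2 + (1 + 1 / η) * (2 * t x ^ 2 + 2 * D ^ 2) := by
    intro x hx
    set e := f x - A x - t x with he
    have h1 : e ^ 2 ≤ D ^ 2 := sq_le_sq' (abs_le.1 (hD x hx)).1 (abs_le.1 (hD x hx)).2
    have h2 : (t x + e) ^ 2 ≤ 2 * t x ^ 2 + 2 * D ^ 2 := by
      nlinarith [sq_nonneg (t x - e)]
    have h3 : f x = A x + (t x + e) := by rw [he]; ring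
    have h4 : 2 * |A x * (t x + e)| ≤ η * A x ^ 2 + 1 / η * (t x + e) ^ 2 := by
      have h5 : (η * |A x| - |t x + e|) ^ 2 / η =
          η * A x ^ 2 + 1 / η * (t x + e) ^ 2 - 2 * |A x * (t x + e)| := by
        rw [abs_mul, ← sq_abs (A x), ← sq_abs (t x + e)]
        field_simp
        ring
      have h6 : 0 ≤ (η * |A x| - |t x + e|) ^ 2 / η := by positivity
      linarith
    have h5 : f x ^ 2 - A x ^ 2 = 2 * (A x * (t x + e)) + (t x + e) ^ 2 := by
      rw [h3]
      ring
    rw [h5]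
    refine (abs_add_le _ _).trans ?_
    rw [abs_mul, abs_two, abs_of_nonneg (sq_nonneg (t x + e))]
    have h6 : (1 + 1 / η) * (t x + e) ^ 2 ≤ (1 + 1 / η) * (2 * t x ^ 2 + 2 * D ^ 2) :=
      mul_le_mul_of_nonneg_left h2 (by positivity)
    linarith
  have hi1 := hA.const_mul η
  have hi2 : IntervalIntegrable (fun x => 2 * t x ^ 2 + 2 * D ^ 2) MeasureTheory.volume T (2 * T) :=
    (ht.const_mul 2).add intervalIntegrable_const
  have hi3 := hi2.const_mul (1 + 1 / η)
  rw [← intervalIntegral.integral_sub hf hA]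
  refine (intervalIntegral.abs_integral_le_integral_abs hTT).trans ?_
  refine (intervalIntegral.integral_mono_on hTT (hf.sub hA).abs (hi1.add hi3) hpt).trans_eq ?_
  rw [intervalIntegral.integral_add hi1 hi3, intervalIntegral.integral_const_mul,
    intervalIntegral.integral_const_mul, intervalIntegral.integral_add (ht.const_mul 2)
    intervalIntegrable_const, intervalIntegral.integral_const_mul,
    intervalIntegral.integral_const, smul_eq_mul]
  ring

lemma intervalIntegrable_R1_sq (l : ℕ) {θ T : ℝ} (hθ : 0 < θ) (hT : 0 < T) (H : ℝ) :
    IntervalIntegrable (fun x => R1 l θ x H ^ 2) MeasureTheory.volume T (2 * T) := by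
  refine (intervalIntegrable_tailSum_sq l θ 0
    (Icc 1 ⌊H⌋₊ ×ˢ Icc 1 ⌊Real.sqrt (2 * T / θ)⌋₊) T (2 * T)).congr fun x hx => ?_
  rw [Set.uIoc_of_le (by linarith)] at hx
  have h1 := R1_eq_headSum_add_tailSum l hθ (H := H) (hT.trans hx.1) hx.2 (Nat.zero_le _)
  have h2 : headSum l θ 0 x = 0 := by simp [headSum]
  rw [h2, zero_add] at h1
  exact congrArg (· ^ 2) h1.symm

lemma continuousOn_mainSum (l : ℕ) (θ : ℝ) (N : ℕ) {T U : ℝ} (hT : 0 < T) :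
    ContinuousOn (mainSum l θ N) (Set.Icc T U) := by
  unfold mainSum
  refine ContinuousOn.mul ?_ (by fun_prop)
  refine continuousOn_const.mul (ContinuousOn.rpow_const continuousOn_id fun x hx => ?_)
  exact Or.inl (hT.trans_le hx.1).ne'

lemma integral_rpow_le (l : ℕ) {T : ℝ} (hT : 0 < T) :
    0 ≤ ∫ x in T..(2 * T), x ^ (2 * (l : ℝ) - 1 / 2) ∧
      ∫ x in T..(2 * T), x ^ (2 * (l : ℝ) - 1 / 2) ≤ 2 ^ (2 * l) * (T ^ (2 * l) * Real.sqrt T) := by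
  have hTT : T ≤ 2 * T := by linarith
  refine ⟨intervalIntegral.integral_nonneg hTT fun x hx =>
    Real.rpow_nonneg (hT.le.trans hx.1) _, ?_⟩
  have h1 : ∀ x ∈ Set.uIoc T (2 * T),
      ‖x ^ (2 * (l : ℝ) - 1 / 2)‖ ≤ (2 * T) ^ (2 * l) / Real.sqrt T := by
    intro x hx
    rw [Set.uIoc_of_le hTT] at hx
    have hx0 := hT.trans hx.1
    rw [rpow_two_mul_sub_half l hx0, Real.norm_of_nonneg (by positivity)]
    have := hx.2
    have := hx.1.le
    gcongr
  have h2 := intervalIntegral.norm_integral_le_of_norm_le_const h1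
  refine (Real.le_norm_self _).trans (h2.trans_eq ?_)
  have h3 : |2 * T - T| = Real.sqrt T * Real.sqrt T := by
    rw [Real.mul_self_sqrt hT.le, abs_of_pos (by linarith)]
    ring
  rw [h3, mul_pow]
  have : Real.sqrt T ≠ 0 := by positivity
  field_simp

lemma two_zpow_div_eq_normConst_sq (l : ℕ) :
    (2 : ℝ) ^ ((3 : ℤ) - 2 * l) / (Real.pi ^ 2 * ((l - 1).factorial : ℝ) ^ 2) =
      1 / 2 * normConst l ^ 2 := by
  unfold normConst
  have : (2 : ℝ) ^ ((3 : ℤ) - 2 * l) = 1 / 2 * ((2 : ℝ) ^ ((2 : ℤ) - l)) ^ 2 := by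
    rw [← zpow_natCast, ← zpow_mul, one_div, ← zpow_neg_one, ← zpow_add₀ two_ne_zero]
    congr 1
    push_cast
    ring
  rw [this]
  field_simp

/-- The truncation length `⌊T ^ (1 / (4γ + 2))⌋` and the estimates it satisfies. -/
lemma exists_truncation {γ ε T : ℝ} (hγ : 1 ≤ γ) (hε : 0 < ε) (hT : 1 ≤ T) :
    ∃ N : ℕ, 1 ≤ N ∧ N ≤ ⌊T ^ 2⌋₊ ∧
      (1 : ℝ) / N ≤ 2 * (T ^ (-(1 / (8 * γ + 4)))) ^ 2 ∧
      (N : ℝ) ^ (-(1 : ℝ) / 2) ≤ 2 * T ^ (-(1 / (8 * γ + 4))) ∧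
      (N : ℝ) ^ (2 * γ + ε) ≤ Real.sqrt T * (T ^ (-(1 / (8 * γ + 4)))) ^ 2 * T ^ ε := by
  have hT0 : 0 < T := by linarith
  set e : ℝ := 1 / (8 * γ + 4) with he
  have hden : 0 < 8 * γ + 4 := by linarith
  have he0 : 0 < e := by positivity
  have he1 : 2 * e ≤ 1 := by
    rw [he, ← mul_div_assoc, div_le_one hden]
    linarith
  have heγ : 2 * e * (2 * γ) = 1 / 2 - 2 * e := by
    rw [he]
    field_simp
    ring
  set y : ℝ := T ^ (2 * e) with hy
  have hy1 : 1 ≤ y := Real.one_le_rpow hT (by positivity)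
  have hyz : (T ^ (-e)) ^ 2 = y⁻¹ := by
    rw [hy, ← Real.rpow_natCast, ← Real.rpow_mul hT0.le, ← Real.rpow_neg hT0.le]
    congr 1
    push_cast
    ring
  set N := ⌊y⌋₊ with hN
  have hN1 : 1 ≤ N := Nat.le_floor (by exact_mod_cast hy1)
  have hN1' : (1 : ℝ) ≤ N := by exact_mod_cast hN1
  have hNy : (N : ℝ) ≤ y := Nat.floor_le (by positivity)
  have hyN : y ≤ 2 * N := by
    have := Nat.lt_floor_add_one y
    linarith
  have hinv : (1 : ℝ) / N ≤ 2 * (T ^ (-e)) ^ 2 := by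
    rw [hyz, div_le_iff₀ (by positivity), mul_right_comm, ← div_eq_mul_inv,
      one_le_div (by positivity)]
    exact hyN
  refine ⟨N, hN1, Nat.floor_mono ?_, hinv, ?_, ?_⟩
  · rw [hy, ← Real.rpow_natCast]
    exact Real.rpow_le_rpow_of_exponent_le hT (by push_cast; linarith)
  · have h1 : ((N : ℝ) ^ (-(1 : ℝ) / 2)) ^ 2 = 1 / N := by
      rw [← Real.rpow_natCast, ← Real.rpow_mul (by positivity), one_div, ← Real.rpow_neg_one]
      norm_num
    have h2 : ((N : ℝ) ^ (-(1 : ℝ) / 2)) ^ 2 ≤ (2 * T ^ (-e)) ^ 2 := by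
      rw [h1, mul_pow]
      refine hinv.trans ?_
      gcongr
      norm_num
    exact (pow_le_pow_iff_left₀ (by positivity) (by positivity) two_ne_zero).1 h2
  · have h1 : (N : ℝ) ^ (2 * γ + ε) ≤ y ^ (2 * γ + ε) :=
      Real.rpow_le_rpow (by positivity) hNy (by linarith)
    refine h1.trans ?_
    rw [hyz, hy, Real.sqrt_eq_rpow, ← Real.rpow_neg hT0.le, ← Real.rpow_add hT0, ← Real.rpow_add hT0,
      ← Real.rpow_mul hT0.le]
    refine Real.rpow_le_rpow_of_exponent_le hT ?_
    nlinarith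

/-- Estimate (5.26), mean square of `R₁` (explicit core of Theorem 1): for `l ≥ 1` and
irrational `θ > 0` of finite approximation type `γ ≥ 1`, for every `ε > 0` there are
`C > 0` and `T₀ ≥ 3` such that for all `T ≥ T₀`, with `H = T²`:
`|∫_T^{2T} R₁(x,H)² dx − (2^{3−2l}·C_{l,θ}/(π²·((l−1)!)²))·∫_T^{2T} x^{2l−1/2} dx|
  ≤ C·T^{2l + (4γ+1)/(8γ+4) + ε}`. -/
theorem R1_mean_square (l : ℕ) (hl : 1 ≤ l) (θ γ : ℝ) (hθ : 0 < θ)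
    (hirr : Irrational θ) (htype : IsApproxType θ γ) (ε : ℝ) (hε : 0 < ε) :
    ∃ C : ℝ, 0 < C ∧ ∃ T₀ : ℝ, 3 ≤ T₀ ∧ ∀ T : ℝ, T₀ ≤ T →
      |(∫ x in T..(2 * T), (R1 l θ x (T ^ 2)) ^ 2) -
          ((2 : ℝ) ^ ((3 : ℤ) - 2 * l) * Cconst l θ /
              (Real.pi ^ 2 * ((l - 1).factorial : ℝ) ^ 2)) *
            ∫ x in T..(2 * T), x ^ (2 * (l : ℝ) - 1 / 2)| ≤
        C * T ^ (2 * (l : ℝ) + (4 * γ + 1) / (8 * γ + 4) + ε) := by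
  have hγ := htype.1
  obtain ⟨C₁, hC₁, hmain⟩ := exists_abs_integral_mainSum_sq_sub_le l hθ htype hε
  obtain ⟨C₂, hC₂, hconst⟩ := exists_Cconst_bounds l hθ
  obtain ⟨C₃, hC₃, htail⟩ := exists_integral_tailSum_sq_le hl hθ hε
  obtain ⟨C₄, hC₄, hhead⟩ := exists_abs_headSum_sub_mainSum_le hl hθ htype (half_pos hε)
  set c := 1 / 2 * normConst l ^ 2 with hc
  have hc0 : 0 < c := by
    have := normConst_pos l
    positivity
  have hCc : 0 ≤ Cconst l θ := (sum_nonneg fun _ _ => sq_nonneg _).trans (hconst 1 le_rfl).1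
  refine ⟨c * Cconst l θ * 2 ^ (2 * l) + 2 * C₁ + 8 * C₃ + 4 * (C₄ ^ 2 * 2 ^ (2 * l - 1)) +
    c * C₂ * 2 * 2 ^ (2 * l), by positivity, max 3 θ, le_max_left _ _, fun T hT => ?_⟩
  have hT1 : 1 ≤ T := by linarith [le_max_left 3 θ]
  have hTθ : θ ≤ T := (le_max_right _ _).trans hT
  have hT0 : 0 < T := by linarith
  have hTT : T ≤ 2 * T := by linarith
  obtain ⟨N, hN1, hNT, hN2, hN3, hN4⟩ := exists_truncation hγ hε hT1
  have hden : 0 < 8 * γ + 4 := by linarith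
  set Z := T ^ (-(1 / (8 * γ + 4))) with hZ
  have hZ0 : 0 < Z := by positivity
  have hZ1 : Z ≤ 1 := Real.rpow_le_one_of_one_le_of_nonpos hT1 (by
    rw [neg_nonpos]
    positivity)
  set E := T ^ ε with hE
  have hE1 : 1 ≤ E := Real.one_le_rpow hT1 hε.le
  set Y := T ^ (2 * l) * Real.sqrt T with hY
  have hY0 : 0 < Y := by positivity
  have hNY : T ^ (2 * l) * (N : ℝ) ^ (2 * γ + ε) ≤ Y * Z ^ 2 * E := by
    calc T ^ (2 * l) * (N : ℝ) ^ (2 * γ + ε) ≤ T ^ (2 * l) * (Real.sqrt T * Z ^ 2 * E) :=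
          mul_le_mul_of_nonneg_left hN4 (by positivity)
      _ = Y * Z ^ 2 * E := by rw [hY]; ring
  have htarget : T ^ (2 * (l : ℝ) + (4 * γ + 1) / (8 * γ + 4) + ε) = Y * Z * E := by
    rw [hY, hZ, hE, Real.sqrt_eq_rpow, ← Real.rpow_natCast T, ← Real.rpow_add hT0,
      ← Real.rpow_add hT0, ← Real.rpow_add hT0]
    congr 1
    push_cast
    field_simp
    ring
  rw [htarget, mul_div_right_comm, two_zpow_div_eq_normConst_sq]
  obtain ⟨hI0, hI1⟩ := integral_rpow_le l hT0
  set I := ∫ x in T..(2 * T), x ^ (2 * (l : ℝ) - 1 / 2) with hI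
  set S := ∑ p ∈ freqSet θ N, uCoef l θ p.1 p.2 ^ 2 with hS
  set P := Icc 1 ⌊T ^ 2⌋₊ ×ˢ Icc 1 ⌊Real.sqrt (2 * T / θ)⌋₊ with hP
  set D := C₄ * ((2 * T) ^ (l - 1) * Real.sqrt (2 * T) * (N : ℝ) ^ (γ + ε / 2)) with hD
  have hmainInt : IntervalIntegrable (fun x => mainSum l θ N x ^ 2) MeasureTheory.volume T
      (2 * T) := by
    refine ContinuousOn.intervalIntegrable ?_
    rw [Set.uIcc_of_le hTT]
    exact (continuousOn_mainSum l θ N hT0).pow 2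
  have hcomp := abs_integral_sq_sub_le (f := fun x => R1 l θ x (T ^ 2)) (A := mainSum l θ N)
    (t := tailSum l θ N P) (D := D) hT0 hZ0 (intervalIntegrable_R1_sq l hθ hT0 _) hmainInt
    (intervalIntegrable_tailSum_sq l θ N P T (2 * T)) (by
      intro x hx
      have hx0 := hT0.trans_le hx.1
      rw [R1_eq_headSum_add_tailSum l hθ hx0 hx.2 hNT]
      rw [show headSum l θ N x + tailSum l θ N P x - mainSum l θ N x - tailSum l θ N P x =
        headSum l θ N x - mainSum l θ N x by ring]
      refine (hhead x N hx0 hN1).trans ?_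
      have := hx.2
      rw [hD]
      gcongr)
  have hD2 : D ^ 2 * T ≤ C₄ ^ 2 * 2 ^ (2 * l - 1) * (Y * Z ^ 2 * E) := by
    have h1 : D ^ 2 * T = C₄ ^ 2 * 2 ^ (2 * l - 1) * (T ^ (2 * l) * (N : ℝ) ^ (2 * γ + ε)) := by
      obtain ⟨k, rfl⟩ := Nat.exists_eq_add_of_le hl
      have h2 : ((N : ℝ) ^ (γ + ε / 2)) ^ 2 = (N : ℝ) ^ (2 * γ + ε) := by
        rw [← Real.rpow_natCast, ← Real.rpow_mul (by positivity)]
        congr 1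
        push_cast
        ring
      rw [hD, mul_pow, mul_pow, mul_pow, h2, Real.sq_sqrt (by positivity),
        show 1 + k - 1 = k by omega, show 2 * (1 + k) - 1 = 2 * k + 1 by omega]
      ring
    rw [h1]
    exact mul_le_mul_of_nonneg_left hNY (by positivity)
  have htail' : ∫ x in T..(2 * T), tailSum l θ N P x ^ 2 ≤ 2 * C₃ * (Y * Z ^ 2 * E) := by
    refine (htail T N hT1 hTθ hN1).trans ?_
    calc C₃ * (Y / N * E) = C₃ * Y * E * (1 / N) := by ring
      _ ≤ C₃ * Y * E * (2 * Z ^ 2) := by gcongr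
      _ = _ := by ring
  have hmain' := (hmain T N hT0 hN1).trans (mul_le_mul_of_nonneg_left hNY hC₁.le)
  rw [← hS, ← hI] at hmain'
  set a := ∫ x in T..(2 * T), mainSum l θ N x ^ 2 with ha
  obtain ⟨hS1, hS2⟩ := hconst N hN1
  rw [← hS] at hS1 hS2
  have hSI : |c * S * I - c * Cconst l θ * I| ≤ c * C₂ * 2 * 2 ^ (2 * l) * (Y * Z) := by
    have h1 : c * S * I - c * Cconst l θ * I = -(c * (Cconst l θ - S) * I) := by ring
    rw [h1, abs_neg, abs_of_nonneg (mul_nonneg (mul_nonneg hc0.le (by linarith)) hI0)]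
    calc c * (Cconst l θ - S) * I ≤ c * (C₂ * (2 * Z)) * (2 ^ (2 * l) * Y) := by
          have : Cconst l θ - S ≤ C₂ * (2 * Z) :=
            (by linarith : Cconst l θ - S ≤ C₂ * (N : ℝ) ^ (-(1 : ℝ) / 2)).trans (by gcongr)
          gcongr
      _ = _ := by ring
  have hZE : Y * Z ^ 2 * E ≤ Y * Z * E := by
    gcongr
    nlinarith
  have hYZ : Y * Z ≤ Y * Z * E := le_mul_of_one_le_right (by positivity) hE1
  have ha1 : Z * a ≤ (c * Cconst l θ * 2 ^ (2 * l) + C₁) * (Y * Z * E) := by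
    have h1 : a ≤ c * Cconst l θ * (2 ^ (2 * l) * Y) + C₁ * (Y * Z ^ 2 * E) := by
      have h2 : c * S * I ≤ c * Cconst l θ * (2 ^ (2 * l) * Y) := by gcongr
      have h3 : 1 / 2 * (normConst l ^ 2 * S) * I = c * S * I := by rw [hc]; ring
      have h4 := (abs_le.1 hmain').2
      linarith
    have h5 : Z * (Y * Z ^ 2 * E) ≤ Y * Z * E :=
      (mul_le_of_le_one_left (by positivity) hZ1).trans hZE
    have h6 : Z * a ≤ c * Cconst l θ * 2 ^ (2 * l) * (Y * Z) + C₁ * (Z * (Y * Z ^ 2 * E)) :=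
      (mul_le_mul_of_nonneg_left h1 hZ0.le).trans_eq (by ring)
    refine h6.trans ?_
    rw [add_mul]
    gcongr
  have herr : (1 + 1 / Z) * (2 * (∫ x in T..(2 * T), tailSum l θ N P x ^ 2) + 2 * (D ^ 2 * T)) ≤
      (8 * C₃ + 4 * (C₄ ^ 2 * 2 ^ (2 * l - 1))) * (Y * Z * E) := by
    have h1 : 1 + 1 / Z ≤ 2 / Z := by
      have : 1 ≤ 1 / Z := (one_le_div hZ0).2 hZ1
      have h2 : 2 / Z = 1 / Z + 1 / Z := by ring
      linarith
    calc (1 + 1 / Z) * (2 * (∫ x in T..(2 * T), tailSum l θ N P x ^ 2) + 2 * (D ^ 2 * T))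
        ≤ (1 + 1 / Z) * (2 * (2 * C₃ * (Y * Z ^ 2 * E)) +
          2 * (C₄ ^ 2 * 2 ^ (2 * l - 1) * (Y * Z ^ 2 * E))) := by gcongr
      _ ≤ 2 / Z * (2 * (2 * C₃ * (Y * Z ^ 2 * E)) +
          2 * (C₄ ^ 2 * 2 ^ (2 * l - 1) * (Y * Z ^ 2 * E))) := by gcongr
      _ = _ := by
        field_simp
        ring
  have hm2 : C₁ * (Y * Z ^ 2 * E) ≤ C₁ * (Y * Z * E) := by gcongr
  have hs2 : c * C₂ * 2 * 2 ^ (2 * l) * (Y * Z) ≤ c * C₂ * 2 * 2 ^ (2 * l) * (Y * Z * E) := by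
    gcongr
  have hm3 : |a - c * S * I| ≤ C₁ * (Y * Z ^ 2 * E) := by
    rw [hc]
    refine le_trans (le_of_eq ?_) hmain'
    congr 1
    ring
  have hfin := (abs_sub_le (∫ x in T..(2 * T), R1 l θ x (T ^ 2) ^ 2) a (c * Cconst l θ * I)).trans
    (add_le_add hcomp ((abs_sub_le a (c * S * I) _).trans (add_le_add hm3 hSI)))
  linarith
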